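/- Let K be an algebraically closed field, A a finite dimensional K-algebra, and θ an integer-valued stability function (lattice point) on mod A. If the torsion class \bar T_θ is not functorially finite, then there exists an infinite semibrick 𝒮 in mod A such that \bar T_θ = T(𝒮), the smallest torsion class containing 𝒮. -/

import Mathlib

namespace TorsPaper

variable (A : Type) [Ring A]

/-- `N` is (isomorphic to) a factor module of `M`. -/
def IsQuotientOf (N M : ModuleCat.{0} A) : Prop :=
  ∃ f : M →ₗ[A] N, Function.Surjective f

/-- `L` is (isomorphic to) a submodule of `M`. -/
def IsSubmoduleOf (L M : ModuleCat.{0} A) : Prop :=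
  ∃ f : L →ₗ[A] M, Function.Injective f

/-- `M` is a nonzero module. -/
def Nonzero (M : ModuleCat.{0} A) : Prop := ∃ x : M, x ≠ 0

/-- A torsion class in `mod A`: a class of finitely generated modules, containing the zero
modules, closed under isomorphisms (which follows from `quot`), factor modules and
extensions. -/
structure IsTorsionClass (T : ModuleCat.{0} A → Prop) : Prop where
  fin : ∀ M, T M → Module.Finite A M
  zero : ∀ M : ModuleCat.{0} A, (∀ x : M, x = 0) → T M
  quot : ∀ M N : ModuleCat.{0} A, T M → Module.Finite A N → IsQuotientOf A N M → T N
  ext : ∀ M : ModuleCat.{0} A, Module.Finite A M → ∀ N : Submodule A M,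
    T (ModuleCat.of A N) → T (ModuleCat.of A (M ⧸ N)) → T M

/-- A torsion-free class in `mod A`. -/
structure IsTorsionFreeClass (F : ModuleCat.{0} A → Prop) : Prop where
  fin : ∀ M, F M → Module.Finite A M
  zero : ∀ M : ModuleCat.{0} A, (∀ x : M, x = 0) → F M
  sub : ∀ M N : ModuleCat.{0} A, F M → Module.Finite A N → IsSubmoduleOf A N M → F N
  ext : ∀ M : ModuleCat.{0} A, Module.Finite A M → ∀ N : Submodule A M,
    F (ModuleCat.of A N) → F (ModuleCat.of A (M ⧸ N)) → F M

/-- The right Hom-perpendicular class `T^⊥` inside `mod A`. -/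
def rightPerp (T : ModuleCat.{0} A → Prop) : ModuleCat.{0} A → Prop :=
  fun X => Module.Finite A X ∧ ∀ M : ModuleCat.{0} A, T M → ∀ f : M →ₗ[A] X, f = 0

/-- The smallest torsion class containing a class `S` of modules. -/
def torsClosure (S : ModuleCat.{0} A → Prop) : ModuleCat.{0} A → Prop :=
  fun X => ∀ T : ModuleCat.{0} A → Prop, IsTorsionClass A T → (∀ Y, S Y → T Y) → T X

/-- The smallest torsion-free class containing a class `S` of modules. -/
def torfClosure (S : ModuleCat.{0} A → Prop) : ModuleCat.{0} A → Prop :=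
  fun X => ∀ F : ModuleCat.{0} A → Prop, IsTorsionFreeClass A F → (∀ Y, S Y → F Y) → F X

/-- A torsion class is compact if it is the smallest torsion class containing a single
module `M`. -/
def IsCompactTors (T : ModuleCat.{0} A → Prop) : Prop :=
  ∃ M : ModuleCat.{0} A, Module.Finite A M ∧ T = torsClosure A (fun X => X = M)

/-- A torsion class is cocompact if `T^⊥` is the smallest torsion-free class containing a
single module `N`. -/
def IsCocompactTors (T : ModuleCat.{0} A → Prop) : Prop :=
  ∃ N : ModuleCat.{0} A, Module.Finite A N ∧ rightPerp A T = torfClosure A (fun X => X = N)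

/-- A torsion class is bicompact if it is both compact and cocompact. -/
def IsBicompactTors (T : ModuleCat.{0} A → Prop) : Prop :=
  IsCompactTors A T ∧ IsCocompactTors A T

/-- A class `C` of modules is functorially finite in `mod A` if every finitely generated
module has a left `C`-approximation and a right `C`-approximation. -/
def FunctoriallyFinite (C : ModuleCat.{0} A → Prop) : Prop :=
  (∀ M : ModuleCat.{0} A, Module.Finite A M →
    ∃ (X : ModuleCat.{0} A) (f : M →ₗ[A] X), C X ∧
      ∀ Y : ModuleCat.{0} A, C Y → ∀ g : M →ₗ[A] Y, ∃ h : X →ₗ[A] Y, h.comp f = g) ∧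
  (∀ M : ModuleCat.{0} A, Module.Finite A M →
    ∃ (X : ModuleCat.{0} A) (f : X →ₗ[A] M), C X ∧
      ∀ Y : ModuleCat.{0} A, C Y → ∀ g : Y →ₗ[A] M, ∃ h : Y →ₗ[A] X, f.comp h = g)

/-- A stability function: a real-valued function on `mod A` which is additive on short
exact sequences. -/
def IsStability (θ : ModuleCat.{0} A → ℝ) : Prop :=
  ∀ L M N : ModuleCat.{0} A, Module.Finite A L → Module.Finite A M → Module.Finite A N →
    ∀ (f : L →ₗ[A] M) (g : M →ₗ[A] N), Function.Injective f → Function.Surjective g →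
      LinearMap.range f = LinearMap.ker g → θ M = θ L + θ N

/-- The semistable torsion class `T_θ`. -/
def tTheta (θ : ModuleCat.{0} A → ℝ) : ModuleCat.{0} A → Prop :=
  fun M => Module.Finite A M ∧ ∀ N : ModuleCat.{0} A, Module.Finite A N →
    IsQuotientOf A N M → Nonzero A N → 0 < θ N

/-- The semistable torsion class `\bar T_θ`. -/
def tThetaBar (θ : ModuleCat.{0} A → ℝ) : ModuleCat.{0} A → Prop :=
  fun M => Module.Finite A M ∧ ∀ N : ModuleCat.{0} A, Module.Finite A N →
    IsQuotientOf A N M → 0 ≤ θ N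

/-- The semistable torsion-free class `F_θ`. -/
def fTheta (θ : ModuleCat.{0} A → ℝ) : ModuleCat.{0} A → Prop :=
  fun M => Module.Finite A M ∧ ∀ L : ModuleCat.{0} A, Module.Finite A L →
    IsSubmoduleOf A L M → Nonzero A L → θ L < 0

/-- The semistable torsion-free class `\bar F_θ`. -/
def fThetaBar (θ : ModuleCat.{0} A → ℝ) : ModuleCat.{0} A → Prop :=
  fun M => Module.Finite A M ∧ ∀ L : ModuleCat.{0} A, Module.Finite A L →
    IsSubmoduleOf A L M → θ L ≤ 0

/-- An integer-valued function on `mod A` additive on short exact sequences; these are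
exactly the group homomorphisms `K0(mod A) → ℤ`. -/
def IsAdditiveZ (φ : ModuleCat.{0} A → ℤ) : Prop :=
  ∀ L M N : ModuleCat.{0} A, Module.Finite A L → Module.Finite A M → Module.Finite A N →
    ∀ (f : L →ₗ[A] M) (g : M →ₗ[A] N), Function.Injective f → Function.Surjective g →
      LinearMap.range f = LinearMap.ker g → φ M = φ L + φ N

/-- `[X] = [Y]` in the Grothendieck group `K0(mod A)`: since `K0(mod A)` is free abelian
on the simple modules, this holds iff all additive `ℤ`-valued functions agree on `X`, `Y`. -/
def SameK0Class (X Y : ModuleCat.{0} A) : Prop :=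
  ∀ φ : ModuleCat.{0} A → ℤ, IsAdditiveZ A φ → φ X = φ Y

/-- Two classes of modules are numerically disjoint if they contain no nonzero `X`, `Y`
with `[X] = [Y] ≠ 0` in `K0(mod A)`. -/
def NumericallyDisjoint (C D : ModuleCat.{0} A → Prop) : Prop :=
  ¬ ∃ X Y : ModuleCat.{0} A, C X ∧ D Y ∧ Nonzero A X ∧ Nonzero A Y ∧ SameK0Class A X Y

/-- A brick: a finitely generated module whose endomorphism algebra is a division algebra,
i.e. `M` is nonzero and every nonzero endomorphism is invertible. -/
def IsBrick (M : ModuleCat.{0} A) : Prop :=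
  Module.Finite A M ∧ Nonzero A M ∧ ∀ f : M →ₗ[A] M, f ≠ 0 → Function.Bijective f

/-- A semibrick: a set of pairwise Hom-orthogonal bricks. -/
def IsSemibrick (S : Set (ModuleCat.{0} A)) : Prop :=
  (∀ M ∈ S, IsBrick A M) ∧
    ∀ M ∈ S, ∀ N ∈ S, M ≠ N → ∀ f : M →ₗ[A] N, f = 0

end TorsPaper

namespace NCRank
open Module

section gen
variable {K : Type*} [Field K] {V W : Type*} [AddCommGroup V] [Module K V]
  [AddCommGroup W] [Module K W]

lemma exists_factor [FiniteDimensional K V] [FiniteDimensional K W] (g : V →ₗ[K] W) (r : ℕ)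
    (hr : finrank K (LinearMap.range g) = r) :
    ∃ (J : (Fin r → K) →ₗ[K] V) (P : W →ₗ[K] (Fin r → K)),
      (P.comp g).comp J = LinearMap.id := by
  have e : LinearMap.range g ≃ₗ[K] (Fin r → K) :=
    LinearEquiv.ofFinrankEq _ _ (by simp [hr])
  obtain ⟨J0, hJ0⟩ := LinearMap.exists_rightInverse_of_surjective g.rangeRestrict
    (LinearMap.range_rangeRestrict g)
  obtain ⟨P0, hP0⟩ := LinearMap.exists_leftInverse_of_injective (LinearMap.range g).subtype
    (Submodule.ker_subtype _)
  refine ⟨J0.comp e.symm.toLinearMap, e.toLinearMap.comp P0, ?_⟩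
  apply LinearMap.ext
  intro v
  have h1 : g (J0 (e.symm v)) = (LinearMap.range g).subtype (e.symm v) := by
    have := LinearMap.congr_fun hJ0 (e.symm v)
    have h2 := congrArg Subtype.val this
    simpa using h2
  have h3 : P0 ((LinearMap.range g).subtype (e.symm v)) = e.symm v :=
    LinearMap.congr_fun hP0 (e.symm v)
  simp only [LinearMap.comp_apply, LinearEquiv.coe_coe, LinearMap.id_apply]
  rw [h1, h3]; simp

lemma rank_ge_of_factor [FiniteDimensional K V] [FiniteDimensional K W] (g : V →ₗ[K] W) (r : ℕ)
    (J : (Fin r → K) →ₗ[K] V) (P : W →ₗ[K] (Fin r → K))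
    (h : IsUnit (LinearMap.det ((P.comp g).comp J))) : r ≤ finrank K (LinearMap.range g) := by
  have hs : LinearMap.range (P.comp g) = ⊤ := by
    have h1 : LinearMap.range ((P.comp g).comp J) = ⊤ := by
      have := LinearMap.equivOfDetNeZero ((P.comp g).comp J) h.ne_zero
      have hu := (LinearMap.isUnit_iff_isUnit_det _).2 h
      exact ((LinearMap.isUnit_iff_range_eq_top _).1 hu)
    rw [eq_top_iff, ← h1]
    exact LinearMap.range_comp_le_range _ _
  have h2 : finrank K (LinearMap.range (P.comp g)) = r := by rw [hs]; simp
  rw [← h2, LinearMap.range_comp]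
  exact Submodule.finrank_map_le _ _

lemma rank_pencil_finite [FiniteDimensional K V] [FiniteDimensional K W] (g1 g2 : V →ₗ[K] W) :
    {t : K | finrank K (LinearMap.range (g1 + t • g2)) < finrank K (LinearMap.range g1)}.Finite := by
  obtain ⟨r, hr⟩ : ∃ r, finrank K (LinearMap.range g1) = r := ⟨_, rfl⟩
  obtain ⟨J, P, h⟩ := exists_factor g1 r hr
  rw [hr]
  let M2 : Matrix (Fin r) (Fin r) K := LinearMap.toMatrix' ((P.comp g2).comp J)
  let p : Polynomial K := Matrix.det (1 + (Polynomial.X : Polynomial K) • M2.map Polynomial.C)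
  have hev : ∀ t, p.eval t = LinearMap.det ((P.comp (g1 + t • g2)).comp J) := by
    intro t
    have e1 : (P.comp (g1 + t • g2)).comp J = LinearMap.id + t • ((P.comp g2).comp J) := by
      rw [← h]; ext; simp
    rw [e1, ← LinearMap.det_toMatrix', ← Polynomial.coe_evalRingHom, RingHom.map_det]
    congr 1
    ext i j
    simp [M2, Matrix.one_apply, LinearMap.toMatrix'_apply, Pi.single_apply]
    split_ifs <;> simp [mul_comm]
  have hp : p ≠ 0 := by
    intro h0
    have := hev 0
    rw [h0] at this
    simp [h] at this
  refine (Polynomial.finite_setOfPred_isRoot hp).subset ?_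
  intro t ht
  by_contra hroot
  have hne : p.eval t ≠ 0 := hroot
  rw [hev] at hne
  have := rank_ge_of_factor (g1 + t • g2) r J P hne.isUnit
  exact absurd ht (not_lt.2 this)

/-- chain lemma for pencils -/
lemma pencil_chain [Infinite K] [FiniteDimensional K V] [FiniteDimensional K W] (X N : V →ₗ[K] W)
    (hmax : ∀ t : K, finrank K (LinearMap.range (X + t • N)) ≤ finrank K (LinearMap.range X))
    (j : ℕ) (v : ℕ → V) (h0 : X (v 0) = 0) (hs : ∀ i < j, X (v (i+1)) = N (v i)) :
    N (v j) ∈ LinearMap.range X := by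
  by_contra hw
  set w := N (v j)
  obtain ⟨r, hr⟩ : ∃ r, finrank K (LinearMap.range X) = r := ⟨_, rfl⟩
  obtain ⟨J, P, hJP⟩ := exists_factor X r hr
  rw [hr] at hmax
  -- the polynomial vector
  have hpoly : ∀ t : K, (X + t • N) (∑ i ∈ Finset.range (j+1), ((-t)^i) • v i) =
      -((-t)^(j+1)) • w := by
    intro t
    have key : ∀ k ≤ j, (X + t • N) (∑ i ∈ Finset.range (k+1), ((-t)^i) • v i) =
      -((-t)^(k+1)) • N (v k) := by
      intro k
      induction k with
      | zero => intro _; simp [h0]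
      | succ k ih =>
        intro hk
        rw [Finset.sum_range_succ, map_add, ih (by omega)]
        simp only [map_smul, LinearMap.add_apply, LinearMap.smul_apply, hs k (by omega)]
        module
    exact key j le_rfl
  let g1 : ((Fin r → K) × K) →ₗ[K] W := (X.comp J).coprod (LinearMap.toSpanSingleton K W w)
  let g2 : ((Fin r → K) × K) →ₗ[K] W := (N.comp J).coprod 0
  have hinj : Function.Injective g1 := by
    rw [← LinearMap.ker_eq_bot, LinearMap.ker_eq_bot']
    rintro ⟨c, d⟩ hcd
    simp only [g1, LinearMap.coprod_apply, LinearMap.comp_apply,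
      LinearMap.toSpanSingleton_apply] at hcd
    have hd : d = 0 := by
      by_contra hd
      apply hw
      refine ⟨-(d⁻¹ • J c), ?_⟩
      have : d • w = - X (J c) := by rw [eq_neg_iff_add_eq_zero, add_comm]; exact hcd
      rw [map_neg, map_smul, ← smul_neg, ← this, smul_smul, inv_mul_cancel₀ hd, one_smul]
    subst hd
    have hX : X (J c) = 0 := by simpa using hcd
    have := LinearMap.congr_fun hJP c
    simp only [LinearMap.comp_apply, hX, map_zero, LinearMap.id_apply] at this
    rw [← this]; rfl
  have hr1 : finrank K (LinearMap.range g1) = r + 1 := by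
    rw [LinearMap.finrank_range_of_inj hinj]; simp
  have hfin := rank_pencil_finite g1 g2
  obtain ⟨t, ht⟩ := ((hfin.union (Set.finite_singleton (0:K))).infinite_compl).nonempty
  simp only [Set.mem_compl_iff, Set.mem_union, Set.mem_ofPred_eq, Set.mem_singleton_iff,
    not_or, not_lt] at ht
  obtain ⟨ht1, ht0⟩ := ht
  have hle : LinearMap.range (g1 + t • g2) ≤ LinearMap.range (X + t • N) := by
    rintro _ ⟨⟨c, d⟩, rfl⟩
    have e : (g1 + t • g2) (c, d) = (X + t • N) (J c) + d • w := by
      simp [g1, g2]; abel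
    rw [e]
    refine Submodule.add_mem _ ⟨_, rfl⟩ (Submodule.smul_mem _ _ ?_)
    refine ⟨(-((-t)^(j+1)))⁻¹ • (∑ i ∈ Finset.range (j+1), ((-t)^i) • v i), ?_⟩
    rw [map_smul, hpoly, smul_smul, inv_mul_cancel₀, one_smul]
    exact neg_ne_zero.2 (pow_ne_zero _ (neg_ne_zero.2 ht0))
  have h3 := Submodule.finrank_mono hle
  have h4 := hmax t
  omega

end gen
end NCRank

namespace NCRank
open Module

/-- A finite dimensional space with a `σ`-semilinear operator `φ` with `φ^l = a`, where powers of `a`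
are norms only in degrees divisible by `l`, has dimension divisible by `l`. -/
lemma semilinear_dvd {E : Type*} [Field E] (σ : E →+* E) (a : E) (l : ℕ)
    (hN : ∀ (k : ℕ) (d : E), (∏ i ∈ Finset.range l, (σ^i) d) = a^k → l ∣ k)
    {H : Type*} [AddCommGroup H] [Module E H] [FiniteDimensional E H]
    (φ : H → H) (hadd : ∀ x y, φ (x+y) = φ x + φ y) (hsm : ∀ (c : E) x, φ (c • x) = σ c • φ x)
    (hl : ∀ x, φ^[l] x = a • x) : l ∣ finrank E H := by
  obtain ⟨k, hk⟩ : ∃ k, finrank E H = k := ⟨_, rfl⟩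
  rw [hk]
  let b := Module.finBasisOfFinrankEq E H hk
  let Φ : Matrix (Fin k) (Fin k) E := Matrix.of fun i j => b.repr (φ (b j)) i
  let ψ : H →+ H := AddMonoidHom.mk' φ hadd
  have hφ : ∀ j, φ (b j) = ∑ i, Φ i j • b i := fun j => (b.sum_repr _).symm
  have hsum : ∀ (c : Fin k → E), φ (∑ i, c i • b i) = ∑ i, (∑ j, Φ i j * σ (c j)) • b i := by
    intro c
    have : φ (∑ i, c i • b i) = ∑ i, φ (c i • b i) := map_sum ψ _ _
    rw [this]
    simp only [hsm, hφ, Finset.smul_sum, Finset.sum_smul, smul_smul]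
    rw [Finset.sum_comm]
    simp only [mul_comm]
  have key : ∀ n : ℕ, ∃ M : Matrix (Fin k) (Fin k) E, (∀ j, φ^[n] (b j) = ∑ i, M i j • b i) ∧
      M.det = ∏ i ∈ Finset.range n, (σ^i) Φ.det := by
    intro n
    induction n with
    | zero =>
      refine ⟨1, fun j => ?_, by simp⟩
      simp [Matrix.one_apply]
    | succ n ih =>
      obtain ⟨M, h1, h2⟩ := ih
      refine ⟨Φ * M.map σ, fun j => ?_, ?_⟩
      · rw [Function.iterate_succ_apply', h1, hsum]
        rfl
      · rw [Matrix.det_mul, Finset.prod_range_succ', mul_comm]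
        have : (M.map σ).det = σ M.det := by
          rw [RingHom.map_det]; rfl
        rw [this, h2, map_prod]
        simp [pow_succ']
  obtain ⟨M, h1, h2⟩ := key l
  apply hN k Φ.det
  rw [← h2]
  have : M = a • (1 : Matrix (Fin k) (Fin k) E) := by
    ext i j
    have h3 := h1 j
    rw [hl] at h3
    have h4 := congrArg (fun x => b.repr x i) h3
    simp [Finsupp.single_apply] at h4
    simp [Matrix.one_apply, eq_comm, ← h4]
  rw [this, Matrix.det_smul]; simp

section cyc
variable {K : Type*} [Field K] {ι : Type*}

/-- index type of generic variables -/
abbrev Idx (n : ℕ) (ι : Type*) := Fin (n+1) × Fin (n+1) × ι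
abbrev R0 (K : Type*) [Field K] (n : ℕ) (ι : Type*) := MvPolynomial (Idx n ι) K
abbrev EF (K : Type*) [Field K] (n : ℕ) (ι : Type*) := FractionRing (Polynomial (R0 K n ι))

def idxShift (n : ℕ) (ι : Type*) : Idx n ι → Idx n ι := fun p => (p.1 - 1, p.2.1 - 1, p.2.2)

lemma idxShift_inj (n : ℕ) (ι : Type*) : Function.Injective (idxShift n ι) := by
  rintro ⟨a, b, c⟩ ⟨a', b', c'⟩ h
  simp [idxShift] at h
  simp [h]

lemma idxShift_iter (n : ℕ) (ι : Type*) (p : Idx n ι) : (idxShift n ι)^[n+1] p = p := by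
  have : ∀ k : ℕ, (idxShift n ι)^[k] p = (p.1 - k • (1 : Fin (n+1)), p.2.1 - k • (1 : Fin (n+1)), p.2.2) := by
    intro k
    induction k with
    | zero => simp
    | succ k ih => rw [Function.iterate_succ_apply', ih]; simp only [idxShift, sub_sub, succ_nsmul]
  have h1 : (n+1) • (1 : Fin (n+1)) = 0 := by
    have := card_nsmul_eq_zero' (G := Fin (n+1)) (x := 1)
    simpa only [Nat.card_eq_fintype_card, Fintype.card_fin] using this
  rw [this, h1]; simp only [sub_zero]

noncomputable def sig0 (K : Type*) [Field K] (n : ℕ) (ι : Type*) : R0 K n ι →+* R0 K n ι :=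
  (MvPolynomial.rename (idxShift n ι)).toRingHom

lemma sig0_inj : Function.Injective (sig0 K n ι) :=
  MvPolynomial.rename_injective _ (idxShift_inj n ι)

lemma sig0_iter (n : ℕ) (p : R0 K n ι) : (sig0 K n ι)^[n+1] p = p := by
  have : ∀ k : ℕ, (sig0 K n ι)^[k] p = MvPolynomial.rename ((idxShift n ι)^[k]) p := by
    intro k
    induction k with
    | zero => simp
    | succ k ih =>
      rw [Function.iterate_succ_apply', ih, Function.iterate_succ']
      simp [sig0, MvPolynomial.rename_rename]
  rw [this]
  have h : (idxShift n ι)^[n+1] = id := funext (idxShift_iter n ι)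
  rw [h]; simp

noncomputable def sig1 (K : Type*) [Field K] (n : ℕ) (ι : Type*) :
    Polynomial (R0 K n ι) →+* Polynomial (R0 K n ι) := Polynomial.mapRingHom (sig0 K n ι)

lemma sig1_inj : Function.Injective (sig1 K n ι) :=
  Polynomial.map_injective _ sig0_inj

lemma sig1_natDegree (p : Polynomial (R0 K n ι)) : (sig1 K n ι p).natDegree = p.natDegree :=
  Polynomial.natDegree_map_eq_of_injective sig0_inj p

lemma sig1_iter (n : ℕ) (p : Polynomial (R0 K n ι)) : (sig1 K n ι)^[n+1] p = p := by
  have : ∀ k : ℕ, ∀ i, ((sig1 K n ι)^[k] p).coeff i = (sig0 K n ι)^[k] (p.coeff i) := by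
    intro k
    induction k with
    | zero => simp
    | succ k ih =>
      intro i
      rw [Function.iterate_succ_apply', Function.iterate_succ_apply', ← ih]
      simp [sig1]
  ext1 i
  rw [this, sig0_iter]

noncomputable def sig (K : Type*) [Field K] (n : ℕ) (ι : Type*) : EF K n ι →+* EF K n ι :=
  IsFractionRing.map (A := Polynomial (R0 K n ι)) (B := Polynomial (R0 K n ι)) (sig1_inj)

lemma sig_algebraMap (p : Polynomial (R0 K n ι)) :
    sig K n ι (algebraMap _ (EF K n ι) p) = algebraMap _ (EF K n ι) (sig1 K n ι p) := by
  simp [sig, IsFractionRing.map]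

lemma sig_iter (n : ℕ) (x : EF K n ι) : (sig K n ι)^[n+1] x = x := by
  obtain ⟨p, q, hq, rfl⟩ := IsFractionRing.div_surjective (A := Polynomial (R0 K n ι)) x
  have : ∀ k : ℕ, ∀ p, (sig K n ι)^[k] (algebraMap _ (EF K n ι) p)
      = algebraMap _ (EF K n ι) ((sig1 K n ι)^[k] p) := by
    intro k
    induction k with
    | zero => simp
    | succ k ih =>
      intro i
      rw [Function.iterate_succ_apply', Function.iterate_succ_apply', ih, sig_algebraMap]
  have h2 := map_div₀ ((sig K n ι)^(n+1)) (algebraMap _ (EF K n ι) p) (algebraMap _ (EF K n ι) q)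
  simp only [RingHom.coe_pow] at h2
  rw [h2, this, this, sig1_iter, sig1_iter]

/-- the element `a`. -/
noncomputable def aE (K : Type*) [Field K] (n : ℕ) (ι : Type*) : EF K n ι :=
  algebraMap (Polynomial (R0 K n ι)) _ Polynomial.X

lemma sig_norm (k : ℕ) (d : EF K n ι) (h : (∏ i ∈ Finset.range (n+1), ((sig K n ι)^i) d) = (aE K n ι)^k) :
    (n+1) ∣ k := by
  obtain ⟨p, q, hq, rfl⟩ := IsFractionRing.div_surjective (A := Polynomial (R0 K n ι)) d
  have hinj : Function.Injective (algebraMap (Polynomial (R0 K n ι)) (EF K n ι)) :=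
    IsFractionRing.injective _ _
  have hq0 : q ≠ 0 := nonZeroDivisors.ne_zero hq
  have hit : ∀ k : ℕ, ∀ p, ((sig K n ι)^k) (algebraMap _ (EF K n ι) p)
      = algebraMap _ (EF K n ι) (((sig1 K n ι)^k) p) := by
    intro k
    induction k with
    | zero => simp
    | succ k ih =>
      intro i
      rw [pow_succ', pow_succ', RingHom.mul_def, RingHom.mul_def, RingHom.comp_apply, RingHom.comp_apply, ih, sig_algebraMap]
  have hne : ∀ k : ℕ, ∀ p, p ≠ 0 → ((sig1 K n ι)^k) p ≠ 0 := by
    intro k p hp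
    rw [RingHom.coe_pow]
    intro h0
    apply hp
    apply (sig1_inj (K := K) (n := n) (ι := ι)).iterate k
    rw [h0, ← RingHom.coe_pow, map_zero]
  have hdeg : ∀ k : ℕ, ∀ p, (((sig1 K n ι)^k) p).natDegree = p.natDegree := by
    intro k
    induction k with
    | zero => simp
    | succ k ih =>
      intro p
      rw [pow_succ', RingHom.mul_def, RingHom.comp_apply, sig1_natDegree, ih]
  have hp0 : p ≠ 0 := by
    rintro rfl
    have : (aE K n ι)^k ≠ 0 := pow_ne_zero _ (by
      rw [aE, Ne, map_eq_zero_iff _ hinj]; exact Polynomial.X_ne_zero)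
    apply this
    rw [← h]
    exact Finset.prod_eq_zero (Finset.mem_range.2 (Nat.succ_pos n)) (by simp)
  simp only [map_div₀, hit, Finset.prod_div_distrib] at h
  rw [div_eq_iff, aE, ← map_prod, ← map_prod, ← map_pow, ← map_mul] at h
  · have h2 := hinj h
    have h3 := congrArg Polynomial.natDegree h2
    rw [Polynomial.natDegree_prod _ _ (fun i _ => hne i p hp0),
      Polynomial.natDegree_mul (pow_ne_zero _ Polynomial.X_ne_zero)
        (Finset.prod_ne_zero_iff.2 fun i _ => hne i q hq0),
      Polynomial.natDegree_prod _ _ (fun i _ => hne i q hq0)] at h3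
    simp only [hdeg, Finset.sum_const, Finset.card_range, smul_eq_mul, Polynomial.natDegree_X_pow] at h3
    have : (n+1) ∣ k + (n+1) * q.natDegree := ⟨_, h3.symm⟩
    exact (Nat.dvd_add_left (Dvd.intro _ rfl)).1 this
  · rw [Finset.prod_ne_zero_iff]
    intro i _
    rw [Ne, map_eq_zero_iff _ hinj]
    exact hne i q hq0
end cyc
end NCRank

namespace NCRank
open Module

section mat
variable {K : Type*} [Field K] {m n : Type*} [Fintype m] [Fintype n] [DecidableEq m] [DecidableEq n]

lemma mat_factor (M : Matrix m n K) (r : ℕ) (hr : M.rank = r) :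
    ∃ (P : Matrix (Fin r) m K) (Q : Matrix n (Fin r) K), P * M * Q = 1 := by
  obtain ⟨J, P, h⟩ := exists_factor (Matrix.toLin' M) r (by rw [← hr]; rfl)
  refine ⟨LinearMap.toMatrix' P, LinearMap.toMatrix' J, ?_⟩
  have := congrArg LinearMap.toMatrix' h
  rw [LinearMap.toMatrix'_comp, LinearMap.toMatrix'_comp, LinearMap.toMatrix'_toLin',
    LinearMap.toMatrix'_id] at this
  exact this

omit [DecidableEq m] [DecidableEq n] in
lemma mat_rank_ge (M : Matrix m n K) (r : ℕ) (P : Matrix (Fin r) m K) (Q : Matrix n (Fin r) K)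
    (h : (P * M * Q).det ≠ 0) : r ≤ M.rank := by
  have h1 : (P * M * Q).rank = r := by
    rw [Matrix.rank_of_isUnit]
    · simp
    · rw [Matrix.isUnit_iff_isUnit_det]; exact h.isUnit
  rw [← h1]
  exact (Matrix.rank_mul_le_left _ _).trans (Matrix.rank_mul_le_right _ _)

lemma spec_le {R E : Type*} [CommRing R] [Field E] [Algebra R E]
    (hinj : Function.Injective (algebraMap R E)) (M : Matrix m n R) (c : K →+* R) (ev : R →+* K)
    (hc : ∀ x, ev (c x) = x) : (M.map ev).rank ≤ (M.map (algebraMap R E)).rank := by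
  obtain ⟨P, Q, h⟩ := mat_factor (M.map ev) _ rfl
  apply mat_rank_ge _ _ ((P.map c).map (algebraMap R E)) ((Q.map c).map (algebraMap R E))
  rw [← Matrix.map_mul, ← Matrix.map_mul]
  have : ((P.map c * M * Q.map c).map (algebraMap R E)).det
      = algebraMap R E ((P.map c * M * Q.map c).det) := by rw [RingHom.map_det]; rfl
  rw [this, Ne, map_eq_zero_iff _ hinj]
  intro h0
  have h1 : ev ((P.map c * M * Q.map c).det) = 0 := by rw [h0, map_zero]
  have h2 : ev ((P.map c * M * Q.map c).det) = (P * M.map ev * Q).det := by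
    rw [RingHom.map_det]
    congr 1
    have hP : (P.map c).map ev = P := by ext; simp [hc]
    have hQ : (Q.map c).map ev = Q := by ext; simp [hc]
    rw [RingHom.mapMatrix_apply, Matrix.map_mul, Matrix.map_mul, hP, hQ]
  rw [h2, h] at h1
  simp at h1

lemma spec_ge {R E : Type*} [CommRing R] [IsDomain R] [Field E] [Algebra R E] [IsFractionRing R E]
    (M : Matrix m n R) : ∃ d : R, d ≠ 0 ∧ ∀ (ev : R →+* K), ev d ≠ 0 →
      (M.map (algebraMap R E)).rank ≤ (M.map ev).rank := by
  have hinj : Function.Injective (algebraMap R E) := IsFractionRing.injective _ _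
  obtain ⟨r, hr⟩ : ∃ r, (M.map (algebraMap R E)).rank = r := ⟨_, rfl⟩
  obtain ⟨P, Q, h⟩ := mat_factor _ r hr
  rw [hr]
  obtain ⟨p, hp⟩ := IsLocalization.exist_integer_multiples_of_finite (nonZeroDivisors R)
    (fun ij : Fin r × m => P ij.1 ij.2)
  obtain ⟨q, hq⟩ := IsLocalization.exist_integer_multiples_of_finite (nonZeroDivisors R)
    (fun ij : n × Fin r => Q ij.1 ij.2)
  choose P' hP' using hp
  choose Q' hQ' using hq
  let P1 : Matrix (Fin r) m R := Matrix.of fun i j => P' (i,j)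
  let Q1 : Matrix n (Fin r) R := Matrix.of fun i j => Q' (i,j)
  have hP1 : P1.map (algebraMap R E) = (algebraMap R E p) • P := by
    ext i j; simpa [P1, Algebra.smul_def] using hP' (i,j)
  have hQ1 : Q1.map (algebraMap R E) = (algebraMap R E q) • Q := by
    ext i j; simpa [Q1, Algebra.smul_def] using hQ' (i,j)
  refine ⟨(P1 * M * Q1).det, ?_, ?_⟩
  · intro h0
    have h1 : algebraMap R E ((P1 * M * Q1).det) = 0 := by rw [h0, map_zero]
    rw [RingHom.map_det, RingHom.mapMatrix_apply, Matrix.map_mul, Matrix.map_mul, hP1, hQ1] at h1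
    rw [Matrix.smul_mul, Matrix.smul_mul, Matrix.mul_smul, h] at h1
    rw [Matrix.det_smul, Matrix.det_smul, Matrix.det_one] at h1
    simp only [mul_one, mul_eq_zero] at h1
    rcases h1 with h1 | h1
    · have := eq_zero_of_pow_eq_zero h1
      rw [map_eq_zero_iff _ hinj] at this
      exact nonZeroDivisors.ne_zero p.2 this
    · have := eq_zero_of_pow_eq_zero h1
      rw [map_eq_zero_iff _ hinj] at this
      exact nonZeroDivisors.ne_zero q.2 this
  · intro ev hev
    apply mat_rank_ge _ _ (P1.map ev) (Q1.map ev)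
    rwa [RingHom.map_det, RingHom.mapMatrix_apply, Matrix.map_mul, Matrix.map_mul] at hev
end mat

section reg
variable {K : Type*} [Field K] {ι : Type*} [Fintype ι] {m n' : Type*} [Fintype m] [Fintype n']
  [DecidableEq m] [DecidableEq n']

def gz {R : Type*} [CommRing R] (c : K →+* R) {κ : Type*} (B : ι → Matrix m n' K) (x : κ → κ → ι → R) :
    Matrix (m × κ) (n' × κ) R :=
  Matrix.of fun p q => ∑ b, x p.2 q.2 b * c (B b p.1 q.1)

omit [Fintype m] [Fintype n'] [DecidableEq m] [DecidableEq n'] in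
lemma gz_map {R R' : Type*} [CommRing R] [CommRing R'] (c : K →+* R) {κ : Type*}
    (B : ι → Matrix m n' K) (x : κ → κ → ι → R) (f : R →+* R') :
    (gz c B x).map f = gz (f.comp c) B (fun i j b => f (x i j b)) := by
  ext; simp [gz]

noncomputable def xg (K : Type*) [Field K] (n : ℕ) (ι : Type*) :
    Fin (n+1) → Fin (n+1) → ι → Polynomial (R0 K n ι) :=
  fun i j b => Polynomial.C (MvPolynomial.X (i,j,b)) * (if j < i then Polynomial.X else 1)

noncomputable def cE (K : Type*) [Field K] (n : ℕ) (ι : Type*) (i : Fin (n+1)) : Polynomial (R0 K n ι) :=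
  if i = Fin.last n then Polynomial.X else 1

lemma sig1_cE (i) : sig1 K n ι (cE K n ι i) = cE K n ι i := by
  unfold cE; split_ifs <;> simp [sig1]

omit [Fintype ι] in
lemma xg_rel (i j : Fin (n+1)) (b : ι) :
    xg K n ι i j b * cE K n ι j = cE K n ι i * sig1 K n ι (xg K n ι (i+1) (j+1) b) := by
  have h1 : sig1 K n ι (xg K n ι (i+1) (j+1) b) =
     Polynomial.C (MvPolynomial.X (i,j,b)) * (if j+1 < i+1 then Polynomial.X else 1) := by
    unfold xg
    rw [map_mul]
    congr 1
    · simp [sig1, sig0, idxShift]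
    · split_ifs <;> simp [sig1]
  rw [h1]
  unfold xg cE
  by_cases hi : i = Fin.last n <;> by_cases hj : j = Fin.last n
  · subst hi; subst hj; simp
  · subst hi
    have h2 : j < Fin.last n := Fin.lt_last_iff_ne_last.2 hj
    simp [hj, h2]
  · subst hj
    have h2 : i < Fin.last n := Fin.lt_last_iff_ne_last.2 hi
    have h3 : (0 : Fin (n+1)) < i + 1 := by
      rw [Fin.lt_def, Fin.val_add_one_of_lt h2]; simp
    simp [hi, h2.le, h3]
  · have h2 : i < Fin.last n := Fin.lt_last_iff_ne_last.2 hi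
    have h3 : j < Fin.last n := Fin.lt_last_iff_ne_last.2 hj
    have h4 : j + 1 < i + 1 ↔ j < i := by
      rw [Fin.lt_def, Fin.val_add_one_of_lt h2, Fin.val_add_one_of_lt h3, Fin.lt_def]; omega
    simp [hi, hj, h4]

lemma prod_cE (n : ℕ) (i : Fin (n+1)) :
    ∏ t ∈ Finset.range (n+1), cE K n ι (i + t • 1) = Polynomial.X := by
  rw [Finset.prod_range]
  have h : ∀ t : Fin (n+1), (t : ℕ) • (1 : Fin (n+1)) = t := by
    have h0 : ∀ k : ℕ, (hk : k < n+1) → (k • (1 : Fin (n+1))) = ⟨k, hk⟩ := by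
      intro k
      induction k with
      | zero => intro _; rw [zero_smul]; rfl
      | succ k ih =>
        intro hk
        have hl : (⟨k, by omega⟩ : Fin (n+1)) < Fin.last n := by
          rw [Fin.lt_def]; simp; omega
        rw [succ_nsmul, ih (by omega)]
        apply Fin.ext
        rw [Fin.val_add_one_of_lt hl]
    intro t
    exact h0 t t.2
  simp only [h]
  rw [Fintype.prod_equiv (Equiv.addLeft i) (fun t => cE K n ι (i+t)) (cE K n ι) (fun t => rfl)]
  simp [cE]

/-- the semilinear operator -/
noncomputable def phi (K : Type*) [Field K] (n : ℕ) (ι : Type*) {q : Type*}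
    (v : q × Fin (n+1) → EF K n ι) : q × Fin (n+1) → EF K n ι :=
  fun p => algebraMap _ _ (cE K n ι p.2) * sig K n ι (v (p.1, p.2 + 1))

lemma phi_iter {q : Type*} (v : q × Fin (n+1) → EF K n ι) :
    (phi K n ι)^[n+1] v = aE K n ι • v := by
  have : ∀ k : ℕ, ∀ p, (phi K n ι)^[k] v p =
      algebraMap _ _ (∏ t ∈ Finset.range k, cE K n ι (p.2 + t • 1)) *
        (sig K n ι)^[k] (v (p.1, p.2 + k • 1)) := by
    intro k
    induction k with
    | zero => simp
    | succ k ih =>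
      intro p
      rw [Function.iterate_succ_apply', phi, ih, Function.iterate_succ_apply', map_mul,
        sig_algebraMap, ← mul_assoc, ← map_mul, Finset.prod_range_succ', map_prod]
      simp only [sig1_cE, zero_smul, add_zero, succ_nsmul', add_assoc]
      rw [mul_comm (cE K n ι p.2)]
  funext p
  rw [this, prod_cE, sig_iter]
  have h1 : (n+1) • (1 : Fin (n+1)) = 0 := by
    have := card_nsmul_eq_zero' (G := Fin (n+1)) (x := 1)
    simpa only [Nat.card_eq_fintype_card, Fintype.card_fin] using this
  rw [h1, add_zero]; rfl

lemma gz_phi (B : ι → Matrix m n' K) (v : n' × Fin (n+1) → EF K n ι) :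
    ((gz (Polynomial.C.comp MvPolynomial.C) B (xg K n ι)).map (algebraMap _ (EF K n ι))).mulVec (phi K n ι v)
    = phi K n ι (((gz (Polynomial.C.comp MvPolynomial.C) B (xg K n ι)).map (algebraMap _ (EF K n ι))).mulVec v) := by
  funext ⟨p, i⟩
  simp only [Matrix.mulVec, dotProduct, phi, Fintype.sum_prod_type, map_sum, map_mul, Finset.mul_sum]
  refine Finset.sum_congr rfl fun q _ => ?_
  refine Eq.trans ?_ (Fintype.sum_equiv (Equiv.addRight (1 : Fin (n+1)))
    (fun j => algebraMap _ (EF K n ι) (cE K n ι i) * (sig K n ι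
      ((gz (Polynomial.C.comp MvPolynomial.C) B (xg K n ι)).map (algebraMap _ (EF K n ι)) (p, i+1) (q, j+1)) *
      sig K n ι (v (q, j+1)))) _ (fun j => rfl))
  refine Finset.sum_congr rfl fun j _ => ?_
  rw [← mul_assoc, ← mul_assoc]
  congr 1
  simp only [Matrix.map_apply, sig_algebraMap, ← map_mul]
  congr 1
  simp only [gz, Matrix.of_apply, map_sum, Finset.sum_mul, Finset.mul_sum, map_mul]
  refine Finset.sum_congr rfl fun b _ => ?_
  rw [mul_right_comm, xg_rel, mul_assoc]
  congr 2
  simp [sig1, sig0]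

lemma gz_dvd (B : ι → Matrix m n' K) :
    (n+1) ∣ ((gz (Polynomial.C.comp MvPolynomial.C) B (xg K n ι)).map (algebraMap _ (EF K n ι))).rank := by
  set Z := (gz (Polynomial.C.comp MvPolynomial.C) B (xg K n ι)).map (algebraMap _ (EF K n ι)) with hZ
  have h1 : (n+1) ∣ finrank (EF K n ι) (LinearMap.ker Z.mulVecLin) := by
    apply semilinear_dvd (sig K n ι) (aE K n ι) (n+1) sig_norm
      (φ := fun v => ⟨phi K n ι v.1, by
        have := v.2
        rw [LinearMap.mem_ker, Matrix.mulVecLin_apply] at this ⊢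
        have e := gz_phi B v.1
        change Z.mulVec _ = phi K n ι (Z.mulVec _) at e
        rw [this] at e
        refine e.trans ?_
        funext p; simp [phi]⟩)
    · intro x y; apply Subtype.ext; funext p; simp [phi, mul_add]
    · intro c x; apply Subtype.ext; funext p; simp [phi]; ring
    · intro x
      apply Subtype.ext
      rw [Submodule.coe_smul, ← phi_iter]
      have key : ∀ (f : LinearMap.ker Z.mulVecLin → LinearMap.ker Z.mulVecLin),
          (∀ v, (f v).1 = phi K n ι v.1) → ∀ k : ℕ, (f^[k] x).1 = (phi K n ι)^[k] x.1 := by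
        intro f hf k
        induction k with
        | zero => rfl
        | succ k ih => rw [Function.iterate_succ_apply', Function.iterate_succ_apply', hf, ih]
      exact key _ (fun _ => rfl) _
  have h2 := LinearMap.finrank_range_add_finrank_ker Z.mulVecLin
  rw [Module.finrank_fintype_fun_eq_card, Fintype.card_prod, Fintype.card_fin] at h2
  have h3 : Z.rank = finrank (EF K n ι) (LinearMap.range Z.mulVecLin) := rfl
  rw [← h3] at h2
  exact (Nat.dvd_add_left h1).1 (h2 ▸ Dvd.intro_left _ rfl)

lemma regular_matrix [Infinite K] (B : ι → Matrix m n' K) (x : Fin (n+1) → Fin (n+1) → ι → K) (q : ℕ)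
    (h : (n+1) * q < (gz (RingHom.id K) B x).rank) :
    ∃ x' : Fin (n+1) → Fin (n+1) → ι → K, (n+1) * (q+1) ≤ (gz (RingHom.id K) B x').rank := by
  let c : K →+* Polynomial (R0 K n ι) := Polynomial.C.comp MvPolynomial.C
  let M := gz c B (xg K n ι)
  have hinj : Function.Injective (algebraMap (Polynomial (R0 K n ι)) (EF K n ι)) :=
    IsFractionRing.injective _ _
  let ev (y : Idx n ι → K) (t : K) : Polynomial (R0 K n ι) →+* K :=
    Polynomial.eval₂RingHom (MvPolynomial.eval y) t
  have hevc : ∀ y t, (ev y t).comp c = RingHom.id K := by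
    intro y t; ext z; simp [ev, c]
  have hev : ∀ y t, M.map (ev y t) = gz (RingHom.id K) B
      (fun i j b => ev y t (xg K n ι i j b)) := by
    intro y t
    rw [gz_map, hevc]
  have h1 : (gz (RingHom.id K) B x).rank ≤ (M.map (algebraMap _ (EF K n ι))).rank := by
    have h2 := spec_le hinj M c (ev (fun p => x p.1 p.2.1 p.2.2) 1)
      (fun z => RingHom.congr_fun (hevc _ _) z)
    rw [hev] at h2
    convert h2 using 3
    funext i j b
    simp only [xg, map_mul, ev]
    split_ifs <;> simp
  have h3 : (n+1) * (q+1) ≤ (M.map (algebraMap _ (EF K n ι))).rank := by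
    obtain ⟨k, hk⟩ := gz_dvd (n := n) B
    change (M.map (algebraMap _ (EF K n ι))).rank = _ at hk
    rw [hk] at h1 ⊢
    have : q < k := lt_of_mul_lt_mul_left (h.trans_le h1) (Nat.zero_le _)
    exact Nat.mul_le_mul_left _ this
  obtain ⟨d, hd, hd2⟩ := spec_ge (K := K) (E := EF K n ι) M
  obtain ⟨y, hy⟩ : ∃ y : Idx n ι → K, MvPolynomial.eval y d.leadingCoeff ≠ 0 := by
    by_contra hcon
    push Not at hcon
    apply hd
    rw [← Polynomial.leadingCoeff_eq_zero]
    exact MvPolynomial.funext (by simpa using hcon)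
  have hdy : d.map (MvPolynomial.eval y) ≠ 0 := by
    intro h0
    apply hy
    have := congrArg (fun p => Polynomial.coeff p d.natDegree) h0
    simpa using this
  obtain ⟨t, ht⟩ := (Polynomial.finite_setOfPred_isRoot hdy).infinite_compl.nonempty
  have ht' : ev y t d ≠ 0 := by
    simpa [ev, Polynomial.eval_map] using ht
  refine ⟨fun i j b => ev y t (xg K n ι i j b), h3.trans ((hd2 (ev y t) ht').trans (le_of_eq ?_))⟩
  exact congrArg Matrix.rank (hev y t)
end reg
end NCRank

namespace NCRank
open Module

section blow
variable {K : Type*} [Field K] {V W : Type*} [AddCommGroup V] [Module K V]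
  [AddCommGroup W] [Module K W]

/-- The block matrix map attached to an array of linear maps. -/
def blow {κ : Type*} [Fintype κ] (Y : κ → κ → (V →ₗ[K] W)) : (κ → V) →ₗ[K] (κ → W) :=
  LinearMap.pi fun i => ∑ j, (Y i j).comp (LinearMap.proj j)

lemma blow_apply {κ : Type*} [Fintype κ] (Y : κ → κ → (V →ₗ[K] W)) (v : κ → V) (i : κ) :
    blow Y v i = ∑ j, Y i j (v j) := by
  simp [blow]

lemma blow_add_smul {κ : Type*} [Fintype κ] (Y Z : κ → κ → (V →ₗ[K] W)) (t : K) :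
    blow (fun i j => Y i j + t • Z i j) = blow Y + t • blow Z := by
  apply LinearMap.ext; intro v; funext i
  simp [blow_apply, Finset.sum_add_distrib, Finset.smul_sum]

variable [FiniteDimensional K V] [FiniteDimensional K W]

lemma blow_reindex {κ κ' : Type*} [Fintype κ] [Fintype κ'] (e : κ ≃ κ') (Y : κ → κ → (V →ₗ[K] W)) :
    finrank K (LinearMap.range (blow (fun i j => Y (e.symm i) (e.symm j)))) =
      finrank K (LinearMap.range (blow Y)) := by
  have h : (blow (fun i j => Y (e.symm i) (e.symm j))).comp
      (LinearEquiv.funCongrLeft K V e.symm).toLinearMap =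
      (LinearEquiv.funCongrLeft K W e.symm).toLinearMap.comp (blow Y) := by
    apply LinearMap.ext; intro v; funext i
    simp only [LinearMap.comp_apply, LinearEquiv.coe_coe, blow_apply, LinearEquiv.funCongrLeft_apply,
      LinearMap.funLeft_apply]
    exact Fintype.sum_equiv e.symm _ _ (fun j => rfl)
  have h2 := congrArg LinearMap.range h
  rw [LinearMap.range_comp, LinearMap.range_comp, LinearEquiv.range, Submodule.map_top] at h2
  rw [h2]
  exact LinearEquiv.finrank_map_eq _ _

lemma blow_gz {κ ι m n' : Type*} [Fintype κ] [Fintype ι] [Fintype m] [Fintype n'] [DecidableEq m]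
    [DecidableEq n'] (bV : Basis n' K V) (bW : Basis m K W) (β : ι → (V →ₗ[K] W))
    (x : κ → κ → ι → K) :
    finrank K (LinearMap.range (blow (fun i j => ∑ b, x i j b • β b))) =
      (gz (RingHom.id K) (fun b => LinearMap.toMatrix bV bW (β b)) x).rank := by
  let eV : (κ → V) ≃ₗ[K] (n' × κ → K) := (LinearEquiv.piCongrRight (fun _ => bV.equivFun)) ≪≫ₗ
    (LinearEquiv.curry K K κ n').symm ≪≫ₗ LinearEquiv.funCongrLeft K K (Equiv.prodComm n' κ)
  let eW : (κ → W) ≃ₗ[K] (m × κ → K) := (LinearEquiv.piCongrRight (fun _ => bW.equivFun)) ≪≫ₗ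
    (LinearEquiv.curry K K κ m).symm ≪≫ₗ LinearEquiv.funCongrLeft K K (Equiv.prodComm m κ)
  have hV : ∀ v p, eV v p = bV.repr (v p.2) p.1 := fun v p => rfl
  have hW : ∀ v p, eW v p = bW.repr (v p.2) p.1 := fun v p => rfl
  set Z := gz (RingHom.id K) (fun b => LinearMap.toMatrix bV bW (β b)) x with hZ
  have h : Z.mulVecLin.comp eV.toLinearMap = eW.toLinearMap.comp
      (blow (fun i j => ∑ b, x i j b • β b)) := by
    apply LinearMap.ext; intro v; funext ⟨p, i⟩
    simp only [LinearMap.comp_apply, LinearEquiv.coe_coe, hW, blow_apply, Matrix.mulVecLin_apply,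
      Matrix.mulVec, dotProduct, hV, hZ, gz, Matrix.of_apply, Fintype.sum_prod_type, map_sum,
      LinearMap.sum_apply, LinearMap.smul_apply, map_smul, Finsupp.coe_finset_sum, Finset.sum_apply,
      Finsupp.smul_apply, smul_eq_mul, RingHom.id_apply, Finset.sum_mul]
    rw [Finset.sum_comm]
    refine Finset.sum_congr rfl fun j _ => ?_
    rw [Finset.sum_comm]
    refine Finset.sum_congr rfl fun b _ => ?_
    have := LinearMap.toMatrix_mulVec_repr bV bW (β b) (v j)
    rw [← this]
    simp [Matrix.mulVec, dotProduct, Finset.mul_sum, mul_assoc]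
  have h2 := congrArg LinearMap.range h
  rw [LinearMap.range_comp, LinearMap.range_comp, LinearEquiv.range, Submodule.map_top] at h2
  change _ = finrank K (LinearMap.range Z.mulVecLin)
  rw [h2]
  exact (LinearEquiv.finrank_map_eq _ _).symm

lemma regular_fin [Infinite K] (𝓑 : Submodule K (V →ₗ[K] W)) (n : ℕ)
    (Y : Fin (n+1) → Fin (n+1) → (V →ₗ[K] W))
    (hY : ∀ i j, Y i j ∈ 𝓑) (q : ℕ) (h : (n+1) * q < finrank K (LinearMap.range (blow Y))) :
    ∃ Y' : Fin (n+1) → Fin (n+1) → (V →ₗ[K] W), (∀ i j, Y' i j ∈ 𝓑) ∧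
      (n+1) * (q+1) ≤ finrank K (LinearMap.range (blow Y')) := by
  let bV := Module.finBasis K V
  let bW := Module.finBasis K W
  let bB := Module.finBasis K 𝓑
  have hx : Y = fun i j => ∑ b, (bB.repr ⟨Y i j, hY i j⟩ b) • (bB b : V →ₗ[K] W) := by
    funext i j
    have := congrArg Subtype.val (bB.sum_repr ⟨Y i j, hY i j⟩)
    refine Eq.trans this.symm ?_
    exact (map_sum 𝓑.subtype _ _)
  rw [hx, blow_gz bV bW (fun b => (bB b : V →ₗ[K] W))
    (fun i j b => (bB.repr ⟨Y i j, hY i j⟩ b))] at h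
  obtain ⟨x', hx'⟩ := regular_matrix _ _ q h
  refine ⟨fun i j => ∑ b, x' i j b • (bB b : V →ₗ[K] W), fun i j => ?_, ?_⟩
  · exact Submodule.sum_mem _ fun b _ => Submodule.smul_mem _ _ (bB b).2
  · rw [blow_gz bV bW (fun b => (bB b : V →ₗ[K] W))]
    exact hx'

lemma rank_blow_le {κ : Type*} [Fintype κ] (Y : κ → κ → (V →ₗ[K] W)) :
    finrank K (LinearMap.range (blow Y)) ≤ Fintype.card κ * finrank K W := by
  refine (Submodule.finrank_le _).trans ?_
  rw [Module.finrank_pi_fintype]; simp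

lemma exists_max_array [Infinite K] (𝓑 : Submodule K (V →ₗ[K] W)) :
    ∃ (q n : ℕ) (X : Fin (n+1) → Fin (n+1) → (V →ₗ[K] W)), (∀ i j, X i j ∈ 𝓑) ∧
      (n+1) * q ≤ finrank K (LinearMap.range (blow X)) ∧
      ∀ (κ : Type) [Fintype κ] [Nonempty κ] (Y : κ → κ → (V →ₗ[K] W)), (∀ i j, Y i j ∈ 𝓑) →
        finrank K (LinearMap.range (blow Y)) ≤ Fintype.card κ * q := by
  let P : ℕ → Prop := fun q => ∃ (n : ℕ) (X : Fin (n+1) → Fin (n+1) → (V →ₗ[K] W)),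
    (∀ i j, X i j ∈ 𝓑) ∧ (n+1) * q ≤ finrank K (LinearMap.range (blow X))
  have hP0 : P 0 := ⟨0, fun _ _ => 0, fun _ _ => 𝓑.zero_mem, by simp⟩
  have hb : ∀ q, P q → q ≤ finrank K W := by
    rintro q ⟨n, X, _, h⟩
    have := h.trans (rank_blow_le X)
    rw [Fintype.card_fin] at this
    exact Nat.le_of_mul_le_mul_left this (Nat.succ_pos n)
  classical
  have hq := Nat.findGreatest_spec (P := P) (Nat.zero_le (finrank K W)) hP0
  set q := Nat.findGreatest P (finrank K W) with hqdef
  obtain ⟨n, X, hX, hr⟩ := hq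
  refine ⟨q, n, X, hX, hr, ?_⟩
  intro κ _ _ Y hY
  by_contra hlt
  push Not at hlt
  obtain ⟨k, hk⟩ : ∃ k, Fintype.card κ = k + 1 := ⟨Fintype.card κ - 1, by
    have := Fintype.card_pos (α := κ); omega⟩
  let e : κ ≃ Fin (k+1) := Fintype.equivFinOfCardEq hk
  rw [← blow_reindex e, hk] at hlt
  obtain ⟨Y', hY', h⟩ := regular_fin 𝓑 k _ (fun i j => hY _ _) q hlt
  have h1 : P (q+1) := ⟨k, Y', hY', h⟩
  have := Nat.le_findGreatest (hb _ h1) h1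
  omega

lemma big_chain [Infinite K] (𝓑 : Submodule K (V →ₗ[K] W)) (q : ℕ) {κ : Type} [Fintype κ] [Nonempty κ]
    (X : κ → κ → (V →ₗ[K] W)) (hX : ∀ i j, X i j ∈ 𝓑)
    (hr : Fintype.card κ * q ≤ finrank K (LinearMap.range (blow X)))
    (hmax : ∀ (κ : Type) [Fintype κ] [Nonempty κ] (Y : κ → κ → (V →ₗ[K] W)), (∀ i j, Y i j ∈ 𝓑) →
        finrank K (LinearMap.range (blow Y)) ≤ Fintype.card κ * q)
    (j : ℕ) (v : ℕ → (κ → V)) (Y : ℕ → κ → κ → (V →ₗ[K] W)) (hY : ∀ a i k, Y a i k ∈ 𝓑)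
    (h0 : blow X (v 0) = 0) (hs : ∀ i < j, blow X (v (i+1)) = blow (Y i) (v i)) :
    blow (Y j) (v j) ∈ LinearMap.range (blow X) := by
  classical
  let XB : (Fin (j+2) × κ) → (Fin (j+2) × κ) → (V →ₗ[K] W) := fun a b =>
    if a.1 = b.1 then X a.2 b.2 else 0
  let NB : (Fin (j+2) × κ) → (Fin (j+2) × κ) → (V →ₗ[K] W) := fun a b =>
    if (a.1 : ℕ) = (b.1 : ℕ) + 1 then Y b.1 a.2 b.2 else 0
  have hXB : ∀ u a i, blow XB u (a, i) = blow X (fun k => u (a, k)) i := by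
    intro u a i
    simp only [blow_apply, XB, Fintype.sum_prod_type]
    rw [Finset.sum_eq_single a]
    · simp
    · intro b _ hb; simp [Ne.symm hb]
    · simp
  let vb : ℕ → (Fin (j+2) × κ → V) := fun i a => if (a.1 : ℕ) = i then v i a.2 else 0
  have hXv : ∀ n a i, blow XB (vb n) (a, i) = if (a : ℕ) = n then blow X (v n) i else 0 := by
    intro n a i
    rw [hXB]
    split_ifs with h
    · simp [vb, h]
    · simp [vb, h, blow_apply]
  have hNv : ∀ n ≤ j, ∀ a i, blow NB (vb n) (a, i) =
      if (a : ℕ) = n + 1 then blow (Y n) (v n) i else 0 := by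
    intro n hn a i
    simp only [blow_apply, NB, Fintype.sum_prod_type, vb]
    rw [Finset.sum_eq_single (⟨n, by omega⟩ : Fin (j+2))]
    · by_cases h : (a : ℕ) = n + 1 <;> simp [h]
    · intro b _ hb
      have : (b : ℕ) ≠ n := fun h => hb (Fin.ext h)
      simp [this]
    · simp
  have hrank : Fintype.card (Fin (j+2) × κ) * q ≤ finrank K (LinearMap.range (blow XB)) := by
    let g : (Fin (j+2) → LinearMap.range (blow X)) →ₗ[K] LinearMap.range (blow XB) :=
      LinearMap.codRestrict _
        { toFun := fun w p => (w p.1).1 p.2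
          map_add' := fun _ _ => rfl
          map_smul' := fun _ _ => rfl } (by
          intro w
          choose u hu using fun a => (w a).2
          refine ⟨fun p => u p.1 p.2, ?_⟩
          funext ⟨a, i⟩
          rw [hXB]
          exact congrFun (hu a) i)
    have hg : Function.Injective g := by
      intro w w' h
      funext a
      apply Subtype.ext
      funext i
      exact congrFun (congrArg Subtype.val h) (a, i)
    have := LinearMap.finrank_le_finrank_of_injective hg
    rw [Module.finrank_pi_fintype] at this
    simp only [Finset.sum_const, Finset.card_univ, Fintype.card_fin, smul_eq_mul] at this
    rw [Fintype.card_prod, Fintype.card_fin, mul_assoc]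
    exact (Nat.mul_le_mul_left _ hr).trans this
  have key := pencil_chain (blow XB) (blow NB) (fun t => by
    rw [← blow_add_smul]
    refine (hmax _ _ ?_).trans hrank
    intro a b
    refine 𝓑.add_mem ?_ (𝓑.smul_mem _ ?_)
    · simp only [XB]; split_ifs
      · exact hX _ _
      · exact 𝓑.zero_mem
    · simp only [NB]; split_ifs
      · exact hY _ _ _
      · exact 𝓑.zero_mem) j vb
    (by funext ⟨a, i⟩; rw [hXv, h0]; simp)
    (by
      intro i hi
      funext ⟨a, k⟩
      rw [hXv, hNv i hi.le, hs i hi])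
  obtain ⟨u, hu⟩ := key
  refine ⟨fun k => u (⟨j+1, by omega⟩, k), ?_⟩
  funext i
  rw [← hXB, hu, hNv j le_rfl]
  simp

/-- the span of all `B u`. -/
def act (𝓑 : Submodule K (V →ₗ[K] W)) (U : Submodule K V) : Submodule K W :=
  Submodule.span K {w | ∃ B ∈ 𝓑, ∃ u ∈ U, B u = w}

lemma finrank_pi_const {κ : Type*} [Fintype κ] {V : Type*} [AddCommGroup V] [Module K V]
    [FiniteDimensional K V] (U : Submodule K V) :
    finrank K (Submodule.pi Set.univ (fun _ : κ => U)) = Fintype.card κ * finrank K U := by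
  let e : (Submodule.pi Set.univ (fun _ : κ => U)) ≃ₗ[K] (κ → U) :=
    { toFun := fun v i => ⟨v.1 i, v.2 i trivial⟩
      invFun := fun v => ⟨fun i => (v i).1, fun i _ => (v i).2⟩
      map_add' := fun _ _ => rfl
      map_smul' := fun _ _ => rfl
      left_inv := fun _ => rfl
      right_inv := fun _ => rfl }
  rw [e.finrank_eq, Module.finrank_pi_fintype]; simp

theorem nc_rank [Infinite K] (𝓑 : Submodule K (V →ₗ[K] W)) :
    ∃ (n : ℕ) (X : Fin (n+1) → Fin (n+1) → (V →ₗ[K] W)) (U : Submodule K V), (∀ i j, X i j ∈ 𝓑) ∧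
      finrank K (LinearMap.range (blow X)) + (n+1) * finrank K U
        = (n+1) * finrank K V + (n+1) * finrank K (act 𝓑 U) := by
  classical
  obtain ⟨q, n, X, hX, hr, hmax⟩ := exists_max_array 𝓑
  let κ := Fin (n+1)
  let Arr : (κ → κ → (V →ₗ[K] W)) → Prop := fun Y => ∀ i j, Y i j ∈ 𝓑
  let Ch : ℕ → (κ → V) → Prop := fun j w => ∃ (v : ℕ → (κ → V)) (Y : ℕ → κ → κ → (V →ₗ[K] W)),
    (∀ a, Arr (Y a)) ∧ blow X (v 0) = 0 ∧ (∀ i < j, blow X (v (i+1)) = blow (Y i) (v i)) ∧ v j = w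
  have hin : ∀ j w, Ch j w → ∀ Y, Arr Y → blow Y w ∈ LinearMap.range (blow X) := by
    rintro j w ⟨v, Y, hY, h0, hs, rfl⟩ Z hZ
    have := big_chain 𝓑 q X hX (by simpa using hr) hmax j v (fun i => if i < j then Y i else Z)
      (by intro a i k; split_ifs
          · exact hY _ _ _
          · exact hZ _ _) h0 (by intro i hi; simp [hi, hs i hi])
    simpa using this
  have hext : ∀ j w, Ch j w → ∀ Y, Arr Y → ∀ w', blow X w' = blow Y w → Ch (j+1) w' := by
    rintro j w ⟨v, Y, hY, h0, hs, rfl⟩ Z hZ w' hw'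
    refine ⟨fun i => if i ≤ j then v i else w', fun i => if i < j then Y i else Z, ?_, ?_, ?_, ?_⟩
    · intro a i k; dsimp only; split_ifs
      · exact hY _ _ _
      · exact hZ _ _
    · simpa using h0
    · intro i hi
      rcases Nat.lt_or_ge i j with h | h
      · have h1 : i + 1 ≤ j := h
        simp [h, h1, h.le, hs i h]
      · have : i = j := by omega
        subst this
        simp [hw']
    · simp
  let G : Submodule K (κ → V) := Submodule.span K {w | ∃ j, Ch j w}
  let H : Submodule K (κ → W) := Submodule.span K {z | ∃ Y, Arr Y ∧ ∃ j w, Ch j w ∧ blow Y w = z}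
  have hker : LinearMap.ker (blow X) ≤ G := by
    intro w hw
    exact Submodule.subset_span ⟨0, fun _ => w, fun _ => X, fun _ => hX, hw, by simp, rfl⟩
  have hGH : G.map (blow X) = H := by
    apply le_antisymm
    · rw [Submodule.map_span_le]
      rintro w ⟨j, hw⟩
      obtain ⟨v, Y, hY, h0, hs, rfl⟩ := hw
      cases j with
      | zero => rw [h0]; exact H.zero_mem
      | succ j =>
        rw [hs j (by omega)]
        exact Submodule.subset_span ⟨Y j, hY j, j, v j,
          ⟨v, Y, hY, h0, fun i hi => hs i (by omega), rfl⟩, rfl⟩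
    · rw [Submodule.span_le]
      rintro z ⟨Y, hY, j, w, hw, rfl⟩
      obtain ⟨w', hw'⟩ := hin j w hw Y hY
      exact ⟨w', Submodule.subset_span ⟨j+1, hext j w hw Y hY w' hw'⟩, hw'⟩
  have hYG : ∀ Y, Arr Y → ∀ g ∈ G, blow Y g ∈ H := by
    intro Y hY g hg
    have : G.map (blow Y) ≤ H := by
      rw [Submodule.map_span_le]
      rintro w ⟨j, hw⟩
      exact Submodule.subset_span ⟨Y, hY, j, w, hw, rfl⟩
    exact this ⟨g, hg, rfl⟩
  -- matrix units
  have hGE : ∀ (a b : κ) (g) (_ : g ∈ G), (Pi.single a (g b) : κ → V) ∈ G := by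
    intro a b g hg
    have : G.map ((LinearMap.single K (fun _ : κ => V) a).comp (LinearMap.proj b)) ≤ G := by
      rw [Submodule.map_span_le]
      rintro w ⟨j, hw⟩
      refine Submodule.subset_span ⟨j+1, hext j w hw (fun i k => if k = b then X i a else 0) ?_ _ ?_⟩
      · intro i k; dsimp only; split_ifs
        · exact hX _ _
        · exact 𝓑.zero_mem
      · funext i
        simp only [blow_apply, LinearMap.comp_apply, LinearMap.proj_apply, LinearMap.coe_single]
        rw [Finset.sum_eq_single a, Finset.sum_eq_single b]
        · simp
        · intro k _ hk; simp [hk]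
        · simp
        · intro k _ hk; simp [hk]
        · simp
    exact this ⟨g, hg, rfl⟩
  let U : Submodule K V := G.comap (LinearMap.single K (fun _ : κ => V) 0)
  have hU : ∀ u, u ∈ U ↔ (Pi.single 0 u : κ → V) ∈ G := fun u => Iff.rfl
  have hGpi : G = Submodule.pi Set.univ (fun _ : κ => U) := by
    apply le_antisymm
    · intro g hg i _
      exact (hU _).2 (hGE 0 i g hg)
    · intro g hg
      have e : g = ∑ i, (Pi.single i (g i) : κ → V) := (Finset.univ_sum_single g).symm
      rw [e]
      refine Submodule.sum_mem _ fun i _ => ?_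
      have := hGE i 0 _ ((hU _).1 (hg i trivial))
      simpa using this
  have hHpi : H = Submodule.pi Set.univ (fun _ : κ => act 𝓑 U) := by
    apply le_antisymm
    · rw [Submodule.span_le]
      rintro z ⟨Y, hY, j, w, hw, rfl⟩ i _
      rw [blow_apply]
      refine Submodule.sum_mem _ fun k _ => Submodule.subset_span ⟨Y i k, hY i k, w k, ?_, rfl⟩
      have : w ∈ G := Submodule.subset_span ⟨j, hw⟩
      rw [hGpi] at this
      exact this k trivial
    · have hs : ∀ i : κ, act 𝓑 U ≤ H.comap (LinearMap.single K (fun _ : κ => W) i) := by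
        intro i
        rw [act, Submodule.span_le]
        rintro w ⟨B, hB, u, hu, rfl⟩
        have := hYG (fun a b => if a = i ∧ b = 0 then B else 0) (by
          intro a b; dsimp only; split_ifs
          · exact hB
          · exact 𝓑.zero_mem) _ ((hU u).1 hu)
        change (Pi.single i (B u) : κ → W) ∈ H
        refine Eq.mp (congrArg (fun z => z ∈ H) ?_) this
        funext a
        simp only [blow_apply, LinearMap.coe_single]
        rw [Finset.sum_eq_single (0 : κ)]
        · by_cases h : a = i
          · subst h; simp
          · simp [h]
        · intro k _ hk; simp [hk]
        · simp
      intro g hg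
      have e : g = ∑ i, (Pi.single i (g i) : κ → W) := (Finset.univ_sum_single g).symm
      rw [e]
      exact Submodule.sum_mem _ fun i _ => hs i (hg i trivial)
  refine ⟨n, X, U, hX, ?_⟩
  have d1 : finrank K G = (n+1) * finrank K U := by
    rw [hGpi, finrank_pi_const]; simp [κ]
  have d2 : finrank K H = (n+1) * finrank K (act 𝓑 U) := by
    rw [hHpi, finrank_pi_const]; simp [κ]
  have d3 := LinearMap.finrank_range_add_finrank_ker (blow X)
  rw [Module.finrank_pi_fintype] at d3
  simp only [Finset.sum_const, Finset.card_univ, Fintype.card_fin, smul_eq_mul] at d3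
  have d4 := LinearMap.finrank_range_add_finrank_ker ((blow X).domRestrict G)
  rw [LinearMap.range_domRestrict, hGH] at d4
  have d5 : finrank K (LinearMap.ker ((blow X).domRestrict G)) = finrank K (LinearMap.ker (blow X)) := by
    have : LinearMap.ker ((blow X).domRestrict G) = (LinearMap.ker (blow X)).comap G.subtype := by
      rw [LinearMap.ker_domRestrict]
    rw [this]
    exact (Submodule.comapSubtypeEquivOfLe hker).finrank_eq
  rw [d1, d2, d5] at d4
  rw [← d3, ← d4]
  ring

theorem nc_surj [Infinite K] (𝓑 : Submodule K (V →ₗ[K] W))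
    (h : ∀ U : Submodule K V, finrank K W + finrank K U ≤ finrank K V + finrank K (act 𝓑 U)) :
    ∃ (n : ℕ) (X : Fin (n+1) → Fin (n+1) → (V →ₗ[K] W)), (∀ i j, X i j ∈ 𝓑) ∧
      Function.Surjective (blow X) := by
  obtain ⟨n, X, U, hX, hr⟩ := nc_rank 𝓑
  refine ⟨n, X, hX, ?_⟩
  rw [← LinearMap.range_eq_top]
  apply Submodule.eq_top_of_finrank_eq
  apply le_antisymm (Submodule.finrank_le _)
  rw [Module.finrank_pi_fintype]
  simp only [Finset.sum_const, Finset.card_univ, Fintype.card_fin, smul_eq_mul]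
  have := Nat.mul_le_mul_left (n+1) (h U)
  rw [mul_add, mul_add] at this
  omega

theorem nc_inj [Infinite K] (𝓑 : Submodule K (V →ₗ[K] W))
    (h : ∀ U : Submodule K V, finrank K U ≤ finrank K (act 𝓑 U)) :
    ∃ (n : ℕ) (X : Fin (n+1) → Fin (n+1) → (V →ₗ[K] W)), (∀ i j, X i j ∈ 𝓑) ∧
      Function.Injective (blow X) := by
  obtain ⟨n, X, U, hX, hr⟩ := nc_rank 𝓑
  refine ⟨n, X, hX, ?_⟩
  rw [← LinearMap.ker_eq_bot]
  apply Submodule.finrank_eq_zero.1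
  have d3 := LinearMap.finrank_range_add_finrank_ker (blow X)
  rw [Module.finrank_pi_fintype] at d3
  simp only [Finset.sum_const, Finset.card_univ, Fintype.card_fin, smul_eq_mul] at d3
  have := Nat.mul_le_mul_left (n+1) (h U)
  omega
end blow
end NCRank

namespace TorsPaper
section tors
variable {A : Type} [Ring A]

section general
variable {T : ModuleCat.{0} A → Prop} (hT : IsTorsionClass A T)
include hT

lemma T_surj {X Y : Type} [AddCommGroup X] [Module A X] [AddCommGroup Y] [Module A Y]
    (hX : T (ModuleCat.of A X)) (f : X →ₗ[A] Y) (hf : Function.Surjective f) :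
    T (ModuleCat.of A Y) := by
  have := hT.fin _ hX
  have : Module.Finite A X := this
  exact hT.quot _ _ hX (Module.Finite.of_surjective f hf) ⟨f, hf⟩

lemma T_range {X Y : Type} [AddCommGroup X] [Module A X] [AddCommGroup Y] [Module A Y]
    (hX : T (ModuleCat.of A X)) (f : X →ₗ[A] Y) : T (ModuleCat.of A (LinearMap.range f)) :=
  T_surj hT hX f.rangeRestrict (LinearMap.surjective_rangeRestrict f)

lemma T_sub {X : Type} [AddCommGroup X] [Module A X] [Subsingleton X] : T (ModuleCat.of A X) :=
  hT.zero _ (fun x => Subsingleton.elim (α := X) _ _)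

lemma T_ext {X Y : Type} [AddCommGroup X] [Module A X] [AddCommGroup Y] [Module A Y]
    [Module.Finite A X] (g : X →ₗ[A] Y) (hg : Function.Surjective g)
    (hY : T (ModuleCat.of A Y)) (hk : T (ModuleCat.of A (LinearMap.ker g))) :
    T (ModuleCat.of A X) := by
  refine hT.ext (ModuleCat.of A X) ‹_› (LinearMap.ker g) hk ?_
  exact T_surj hT hY (g.quotKerEquivOfSurjective hg).symm.toLinearMap
    (g.quotKerEquivOfSurjective hg).symm.surjective

lemma T_ext_mk {X : Type} [AddCommGroup X] [Module A X] [Module.Finite A X] (N : Submodule A X)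
    (h1 : T (ModuleCat.of A N)) (h2 : T (ModuleCat.of A (X ⧸ N))) : T (ModuleCat.of A X) :=
  hT.ext (ModuleCat.of A X) ‹_› N h1 h2

lemma T_prod {X Y : Type} [AddCommGroup X] [Module A X] [AddCommGroup Y] [Module A Y]
    (hX : T (ModuleCat.of A X)) (hY : T (ModuleCat.of A Y)) : T (ModuleCat.of A (X × Y)) := by
  have : Module.Finite A X := hT.fin _ hX
  have : Module.Finite A Y := hT.fin _ hY
  refine T_ext hT (LinearMap.snd A X Y) LinearMap.snd_surjective hY ?_
  refine T_surj hT hX ((LinearMap.inl A X Y).codRestrict _ (by simp)) ?_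
  rintro ⟨⟨x, y⟩, h⟩
  have hy : y = 0 := h
  subst hy
  exact ⟨x, rfl⟩

lemma exists_tors [IsNoetherianRing A] {X : Type} [AddCommGroup X] [Module A X] [Module.Finite A X] :
    ∃ N : Submodule A X, T (ModuleCat.of A N) ∧
      (∀ (Z : Type) [AddCommGroup Z] [Module A Z], T (ModuleCat.of A Z) → ∀ g : Z →ₗ[A] X,
        LinearMap.range g ≤ N) ∧
      (∀ (Z : Type) [AddCommGroup Z] [Module A Z], T (ModuleCat.of A Z) → ∀ g : Z →ₗ[A] X ⧸ N,
        g = 0) := by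
  obtain ⟨N, hN, hmax⟩ := (wellFounded_gt (α := Submodule A X)).has_min
    {N | T (ModuleCat.of A N)} ⟨⊥, T_sub hT⟩
  have h1 : (∀ (Z : Type) [AddCommGroup Z] [Module A Z], T (ModuleCat.of A Z) → ∀ g : Z →ₗ[A] X,
        LinearMap.range g ≤ N) := by
    intro Z _ _ hZ g
    have := T_range hT (T_prod hT hN hZ) (N.subtype.coprod g)
    rw [LinearMap.range_coprod, Submodule.range_subtype] at this
    have h2 := hmax _ this
    have h3 : N = N ⊔ LinearMap.range g := by
      by_contra hne
      exact h2 (lt_of_le_of_ne le_sup_left hne)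
    rw [h3]; exact le_sup_right
  refine ⟨N, hN, h1, ?_⟩
  intro Z _ _ hZ g
  let N' : Submodule A X := (LinearMap.range g).comap N.mkQ
  let p : N' →ₗ[A] LinearMap.range g := (N.mkQ.comp N'.subtype).codRestrict _ (fun x => x.2)
  have hp : Function.Surjective p := by
    rintro ⟨y, hy⟩
    obtain ⟨x, rfl⟩ := N.mkQ_surjective y
    exact ⟨⟨x, hy⟩, rfl⟩
  have hNN : N ≤ N' := by
    intro x hx
    change N.mkQ x ∈ LinearMap.range g
    have : N.mkQ x = 0 := by simpa using hx
    rw [this]; exact Submodule.zero_mem _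
  have hT' : T (ModuleCat.of A N') := by
    refine T_ext hT p hp (T_range hT hZ g) ?_
    refine T_surj hT hN ((Submodule.inclusion hNN).codRestrict _ ?_) ?_
    · intro x
      apply Subtype.ext
      change N.mkQ x = 0
      simp
    · rintro ⟨⟨x, hx⟩, h⟩
      have h0 : N.mkQ x = 0 := congrArg Subtype.val h
      exact ⟨⟨x, by simpa using h0⟩, rfl⟩
  have h2 := h1 N' hT' N'.subtype
  rw [Submodule.range_subtype] at h2
  apply LinearMap.ext
  intro z
  obtain ⟨x, hx⟩ := N.mkQ_surjective (g z)
  have hxN : x ∈ N := h2 (show N.mkQ x ∈ LinearMap.range g from hx ▸ ⟨z, rfl⟩)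
  rw [← hx]
  simpa using hxN
end general

section theta
variable {θ : ModuleCat.{0} A → ℝ} (hθ : IsStability A θ)
include hθ

lemma th_zero {X : Type} [AddCommGroup X] [Module A X] [Subsingleton X] :
    θ (ModuleCat.of A X) = 0 := by
  have hf : Module.Finite A X := inferInstance
  have := hθ (ModuleCat.of A X) (ModuleCat.of A X) (ModuleCat.of A X) hf hf hf
    LinearMap.id LinearMap.id Function.injective_id Function.surjective_id
    (Subsingleton.elim (α := Submodule A X) _ _)
  linarith

lemma th_exact {X Y : Type} [AddCommGroup X] [Module A X] [AddCommGroup Y] [Module A Y]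
    [IsNoetherianRing A] [Module.Finite A X] (g : X →ₗ[A] Y) (hg : Function.Surjective g) :
    θ (ModuleCat.of A X) = θ (ModuleCat.of A (LinearMap.ker g)) + θ (ModuleCat.of A Y) := by
  have h1 : Module.Finite A (LinearMap.ker g) := inferInstance
  have h2 : Module.Finite A Y := Module.Finite.of_surjective g hg
  exact hθ (ModuleCat.of A (LinearMap.ker g)) (ModuleCat.of A X) (ModuleCat.of A Y) h1 ‹_› h2
    (LinearMap.ker g).subtype g Subtype.val_injective hg (Submodule.range_subtype _)

lemma th_iso {X Y : Type} [AddCommGroup X] [Module A X] [AddCommGroup Y] [Module A Y]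
    [IsNoetherianRing A] [Module.Finite A X] (e : X ≃ₗ[A] Y) :
    θ (ModuleCat.of A X) = θ (ModuleCat.of A Y) := by
  rw [th_exact hθ e.toLinearMap e.surjective]
  have h : LinearMap.ker e.toLinearMap = ⊥ := e.ker
  have : Subsingleton (LinearMap.ker e.toLinearMap) := by rw [h]; infer_instance
  rw [th_zero hθ, zero_add]

lemma th_sub {X : Type} [AddCommGroup X] [Module A X]
    [IsNoetherianRing A] [Module.Finite A X] (N : Submodule A X) :
    θ (ModuleCat.of A X) = θ (ModuleCat.of A N) + θ (ModuleCat.of A (X ⧸ N)) := by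
  rw [th_exact hθ N.mkQ N.mkQ_surjective,
    th_iso hθ (LinearEquiv.ofEq _ _ (Submodule.ker_mkQ N))]

lemma th_range {X Y : Type} [AddCommGroup X] [Module A X] [AddCommGroup Y] [Module A Y]
    [IsNoetherianRing A] [Module.Finite A X] (g : X →ₗ[A] Y) :
    θ (ModuleCat.of A X) = θ (ModuleCat.of A (LinearMap.ker g)) +
      θ (ModuleCat.of A (LinearMap.range g)) := by
  rw [th_exact hθ g.rangeRestrict (LinearMap.surjective_rangeRestrict g),
    th_iso hθ (LinearEquiv.ofEq _ _ (LinearMap.ker_rangeRestrict g))]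

lemma tb_torsion [IsNoetherianRing A] : IsTorsionClass A (tThetaBar A θ) where
  fin M h := h.1
  zero M h := by
    have hs : Subsingleton M := ⟨fun a b => (h a).trans (h b).symm⟩
    refine ⟨inferInstance, fun N _ ⟨f, hf⟩ => ?_⟩
    have : Subsingleton N := hf.subsingleton
    exact (th_zero hθ (X := N)).ge
  quot M N h hN := by
    rintro ⟨f, hf⟩
    exact ⟨hN, fun Q hQ ⟨g, hg⟩ => h.2 Q hQ ⟨g.comp f, hg.comp hf⟩⟩
  ext M hM N h1 h2 := by
    refine ⟨hM, fun Q hQ ⟨g, hg⟩ => ?_⟩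
    have e := th_sub hθ (N.map g)
    have e1 : 0 ≤ θ (ModuleCat.of A (N.map g)) := by
      refine h1.2 _ (inferInstanceAs (Module.Finite A (N.map g))) ⟨g.submoduleMap N, ?_⟩
      exact g.submoduleMap_surjective N
    have e2 : 0 ≤ θ (ModuleCat.of A (Q ⧸ N.map g)) := by
      refine h2.2 _ (inferInstanceAs (Module.Finite A (Q ⧸ N.map g)))
        ⟨N.mapQ (N.map g) g (Submodule.le_comap_map _ _), ?_⟩
      intro y
      obtain ⟨y, rfl⟩ := Submodule.mkQ_surjective _ y
      obtain ⟨x, rfl⟩ := hg y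
      exact ⟨N.mkQ x, rfl⟩
    change 0 ≤ θ (ModuleCat.of A Q)
    linarith

lemma tb_nonneg {X : Type} [AddCommGroup X] [Module A X] (h : tThetaBar A θ (ModuleCat.of A X)) :
    0 ≤ θ (ModuleCat.of A X) :=
  h.2 _ h.1 ⟨LinearMap.id, Function.surjective_id⟩

lemma tf_neg [IsNoetherianRing A] [IsArtinianRing A] {X : Type} [AddCommGroup X] [Module A X]
    [Module.Finite A X] [Nontrivial X]
    (hF : ∀ (Z : Type) [AddCommGroup Z] [Module A Z], tThetaBar A θ (ModuleCat.of A Z) →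
      ∀ g : Z →ₗ[A] X, g = 0) : θ (ModuleCat.of A X) < 0 := by
  by_contra hcon
  push Not at hcon
  obtain ⟨L, ⟨hL0, hL⟩, hmin⟩ := (wellFounded_lt (α := Submodule A X)).has_min
    {L | L ≠ ⊥ ∧ 0 ≤ θ (ModuleCat.of A L)} ⟨⊤, by
      refine ⟨top_ne_bot, ?_⟩
      rw [th_iso hθ Submodule.topEquiv]
      exact hcon⟩
  have hLT : tThetaBar A θ (ModuleCat.of A L) := by
    refine ⟨inferInstanceAs (Module.Finite A L), fun Q hQ ⟨g, hg⟩ => ?_⟩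
    by_contra hneg
    push Not at hneg
    replace g : L →ₗ[A] Q := g
    rename_i g0
    have e := th_exact hθ (X := L) (Y := Q) g0 hg
    change θ (ModuleCat.of A Q) < 0 at hneg
    let L' := (LinearMap.ker (show L →ₗ[A] Q from g0)).map L.subtype
    have e1 : θ (ModuleCat.of A L') = θ (ModuleCat.of A (LinearMap.ker (show L →ₗ[A] Q from g0))) :=
      (th_iso hθ (Submodule.equivMapOfInjective L.subtype Subtype.val_injective _)).symm
    have hle : L' ≤ L := Submodule.map_subtype_le _ _
    have hpos : 0 < θ (ModuleCat.of A L') := by rw [e1]; linarith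
    have hne : L' ≠ ⊥ := by
      intro h
      have : Subsingleton L' := by rw [h]; infer_instance
      rw [th_zero hθ] at hpos
      exact lt_irrefl _ hpos
    have h2 : L' = L := by
      by_contra h
      exact hmin L' ⟨hne, hpos.le⟩ (lt_of_le_of_ne hle h)
    have h3 : θ (ModuleCat.of A L') = θ (ModuleCat.of A L) := by rw [h2]
    have hkt : LinearMap.ker (show L →ₗ[A] Q from g0) = ⊤ := by
      rw [eq_top_iff]
      rintro ⟨x, hx⟩ _
      have hx' : x ∈ L' := h2 ▸ hx
      obtain ⟨y, hy, rfl⟩ := hx'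
      exact hy
    have : Subsingleton Q := by
      constructor
      intro a b
      obtain ⟨a, rfl⟩ := hg a
      obtain ⟨b, rfl⟩ := hg b
      have h5 : ∀ a : L, (show L →ₗ[A] Q from g0) a = 0 := fun a => by
        have : a ∈ LinearMap.ker (show L →ₗ[A] Q from g0) := hkt ▸ trivial
        exact this
      exact (h5 a).trans (h5 b).symm
    rw [th_zero hθ] at hneg
    exact lt_irrefl _ hneg
  have := hF L hLT L.subtype
  apply hL0
  rw [← Submodule.range_subtype L, this, LinearMap.range_zero]

end theta
end tors
end TorsPaper

namespace TorsPaper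
open Module
section dm
variable (K : Type) [Field K] {A : Type} [Ring A] [Algebra K A]

/-- The `K`-dimension of an `A`-module. -/
noncomputable def dm (X : Type) [AddCommGroup X] [Module A X] : ℕ :=
  @finrank K X _ _ (Module.compHom X (algebraMap K A))

lemma dm_eq (X : Type) [AddCommGroup X] [Module A X] [m : Module K X] [IsScalarTower K A X] :
    dm K (A := A) X = finrank K X := by
  have : Module.compHom X (algebraMap K A) = m := by
    refine Module.ext' _ _ ?_
    intro r x
    change algebraMap K A r • x = r • x
    exact algebraMap_smul A r x
  unfold dm
  rw [this]

/-- scalar restriction facts. -/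
lemma kst (X : Type) [AddCommGroup X] [Module A X] :
    @IsScalarTower K A X _ _ (Module.compHom X (algebraMap K A)).toSMul := by
  letI := Module.compHom X (algebraMap K A)
  constructor
  intro r a x
  change (r • a) • x = algebraMap K A r • (a • x)
  rw [Algebra.smul_def, mul_smul]

variable [FiniteDimensional K A]

lemma dm_sub {X : Type} [AddCommGroup X] [Module A X] [Module.Finite A X] (N : Submodule A X) :
    dm K (A := A) X = dm K (A := A) N + dm K (A := A) (X ⧸ N) := by
  letI := Module.compHom X (algebraMap K A)
  haveI := kst K (A := A) X
  haveI : FiniteDimensional K X := Module.Finite.trans A X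
  rw [dm_eq, dm_eq, dm_eq]
  have := Submodule.finrank_quotient_add_finrank (N.restrictScalars K)
  rw [← this, add_comm]
  rfl

lemma dm_iso {X Y : Type} [AddCommGroup X] [Module A X] [AddCommGroup Y] [Module A Y]
    (e : X ≃ₗ[A] Y) : dm K (A := A) X = dm K (A := A) Y := by
  letI := Module.compHom X (algebraMap K A)
  haveI := kst K (A := A) X
  letI := Module.compHom Y (algebraMap K A)
  haveI := kst K (A := A) Y
  rw [dm_eq, dm_eq]
  exact (e.restrictScalars K).finrank_eq

lemma dm_pos {X : Type} [AddCommGroup X] [Module A X] [Module.Finite A X] [Nontrivial X] :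
    0 < dm K (A := A) X := by
  letI := Module.compHom X (algebraMap K A)
  haveI := kst K (A := A) X
  haveI : FiniteDimensional K X := Module.Finite.trans A X
  rw [dm_eq]
  exact finrank_pos

lemma dm_quot_lt {X : Type} [AddCommGroup X] [Module A X] [Module.Finite A X] (N : Submodule A X)
    (h : N ≠ ⊥) : dm K (A := A) (X ⧸ N) < dm K (A := A) X := by
  have hn : IsNoetherianRing A := IsNoetherianRing.of_finite K A
  have := dm_sub K (A := A) N
  haveI : Nontrivial N := Submodule.nontrivial_iff_ne_bot.2 h
  have := dm_pos K (A := A) (X := N)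
  omega

lemma dm_lt {X : Type} [AddCommGroup X] [Module A X] [Module.Finite A X] (N : Submodule A X)
    (h : N ≠ ⊤) : dm K (A := A) N < dm K (A := A) X := by
  have := dm_sub K (A := A) N
  haveI : Nontrivial (X ⧸ N) := Submodule.Quotient.nontrivial_iff.2 h
  have := dm_pos K (A := A) (X := X ⧸ N)
  omega
end dm

section S0
variable {A : Type} [Ring A]
/-- The simple objects of the wide subcategory `α(T)`. -/
def S0 (T : ModuleCat.{0} A → Prop) (B : ModuleCat.{0} A) : Prop :=
  T B ∧ Nonzero A B ∧ ∀ (Z : Type) [AddCommGroup Z] [Module A Z], T (ModuleCat.of A Z) →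
    ∀ g : Z →ₗ[A] B, g ≠ 0 → Function.Surjective g ∧ T (ModuleCat.of A (LinearMap.ker g))

lemma S0_bij {T : ModuleCat.{0} A → Prop} {B B' : ModuleCat.{0} A} (h : S0 T B) (h' : S0 T B')
    (g : B →ₗ[A] B') (hg : g ≠ 0) : Function.Bijective g := by
  obtain ⟨hs, hk⟩ := h'.2.2 B h.1 g hg
  refine ⟨?_, hs⟩
  rw [← LinearMap.ker_eq_bot]
  by_contra hne
  have h1 : (LinearMap.ker g).subtype ≠ 0 := by
    intro h0
    apply hne
    rw [← Submodule.range_subtype (LinearMap.ker g), h0, LinearMap.range_zero]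
  have h2 := (h.2.2 _ hk (LinearMap.ker g).subtype h1).1
  apply hg
  apply LinearMap.ext
  intro x
  obtain ⟨y, rfl⟩ := h2 x
  exact y.2

/-- isomorphism setoid -/
def isoSetoid (A : Type) [Ring A] : Setoid (ModuleCat.{0} A) where
  r X Y := Nonempty (X ≃ₗ[A] Y)
  iseqv := ⟨fun _ => ⟨LinearEquiv.refl _ _⟩, fun ⟨e⟩ => ⟨e.symm⟩, fun ⟨e⟩ ⟨f⟩ => ⟨e.trans f⟩⟩

noncomputable def isoRep (B : ModuleCat.{0} A) : ModuleCat.{0} A :=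
  (Quotient.mk (isoSetoid A) B).out

lemma isoRep_iso (B : ModuleCat.{0} A) : Nonempty (isoRep B ≃ₗ[A] B) :=
  Quotient.exact (Quotient.out_eq (Quotient.mk (isoSetoid A) B))

lemma isoRep_eq {B B' : ModuleCat.{0} A} (e : B ≃ₗ[A] B') : isoRep B = isoRep B' :=
  congrArg Quotient.out (Quotient.sound (s := isoSetoid A) (⟨e⟩ : Nonempty (B ≃ₗ[A] B')))

def SS (T : ModuleCat.{0} A → Prop) : Set (ModuleCat.{0} A) := {B | S0 T B ∧ isoRep B = B}

lemma SS_semibrick {T : ModuleCat.{0} A → Prop} (hT : IsTorsionClass A T) : IsSemibrick A (SS T) := by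
  refine ⟨fun M hM => ⟨hT.fin _ hM.1.1, hM.1.2.1, fun f hf => S0_bij hM.1 hM.1 f hf⟩, ?_⟩
  intro M hM N hN hne f
  by_contra hf
  have := S0_bij hM.1 hN.1 f hf
  apply hne
  rw [← hM.2, ← hN.2]
  exact isoRep_eq (LinearEquiv.ofBijective f this)

lemma S0_iso {T : ModuleCat.{0} A → Prop} (hT : IsTorsionClass A T) {B B' : ModuleCat.{0} A}
    (h : S0 T B) (e : B' ≃ₗ[A] B) : S0 T B' := by
  refine ⟨T_surj hT (X := B) (Y := B') h.1 e.symm.toLinearMap e.symm.surjective, ?_, ?_⟩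
  · obtain ⟨x, hx⟩ := h.2.1
    exact ⟨e.symm x, by simpa using hx⟩
  · intro Z _ _ hZ g hg
    have hg' : e.toLinearMap.comp g ≠ 0 := by
      intro h0
      apply hg
      apply LinearMap.ext
      intro z
      have := LinearMap.congr_fun h0 z
      simpa using this
    obtain ⟨h1, h2⟩ := h.2.2 Z hZ _ hg'
    refine ⟨?_, ?_⟩
    · intro y
      obtain ⟨z, hz⟩ := h1 (e y)
      exact ⟨z, e.injective hz⟩
    · rwa [LinearMap.ker_comp, LinearEquiv.ker, Submodule.comap_bot] at h2

lemma SS_mem {T : ModuleCat.{0} A → Prop} (hT : IsTorsionClass A T) {B : ModuleCat.{0} A}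
    (h : S0 T B) : isoRep B ∈ SS T := by
  obtain ⟨e⟩ := isoRep_iso B
  exact ⟨S0_iso hT h e, isoRep_eq e⟩

end S0

section gen
variable (K : Type) [Field K] {A : Type} [Ring A] [Algebra K A] [FiniteDimensional K A]

lemma alpha_filt {T T' : ModuleCat.{0} A → Prop} (hT : IsTorsionClass A T) (hT' : IsTorsionClass A T')
    (hS : ∀ B, B ∈ SS T → T' B) (n : ℕ) : ∀ (Y : Type) [AddCommGroup Y] [Module A Y],
    dm K (A := A) Y ≤ n → T (ModuleCat.of A Y) →
    (∀ (Z : Type) [AddCommGroup Z] [Module A Z], T (ModuleCat.of A Z) →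
      ∀ g : Z →ₗ[A] Y, T (ModuleCat.of A (LinearMap.ker g))) → T' (ModuleCat.of A Y) := by
  have hn : IsNoetherianRing A := IsNoetherianRing.of_finite K A
  have ha : IsArtinianRing A := IsArtinianRing.of_finite K A
  induction n with
  | zero =>
    intro Y _ _ hd hY _
    haveI : Module.Finite A Y := hT.fin _ hY
    rcases subsingleton_or_nontrivial Y with h | h
    · exact T_sub hT'
    · have := dm_pos K (A := A) (X := Y); omega
  | succ n ih =>
    intro Y _ _ hd hY hα
    haveI : Module.Finite A Y := hT.fin _ hY
    rcases subsingleton_or_nontrivial Y with h | h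
    · exact T_sub hT'
    obtain ⟨B, ⟨hB0, hB⟩, hmin⟩ := (wellFounded_lt (α := Submodule A Y)).has_min
      {B | B ≠ ⊥ ∧ T (ModuleCat.of A B)} ⟨⊤, top_ne_bot,
        T_surj hT hY Submodule.topEquiv.symm.toLinearMap Submodule.topEquiv.symm.surjective⟩
    have hBS : S0 T (ModuleCat.of A B) := by
      refine ⟨hB, ?_, ?_⟩
      · obtain ⟨x, hx, hx0⟩ := Submodule.exists_mem_ne_zero_of_ne_bot hB0
        exact ⟨(⟨x, hx⟩ : B), fun h => hx0 (congrArg Subtype.val h)⟩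
      · intro Z _ _ hZ g0 hg
        obtain ⟨g, rfl⟩ : ∃ g : Z →ₗ[A] B, g = g0 := ⟨g0, rfl⟩
        have hr := T_range hT hZ (B.subtype.comp g)
        have hk := hα Z hZ (B.subtype.comp g)
        rw [LinearMap.ker_comp, Submodule.ker_subtype, Submodule.comap_bot] at hk
        refine ⟨?_, hk⟩
        have hle : LinearMap.range (B.subtype.comp g) ≤ B := by
          rintro _ ⟨z, rfl⟩
          exact (g z).2
        have hne : LinearMap.range (B.subtype.comp g) ≠ ⊥ := by
          intro h
          apply hg
          rw [LinearMap.range_eq_bot] at h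
          apply LinearMap.ext
          intro z
          exact Subtype.ext (LinearMap.congr_fun h z)
        have heq : LinearMap.range (B.subtype.comp g) = B := by
          by_contra h
          exact hmin _ ⟨hne, hr⟩ (lt_of_le_of_ne hle h)
        rintro ⟨y, hy⟩
        rw [← heq] at hy
        obtain ⟨z, hz⟩ := hy
        exact ⟨z, Subtype.ext hz⟩
    have hBT' : T' (ModuleCat.of A B) := by
      obtain ⟨e⟩ := isoRep_iso (ModuleCat.of A B)
      exact T_surj hT' (X := isoRep (ModuleCat.of A B)) (Y := B) (hS _ (SS_mem hT hBS))
        e.toLinearMap e.surjective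
    refine T_ext_mk hT' B hBT' ?_
    apply ih (Y ⧸ B)
    · have := dm_quot_lt K (A := A) B hB0
      omega
    · exact T_surj hT hY B.mkQ B.mkQ_surjective
    · intro Z _ _ hZ g
      haveI : Module.Finite A Z := hT.fin _ hZ
      let P : Submodule A (Z × Y) := LinearMap.ker ((g.comp (LinearMap.fst A Z Y)) -
        (B.mkQ.comp (LinearMap.snd A Z Y)))
      have hP : ∀ p : Z × Y, p ∈ P ↔ g p.1 = B.mkQ p.2 := by
        intro p
        simp only [P, LinearMap.mem_ker, LinearMap.sub_apply, sub_eq_zero]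
        rfl
      let p1 : P →ₗ[A] Z := (LinearMap.fst A Z Y).comp P.subtype
      let p2 : P →ₗ[A] Y := (LinearMap.snd A Z Y).comp P.subtype
      have hPT : T (ModuleCat.of A P) := by
        refine T_ext hT p1 ?_ hZ ?_
        · intro z
          obtain ⟨y, hy⟩ := B.mkQ_surjective (g z)
          exact ⟨⟨(z, y), (hP _).2 hy.symm⟩, rfl⟩
        · refine T_surj hT hB (LinearMap.codRestrict (LinearMap.ker p1)
            (LinearMap.codRestrict P ((LinearMap.inr A Z Y).comp B.subtype) ?_) ?_) ?_
          · intro b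
            rw [hP]
            change g 0 = B.mkQ b.1
            rw [map_zero]
            exact ((Submodule.Quotient.mk_eq_zero B).2 b.2).symm
          · intro b
            rfl
          · rintro ⟨⟨⟨z, y⟩, h1⟩, h2⟩
            have hz : z = 0 := h2
            subst hz
            rw [hP] at h1
            have hy : y ∈ B := by simpa using h1.symm
            exact ⟨⟨y, hy⟩, rfl⟩
      have hk := hα P hPT p2
      refine T_surj hT hk (LinearMap.codRestrict (LinearMap.ker g)
        (p1.comp (LinearMap.ker p2).subtype) ?_) ?_
      · rintro ⟨⟨⟨z, y⟩, h1⟩, h2⟩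
        have hy : y = 0 := h2
        subst hy
        rw [hP] at h1
        rw [LinearMap.mem_ker]
        refine h1.trans ?_
        simp
      · rintro ⟨z, hz⟩
        refine ⟨⟨⟨(z, 0), (hP _).2 ?_⟩, rfl⟩, rfl⟩
        rw [LinearMap.mem_ker] at hz
        simp [hz]

lemma gen_aux {θ : ModuleCat.{0} A → ℝ} (hθ : IsStability A θ)
    (hint : ∀ M : ModuleCat.{0} A, Module.Finite A M → ∃ k : ℤ, θ M = (k : ℝ))
    {T' : ModuleCat.{0} A → Prop} (hT' : IsTorsionClass A T')
    (hS : ∀ B, B ∈ SS (tThetaBar A θ) → T' B) (n : ℕ) : ∀ (X : Type) [AddCommGroup X] [Module A X],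
    dm K (A := A) X ≤ n → tThetaBar A θ (ModuleCat.of A X) → T' (ModuleCat.of A X) := by
  have hn : IsNoetherianRing A := IsNoetherianRing.of_finite K A
  have ha : IsArtinianRing A := IsArtinianRing.of_finite K A
  have hT := tb_torsion hθ
  induction n with
  | zero =>
    intro Y _ _ hd hY
    haveI : Module.Finite A Y := hT.fin _ hY
    rcases subsingleton_or_nontrivial Y with h | h
    · exact T_sub hT'
    · have := dm_pos K (A := A) (X := Y); omega
  | succ n ih =>
    intro X _ _ hd hX
    haveI : Module.Finite A X := hT.fin _ hX
    by_cases hL : ∃ L : Submodule A X, L ≠ ⊥ ∧ L ≠ ⊤ ∧ tThetaBar A θ (ModuleCat.of A L)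
    · obtain ⟨L, h1, h2, h3⟩ := hL
      have d1 := dm_lt K (A := A) L h2
      have d2 := dm_quot_lt K (A := A) L h1
      exact T_ext_mk hT' L (ih L (by omega) h3) (ih _ (by omega) (T_surj hT hX L.mkQ L.mkQ_surjective))
    push Not at hL
    let P : ℕ → Prop := fun n => ∃ (Y : ModuleCat.{0} A) (π : Y →ₗ[A] X), Function.Surjective π ∧
      tThetaBar A θ Y ∧ (∀ (Z : Type) [AddCommGroup Z] [Module A Z], tThetaBar A θ (ModuleCat.of A Z) →
        ∀ g : Z →ₗ[A] Y, π.comp g = 0 → g = 0) ∧ θ Y = n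
    have hnat : ∀ Y : ModuleCat.{0} A, tThetaBar A θ Y → ∃ n : ℕ, θ Y = n := by
      intro Y hY
      obtain ⟨k, hk⟩ := hint Y hY.1
      have h0 : 0 ≤ θ Y := tb_nonneg hθ (X := Y) hY
      rw [hk] at h0
      have h1 : (0:ℤ) ≤ k := by exact_mod_cast h0
      refine ⟨k.toNat, ?_⟩
      rw [hk]
      have := Int.toNat_of_nonneg h1
      exact_mod_cast this.symm
    have hP : ∃ n, P n := by
      obtain ⟨n, hn⟩ := hnat _ hX
      exact ⟨n, ModuleCat.of A X, LinearMap.id, Function.surjective_id, hX,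
        fun Z _ _ hZ g hg => hg, hn⟩
    classical
    obtain ⟨Y, π, hπ, hY, hker, hYn⟩ := Nat.find_spec hP
    have hmin : ∀ (Z : Type) [AddCommGroup Z] [Module A Z] (ρ : Z →ₗ[A] X), Function.Surjective ρ →
        tThetaBar A θ (ModuleCat.of A Z) → (∀ (W : Type) [AddCommGroup W] [Module A W],
        tThetaBar A θ (ModuleCat.of A W) → ∀ g : W →ₗ[A] Z, ρ.comp g = 0 → g = 0) →
        θ Y ≤ θ (ModuleCat.of A Z) := by
      intro Z _ _ ρ h1 h2 h3
      obtain ⟨m, hm⟩ := hnat _ h2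
      have := Nat.find_min' hP ⟨ModuleCat.of A Z, ρ, h1, h2, h3, hm⟩
      rw [hYn, hm]
      exact_mod_cast this
    haveI : Module.Finite A Y := hY.1
    refine T_surj hT' (X := Y) ?_ π hπ
    refine alpha_filt K hT hT' hS _ Y le_rfl hY ?_
    intro Z _ _ hZ g
    haveI : Module.Finite A Z := hZ.1
    by_cases hg : g = 0
    · rw [hg, LinearMap.ker_zero]
      exact T_surj hT hZ Submodule.topEquiv.symm.toLinearMap Submodule.topEquiv.symm.surjective
    have hπg : π.comp g ≠ 0 := fun h => hg (hker Z hZ g h)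
    have hsurj : Function.Surjective (π.comp g) := by
      rw [← LinearMap.range_eq_top]
      by_contra h
      exact hL _ (fun h0 => hπg (LinearMap.range_eq_bot.1 h0)) h (T_range hT hZ _)
    obtain ⟨N, hN, -, hNF⟩ := exists_tors hT (X := LinearMap.ker g)
    let N' : Submodule A Z := N.map (LinearMap.ker g).subtype
    have hN'k : N' ≤ LinearMap.ker g := Submodule.map_subtype_le _ _
    let gb : (Z ⧸ N') →ₗ[A] Y := N'.liftQ g hN'k
    have hi : N ≤ N'.comap (LinearMap.ker g).subtype := Submodule.le_comap_map _ _
    let i : (LinearMap.ker g ⧸ N) →ₗ[A] (Z ⧸ N') := N.mapQ N' (LinearMap.ker g).subtype hi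
    have hinj : Function.Injective i := by
      rw [← LinearMap.ker_eq_bot, LinearMap.ker_eq_bot']
      intro y hy
      obtain ⟨⟨z, hz⟩, rfl⟩ := N.mkQ_surjective y
      have h1 : N'.mkQ z = 0 := hy
      have h2 : z ∈ N' := by simpa using h1
      obtain ⟨w, hw, hwz⟩ := h2
      have : w = ⟨z, hz⟩ := Subtype.ext hwz
      subst this
      simpa using hw
    have hmn := hmin (Z ⧸ N') (π.comp gb) (by
        intro x
        obtain ⟨z, hz⟩ := hsurj x
        exact ⟨N'.mkQ z, hz⟩) (T_surj hT hZ N'.mkQ N'.mkQ_surjective) (by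
        intro W _ _ hW h hh
        have h1 : gb.comp h = 0 := hker W hW _ (by rw [← LinearMap.comp_assoc]; exact hh)
        have h2 : ∀ w, h w ∈ LinearMap.range i := by
          intro w
          have h3 := LinearMap.congr_fun h1 w
          obtain ⟨z, hz⟩ := N'.mkQ_surjective (h w)
          have h4 : gb (h w) = 0 := h3
          rw [← hz] at h4 ⊢
          exact ⟨N.mkQ ⟨z, h4⟩, rfl⟩
        let h' : W →ₗ[A] (LinearMap.ker g ⧸ N) :=
          (LinearEquiv.ofInjective i hinj).symm.toLinearMap.comp (h.codRestrict _ h2)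
        have h5 : h' = 0 := hNF W hW h'
        apply LinearMap.ext
        intro w
        have h6 : i (h' w) = h w := by
          have := (LinearEquiv.ofInjective i hinj).apply_symm_apply (h.codRestrict _ h2 w)
          exact congrArg Subtype.val this
        rw [← h6, h5]; simp)
    have e1 := th_sub hθ N'
    have e2 := th_range hθ g
    have e3 := th_sub hθ N
    have e4 : θ (ModuleCat.of A N') = θ (ModuleCat.of A N) :=
      (th_iso hθ (Submodule.equivMapOfInjective (LinearMap.ker g).subtype Subtype.val_injective N)).symm
    have e5 := th_sub hθ (LinearMap.range g)
    have e6 : 0 ≤ θ (ModuleCat.of A (Y ⧸ LinearMap.range g)) :=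
      tb_nonneg hθ (T_surj hT (X := Y) hY (LinearMap.range g).mkQ (Submodule.mkQ_surjective _))
    have e7 : θ Y = θ (ModuleCat.of A Y) := rfl
    have e8 : 0 ≤ θ (ModuleCat.of A (LinearMap.ker g ⧸ N)) := by linarith
    refine T_ext_mk hT N hN ?_
    rcases subsingleton_or_nontrivial (LinearMap.ker g ⧸ N) with h | h
    · exact T_sub hT
    · have := tf_neg hθ hNF
      linarith

include K in
theorem semibrick_gen {θ : ModuleCat.{0} A → ℝ} (hθ : IsStability A θ)
    (hint : ∀ M : ModuleCat.{0} A, Module.Finite A M → ∃ k : ℤ, θ M = (k : ℝ)) :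
    tThetaBar A θ = torsClosure A (fun X => X ∈ SS (tThetaBar A θ)) := by
  have hn : IsNoetherianRing A := IsNoetherianRing.of_finite K A
  funext X
  apply propext
  constructor
  · intro hX T' hT' hS
    exact gen_aux K hθ hint hT' hS _ X le_rfl hX
  · intro h
    exact h _ (tb_torsion hθ) (fun Y hY => hY.1.1)
end gen
end TorsPaper

namespace TorsPaper
open Module

section ed
variable (K : Type) [Field K] {A : Type} [Ring A] [Algebra K A]

/-- fixed vectors of an element of `A`. -/
def fixK (e : A) (X : Type) [AddCommGroup X] [Module A X] [Module K X] [IsScalarTower K A X] :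
    Submodule K X where
  carrier := {x | e • x = x}
  add_mem' := by
    intro a b (ha : e • a = a) (hb : e • b = b)
    change e • (a + b) = a + b
    rw [smul_add, ha, hb]
  zero_mem' := smul_zero _
  smul_mem' := by
    intro c x (hx : e • x = x)
    change e • c • x = c • x
    rw [smul_comm, hx]

lemma mem_fixK (e : A) (X : Type) [AddCommGroup X] [Module A X] [Module K X] [IsScalarTower K A X]
    (x : X) : x ∈ fixK K e X ↔ e • x = x := Iff.rfl

noncomputable def ed (e : A) (X : Type) [AddCommGroup X] [Module A X] : ℕ :=
  letI := Module.compHom X (algebraMap K A)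
  haveI := kst K (A := A) X
  finrank K (fixK K e X)

lemma ed_eq (e : A) (X : Type) [AddCommGroup X] [Module A X] [m : Module K X] [IsScalarTower K A X] :
    ed K e X = finrank K (fixK K e X) := by
  have : Module.compHom X (algebraMap K A) = m := by
    refine Module.ext' _ _ ?_
    intro r x
    change algebraMap K A r • x = r • x
    exact algebraMap_smul A r x
  subst this
  rfl

lemma ed_one [FiniteDimensional K A] (X : Type) [AddCommGroup X] [Module A X] :
    ed K (1 : A) X = dm K (A := A) X := by
  letI := Module.compHom X (algebraMap K A)
  haveI := kst K (A := A) X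
  rw [ed_eq, dm_eq]
  have : fixK K (1 : A) X = ⊤ := by
    rw [eq_top_iff]; intro x _; exact one_smul A x
  rw [this, finrank_top]

lemma ed_iso (e : A) {X Y : Type} [AddCommGroup X] [Module A X] [AddCommGroup Y] [Module A Y]
    (f : X ≃ₗ[A] Y) : ed K e X = ed K e Y := by
  letI := Module.compHom X (algebraMap K A)
  haveI := kst K (A := A) X
  letI := Module.compHom Y (algebraMap K A)
  haveI := kst K (A := A) Y
  rw [ed_eq, ed_eq]
  let fk : X ≃ₗ[K] Y := f.restrictScalars K
  have : (fixK K e X).map fk.toLinearMap = fixK K e Y := by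
    ext y
    constructor
    · rintro ⟨x, hx, rfl⟩
      change e • f x = f x
      rw [← map_smul, (mem_fixK K e X x).1 hx]
    · intro hy
      refine ⟨f.symm y, ?_, f.apply_symm_apply y⟩
      change e • f.symm y = f.symm y
      rw [← map_smul, (mem_fixK K e Y y).1 hy]
  rw [← this]
  exact (LinearEquiv.finrank_map_eq _ _).symm

lemma ed_sub [FiniteDimensional K A] (e : A) (he : e * e = e) {X : Type} [AddCommGroup X] [Module A X]
    [Module.Finite A X] (N : Submodule A X) : ed K e X = ed K e N + ed K e (X ⧸ N) := by
  letI := Module.compHom X (algebraMap K A)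
  haveI := kst K (A := A) X
  haveI : FiniteDimensional K X := Module.Finite.trans A X
  rw [ed_eq, ed_eq, ed_eq]
  let g : fixK K e X →ₗ[K] fixK K e (X ⧸ N) :=
    ((N.mkQ.restrictScalars K).comp (fixK K e X).subtype).codRestrict _ (by
      intro x
      change e • N.mkQ x.1 = N.mkQ x.1
      rw [← map_smul, (mem_fixK K e X x.1).1 x.2])
  have hg : LinearMap.range g = ⊤ := by
    rw [LinearMap.range_eq_top]
    rintro ⟨y, hy⟩
    obtain ⟨x, rfl⟩ := N.mkQ_surjective y
    refine ⟨⟨e • x, ?_⟩, ?_⟩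
    · rw [mem_fixK, smul_smul, he]
    · apply Subtype.ext
      change N.mkQ (e • x) = N.mkQ x
      rw [map_smul]; exact hy
  have h1 := LinearMap.finrank_range_add_finrank_ker g
  rw [hg, finrank_top] at h1
  rw [← h1, add_comm]
  congr 1
  let i : LinearMap.ker g ≃ₗ[K] fixK K e N :=
    { toFun := fun x => ⟨⟨x.1.1, by
          have := congrArg Subtype.val x.2
          have h2 : N.mkQ x.1.1 = 0 := this
          simpa using h2⟩, Subtype.ext x.1.2⟩
      invFun := fun y => ⟨⟨y.1.1, congrArg Subtype.val y.2⟩, by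
          apply Subtype.ext
          change N.mkQ y.1.1 = 0
          simp⟩
      map_add' := fun _ _ => rfl
      map_smul' := fun _ _ => rfl
      left_inv := fun _ => rfl
      right_inv := fun _ => rfl }
  exact i.finrank_eq
end ed

/-- weight data: two families of idempotents -/
structure Wt (A : Type) [Ring A] where
  Q : Type
  P : Type
  [fQ : Fintype Q]
  [fP : Fintype P]
  s : Q → A
  t : P → A
  hs : ∀ q, s q * s q = s q
  ht : ∀ p, t p * t p = t p

attribute [instance] Wt.fQ Wt.fP

namespace Wt
variable {A : Type} [Ring A]

/-- blow up of weight data -/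
def bl (D : Wt A) (κ : Type) [Fintype κ] : Wt A where
  Q := D.Q × κ
  P := D.P × κ
  s q := D.s q.1
  t p := D.t p.1
  hs q := D.hs q.1
  ht p := D.ht p.1

def IsMat (D : Wt A) (f : D.P → D.Q → A) : Prop :=
  ∀ p q, D.t p * f p q = f p q ∧ f p q * D.s q = f p q

def TF (D : Wt A) (f : D.P → D.Q → A) (X : Type) [AddCommGroup X] [Module A X] : Prop :=
  ∀ v : D.P → X, ∃ u : D.Q → X, ∀ p, D.t p • v p = ∑ q, f p q • u q

def IF (D : Wt A) (f : D.P → D.Q → A) (X : Type) [AddCommGroup X] [Module A X] : Prop :=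
  ∀ u : D.Q → X, (∀ p, ∑ q, f p q • u q = 0) → ∀ q, D.s q • u q = 0

variable (K : Type) [Field K] [Algebra K A]

noncomputable def w (D : Wt A) (X : Type) [AddCommGroup X] [Module A X] : ℤ :=
  (∑ q, (ed K (D.s q) X : ℤ)) - ∑ p, (ed K (D.t p) X : ℤ)

lemma w_bl (D : Wt A) (κ : Type) [Fintype κ] (X : Type) [AddCommGroup X] [Module A X] :
    (D.bl κ).w K X = Fintype.card κ * D.w K X := by
  unfold w
  have h1 : ∑ q : (D.bl κ).Q, (ed K ((D.bl κ).s q) X : ℤ) = Fintype.card κ * ∑ q, (ed K (D.s q) X : ℤ) := by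
    change ∑ q : D.Q × κ, (ed K (D.s q.1) X : ℤ) = _
    rw [Fintype.sum_prod_type]; simp [Finset.mul_sum]
  have h2 : ∑ q : (D.bl κ).P, (ed K ((D.bl κ).t q) X : ℤ) = Fintype.card κ * ∑ q, (ed K (D.t q) X : ℤ) := by
    change ∑ q : D.P × κ, (ed K (D.t q.1) X : ℤ) = _
    rw [Fintype.sum_prod_type]; simp [Finset.mul_sum]
  rw [h1, h2, mul_sub]

lemma w_sub [FiniteDimensional K A] (D : Wt A) {X : Type} [AddCommGroup X] [Module A X]
    [Module.Finite A X] (N : Submodule A X) : D.w K X = D.w K N + D.w K (X ⧸ N) := by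
  unfold w
  simp only [ed_sub K _ (D.hs _) N, ed_sub K _ (D.ht _) N, Nat.cast_add, Finset.sum_add_distrib]
  ring

lemma w_iso (D : Wt A) {X Y : Type} [AddCommGroup X] [Module A X] [AddCommGroup Y] [Module A Y]
    (e : X ≃ₗ[A] Y) : D.w K X = D.w K Y := by
  unfold w
  simp only [ed_iso K _ e]

/-- the vectors fixed componentwise -/
def Vs {Q : Type} (s : Q → A) (X : Type) [AddCommGroup X] [Module A X] [Module K X]
    [IsScalarTower K A X] : Submodule K (Q → X) := Submodule.pi Set.univ (fun q => fixK K (s q) X)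

lemma mem_Vs {Q : Type} (s : Q → A) (X : Type) [AddCommGroup X] [Module A X] [Module K X]
    [IsScalarTower K A X] (u : Q → X) : u ∈ Vs K s X ↔ ∀ q, s q • u q = u q :=
  ⟨fun h q => h q trivial, fun h q _ => h q⟩

lemma finrank_Vs {Q : Type} [Fintype Q] (s : Q → A) (X : Type) [AddCommGroup X] [Module A X] [Module K X]
    [IsScalarTower K A X] [FiniteDimensional K X] : finrank K (Vs K s X) = ∑ q, ed K (s q) X := by
  let e : Vs K s X ≃ₗ[K] ((q : Q) → fixK K (s q) X) :=
    { toFun := fun v i => ⟨v.1 i, v.2 i trivial⟩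
      invFun := fun v => ⟨fun i => (v i).1, fun i _ => (v i).2⟩
      map_add' := fun _ _ => rfl
      map_smul' := fun _ _ => rfl
      left_inv := fun _ => rfl
      right_inv := fun _ => rfl }
  rw [e.finrank_eq, Module.finrank_pi_fintype]
  simp only [ed_eq]

lemma w_eq (D : Wt A) (X : Type) [AddCommGroup X] [Module A X] [Module K X]
    [IsScalarTower K A X] [FiniteDimensional K X] :
    D.w K X = finrank K (Vs K D.s X) - finrank K (Vs K D.t X) := by
  rw [finrank_Vs, finrank_Vs]; simp [w]

/-- action of a matrix -/
def mact (D : Wt A) (X : Type) [AddCommGroup X] [Module A X] [Module K X] [IsScalarTower K A X] :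
    (D.P → D.Q → A) →ₗ[K] (Vs K D.s X →ₗ[K] Vs K D.t X) where
  toFun F :=
    { toFun := fun u => ⟨fun p => D.t p • ∑ q, F p q • u.1 q, by
        rw [mem_Vs]; intro p; rw [smul_smul, D.ht]⟩
      map_add' := by
        intro u v; apply Subtype.ext; funext p
        simp [smul_add, Finset.sum_add_distrib]
      map_smul' := by
        intro c v; apply Subtype.ext; funext p
        simp only [SetLike.val_smul, Pi.smul_apply, RingHom.id_apply]
        simp only [smul_comm _ c, ← Finset.smul_sum] }
  map_add' F G := by
    apply LinearMap.ext; intro u; apply Subtype.ext; funext p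
    simp [add_smul, Finset.sum_add_distrib]
  map_smul' c F := by
    apply LinearMap.ext; intro u; apply Subtype.ext; funext p
    simp only [Pi.smul_apply, RingHom.id_apply, LinearMap.smul_apply, SetLike.val_smul, LinearMap.coe_mk,
      AddHom.coe_mk]
    simp only [smul_assoc, ← Finset.smul_sum, smul_comm _ c]

lemma mact_apply (D : Wt A) (X : Type) [AddCommGroup X] [Module A X] [Module K X] [IsScalarTower K A X]
    (F : D.P → D.Q → A) (u : Vs K D.s X) (p : D.P) :
    (D.mact K X F u).1 p = D.t p • ∑ q, F p q • u.1 q := rfl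

lemma IsMat.smul_sum {D : Wt A} {f : D.P → D.Q → A} (hf : D.IsMat f) {X : Type} [AddCommGroup X]
    [Module A X] (u : D.Q → X) (p : D.P) : D.t p • ∑ q, f p q • u q = ∑ q, f p q • u q := by
  simp only [Finset.smul_sum, smul_smul, (hf p _).1]

lemma IsMat.sum_s {D : Wt A} {f : D.P → D.Q → A} (hf : D.IsMat f) {X : Type} [AddCommGroup X]
    [Module A X] (u : D.Q → X) (p : D.P) : ∑ q, f p q • D.s q • u q = ∑ q, f p q • u q := by
  simp only [smul_smul, (hf p _).2]

lemma TF_iff {D : Wt A} {f : D.P → D.Q → A} (hf : D.IsMat f) (X : Type) [AddCommGroup X]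
    [Module A X] [Module K X] [IsScalarTower K A X] :
    D.TF f X ↔ Function.Surjective (D.mact K X f) := by
  constructor
  · intro h v
    obtain ⟨u, hu⟩ := h v.1
    refine ⟨⟨fun q => D.s q • u q, ?_⟩, ?_⟩
    · rw [mem_Vs]; intro q; rw [smul_smul, D.hs]
    · apply Subtype.ext; funext p
      rw [mact_apply, hf.smul_sum, hf.sum_s, ← hu]
      exact (mem_Vs K D.t X v.1).1 v.2 p
  · intro h v
    obtain ⟨u, hu⟩ := h ⟨fun p => D.t p • v p, by
      rw [mem_Vs]; intro q; rw [smul_smul, D.ht]⟩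
    refine ⟨u.1, fun p => ?_⟩
    have := congrFun (congrArg Subtype.val hu) p
    rw [mact_apply, hf.smul_sum] at this
    exact this.symm

lemma IF_iff {D : Wt A} {f : D.P → D.Q → A} (hf : D.IsMat f) (X : Type) [AddCommGroup X]
    [Module A X] [Module K X] [IsScalarTower K A X] :
    D.IF f X ↔ Function.Injective (D.mact K X f) := by
  rw [← LinearMap.ker_eq_bot, LinearMap.ker_eq_bot']
  constructor
  · intro h u hu
    apply Subtype.ext; funext q
    rw [← (mem_Vs K D.s X u.1).1 u.2 q]
    apply h u.1
    intro p
    have := congrFun (congrArg Subtype.val hu) p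
    rwa [mact_apply, hf.smul_sum] at this
  · intro h u hu q
    have := h ⟨fun q => D.s q • u q, by rw [mem_Vs]; intro q; rw [smul_smul, D.hs]⟩ (by
      apply Subtype.ext; funext p
      rw [mact_apply, hf.smul_sum, hf.sum_s, hu]; rfl)
    exact congrFun (congrArg Subtype.val this) q

variable [FiniteDimensional K A]

lemma TF_w {D : Wt A} {f : D.P → D.Q → A} (hf : D.IsMat f) {X : Type} [AddCommGroup X]
    [Module A X] [Module.Finite A X] (h : D.TF f X) : 0 ≤ D.w K X := by
  letI := Module.compHom X (algebraMap K A)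
  haveI := kst K (A := A) X
  haveI : FiniteDimensional K X := Module.Finite.trans A X
  rw [w_eq]
  have := LinearMap.finrank_le_finrank_of_surjective ((TF_iff K hf X).1 h)
  omega

lemma IF_w {D : Wt A} {f : D.P → D.Q → A} (hf : D.IsMat f) {X : Type} [AddCommGroup X]
    [Module A X] [Module.Finite A X] (h : D.IF f X) : D.w K X ≤ 0 := by
  letI := Module.compHom X (algebraMap K A)
  haveI := kst K (A := A) X
  haveI : FiniteDimensional K X := Module.Finite.trans A X
  rw [w_eq]
  have := LinearMap.finrank_le_finrank_of_injective ((IF_iff K hf X).1 h)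
  omega

lemma pencil [Infinite K] {D : Wt A} {f1 f2 : D.P → D.Q → A} (hf1 : D.IsMat f1) (hf2 : D.IsMat f2)
    {M N : Type} [AddCommGroup M] [Module A M] [Module.Finite A M]
    [AddCommGroup N] [Module A N] [Module.Finite A N] (hM : D.TF f1 M) (hN : D.IF f2 N) :
    ∃ f, D.IsMat f ∧ D.TF f M ∧ D.IF f N := by
  letI := Module.compHom M (algebraMap K A)
  haveI := kst K (A := A) M
  haveI : FiniteDimensional K M := Module.Finite.trans A M
  letI := Module.compHom N (algebraMap K A)
  haveI := kst K (A := A) N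
  haveI : FiniteDimensional K N := Module.Finite.trans A N
  have h1 := NCRank.rank_pencil_finite (D.mact K M f1) (D.mact K M f2)
  have h2 := NCRank.rank_pencil_finite (D.mact K N f2) (D.mact K N f1)
  obtain ⟨τ, hτ⟩ := ((h1.union ((h2.image (fun x => x⁻¹)).union
    (Set.finite_singleton (0:K)))).infinite_compl).nonempty
  simp only [Set.mem_compl_iff, Set.mem_union, not_or, Set.mem_singleton_iff] at hτ
  obtain ⟨hτ1, hτ2, hτ0⟩ := hτ
  have hf : D.IsMat (f1 + τ • f2) := by
    intro p q
    simp only [Pi.add_apply, Pi.smul_apply, mul_add, add_mul, Algebra.mul_smul_comm,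
      Algebra.smul_mul_assoc, (hf1 p q).1, (hf1 p q).2, (hf2 p q).1, (hf2 p q).2, and_self]
  refine ⟨f1 + τ • f2, hf, ?_, ?_⟩
  · rw [TF_iff K hf, map_add, map_smul, ← LinearMap.range_eq_top]
    rw [TF_iff K hf1, ← LinearMap.range_eq_top] at hM
    apply Submodule.eq_top_of_finrank_eq
    apply le_antisymm (Submodule.finrank_le _)
    have : ¬ (finrank K (LinearMap.range (D.mact K M f1 + τ • D.mact K M f2)) <
        finrank K (LinearMap.range (D.mact K M f1))) := hτ1
    rw [not_lt, hM, finrank_top] at this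
    exact this
  · rw [IF_iff K hf, map_add, map_smul]
    rw [IF_iff K hf2] at hN
    have h3 : ¬ (finrank K (LinearMap.range (D.mact K N f2 + τ⁻¹ • D.mact K N f1)) <
        finrank K (LinearMap.range (D.mact K N f2))) := by
      intro h
      exact hτ2 ⟨τ⁻¹, h, inv_inv τ⟩
    rw [not_lt, LinearMap.finrank_range_of_inj hN] at h3
    have h4 := LinearMap.finrank_range_add_finrank_ker (D.mact K N f2 + τ⁻¹ • D.mact K N f1)
    have h5 : LinearMap.ker (D.mact K N f2 + τ⁻¹ • D.mact K N f1) = ⊥ := by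
      apply Submodule.finrank_eq_zero.1; omega
    rw [← LinearMap.ker_eq_bot, LinearMap.ker_eq_bot']
    intro u hu
    rw [LinearMap.ker_eq_bot'] at h5
    apply h5
    have : D.mact K N f2 + τ⁻¹ • D.mact K N f1 = τ⁻¹ • (D.mact K N f1 + τ • D.mact K N f2) := by
      rw [smul_add, smul_smul, inv_mul_cancel₀ hτ0, one_smul, add_comm]
    rw [this, LinearMap.smul_apply, hu, smul_zero]
end Wt
end TorsPaper

namespace TorsPaper
open Module
namespace Wt
variable {A : Type} [Ring A] (K : Type) [Field K] [Algebra K A]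

open Classical in
/-- Put a vector in component `p`. -/
noncomputable def Jp (D : Wt A) (X : Type) [AddCommGroup X] [Module A X] [Module K X] [IsScalarTower K A X]
    (p : D.P) : X →ₗ[K] Vs K D.t X where
  toFun x := ⟨Pi.single p (D.t p • x), by
    rw [mem_Vs]; intro p'
    by_cases h : p' = p
    · subst h; simp [smul_smul, D.ht]
    · simp [h]⟩
  map_add' x y := by
    apply Subtype.ext; simp [smul_add, Pi.single_add]
  map_smul' c x := by
    apply Subtype.ext
    simp only [SetLike.val_smul, RingHom.id_apply]
    rw [← Pi.single_smul, smul_comm]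

lemma act_le (D : Wt A) (X : Type) [AddCommGroup X] [Module A X] [Module K X]
    [IsScalarTower K A X] [FiniteDimensional K X] (U : Submodule K (Vs K D.s X)) :
    ∃ L : Submodule A X, finrank K U ≤ ∑ q, ed K (D.s q) L ∧
      ∑ p, ed K (D.t p) L ≤ finrank K (NCRank.act (LinearMap.range (D.mact K X)) U) := by
  classical
  let L : Submodule A X := Submodule.span A {x | ∃ u ∈ U, ∃ q, u.1 q = x}
  haveI : FiniteDimensional K L := inferInstanceAs (FiniteDimensional K (L.restrictScalars K))
  refine ⟨L, ?_, ?_⟩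
  · rw [← finrank_Vs]
    let i : U →ₗ[K] Vs K D.s L :=
      { toFun := fun u => ⟨fun q => ⟨u.1.1 q, Submodule.subset_span ⟨u.1, u.2, q, rfl⟩⟩, by
          rw [mem_Vs]; intro q; apply Subtype.ext
          exact (mem_Vs K D.s X u.1.1).1 u.1.2 q⟩
        map_add' := fun _ _ => rfl
        map_smul' := fun _ _ => rfl }
    apply LinearMap.finrank_le_finrank_of_injective (f := i)
    intro u v h
    apply Subtype.ext; apply Subtype.ext; funext q
    exact congrArg Subtype.val (congrFun (congrArg Subtype.val h) q)
  · rw [← finrank_Vs]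
    have key : ∀ (p : D.P) (x : X), x ∈ L → ∀ a : A,
        D.Jp K X p (a • x) ∈ NCRank.act (LinearMap.range (D.mact K X)) U := by
      intro p x hx
      induction hx using Submodule.span_induction with
      | mem x h =>
        obtain ⟨u, hu, q, rfl⟩ := h
        intro a
        refine Submodule.subset_span ⟨_, ⟨Pi.single p (Pi.single q a), rfl⟩, u, hu, ?_⟩
        apply Subtype.ext; funext p'
        rw [mact_apply]
        change _ = (Pi.single p (D.t p • a • u.1 q) : D.P → X) p'
        by_cases h : p' = p
        · subst h
          simp only [Pi.single_eq_same]
          congr 1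
          rw [Finset.sum_eq_single q]
          · simp
          · intro b _ hb; simp [hb]
          · simp
        · simp [h]
      | zero => intro a; simp
      | add x y _ _ hx hy => intro a; rw [smul_add, map_add]; exact add_mem (hx a) (hy a)
      | smul b x _ hx => intro a; rw [smul_smul]; exact hx _
    let i : Vs K D.t L →ₗ[K] Vs K D.t X :=
      { toFun := fun u => ⟨fun q => (u.1 q).1, by
          rw [mem_Vs]; intro q
          exact congrArg Subtype.val ((mem_Vs K D.t L u.1).1 u.2 q)⟩
        map_add' := fun _ _ => rfl
        map_smul' := fun _ _ => rfl }
    have hi : ∀ u, i u ∈ NCRank.act (LinearMap.range (D.mact K X)) U := by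
      intro u
      have : i u = ∑ p, D.Jp K X p ((1 : A) • (u.1 p).1) := by
        apply Subtype.ext
        rw [AddSubmonoidClass.coe_finsetSum]
        funext p
        rw [Finset.sum_apply, Finset.sum_eq_single p]
        · change _ = (Pi.single p (D.t p • (1 : A) • (u.1 p).1) : D.P → X) p
          rw [Pi.single_eq_same, one_smul]
          exact ((mem_Vs K D.t X (i u).1).1 (i u).2 p).symm
        · intro b _ hb
          change (Pi.single b _ : D.P → X) p = 0
          simp [Ne.symm hb]
        · simp
      rw [this]
      exact Submodule.sum_mem _ fun p _ => key p _ (u.1 p).2 1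
    apply LinearMap.finrank_le_finrank_of_injective (f := i.codRestrict _ hi)
    intro u v h
    apply Subtype.ext; funext q; apply Subtype.ext
    exact congrFun (congrArg Subtype.val (congrArg Subtype.val h)) q

/-- matrix associated with a matrix of matrices -/
def mkm (D : Wt A) {κ : Type} [Fintype κ] (F : κ → κ → D.P → D.Q → A) : (D.bl κ).P → (D.bl κ).Q → A :=
  fun p q => D.t p.1 * F p.2 q.2 p.1 q.1 * D.s q.1

lemma mkm_isMat (D : Wt A) {κ : Type} [Fintype κ] (F : κ → κ → D.P → D.Q → A) :
    (D.bl κ).IsMat (D.mkm F) := by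
  intro p q
  constructor
  · change D.t p.1 * (D.t p.1 * F p.2 q.2 p.1 q.1 * D.s q.1) = _
    rw [← mul_assoc, ← mul_assoc, D.ht]; rfl
  · change D.t p.1 * F p.2 q.2 p.1 q.1 * D.s q.1 * D.s q.1 = _
    rw [mul_assoc, D.hs]; rfl

lemma mkm_sum (D : Wt A) {κ : Type} [Fintype κ] (F : κ → κ → D.P → D.Q → A)
    (X : Type) [AddCommGroup X] [Module A X] [Module K X] [IsScalarTower K A X] (u : (D.bl κ).Q → X)
    (u' : κ → Vs K D.s X) (h : ∀ j q, (u' j).1 q = D.s q • u (q, j)) (p : D.P) (i : κ) :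
    ∑ q, D.mkm F (p, i) q • u q = (NCRank.blow (fun i j => D.mact K X (F i j)) u' i).1 p := by
  rw [NCRank.blow_apply, AddSubmonoidClass.coe_finsetSum, Finset.sum_apply]
  simp only [mact_apply, h]
  change ∑ q : D.Q × κ, _ = _
  rw [Fintype.sum_prod_type_right]
  simp only [mkm, Finset.smul_sum, smul_smul, mul_assoc]

variable [FiniteDimensional K A] [Infinite K]

lemma exists_TF (D : Wt A) (X : Type) [AddCommGroup X] [Module A X] [Module.Finite A X]
    (h : ∀ L : Submodule A X, 0 ≤ D.w K (X ⧸ L)) :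
    ∃ (n : ℕ) (f : _), (D.bl (Fin (n+1))).IsMat f ∧ (D.bl (Fin (n+1))).TF f X := by
  letI := Module.compHom X (algebraMap K A)
  haveI := kst K (A := A) X
  haveI : FiniteDimensional K X := Module.Finite.trans A X
  obtain ⟨n, F, hF, hs⟩ := NCRank.nc_surj (LinearMap.range (D.mact K X)) (by
    intro U
    obtain ⟨L, h1, h2⟩ := D.act_le K X U
    have h3 := h L
    have h4 := D.w_sub K L
    have h5 := D.w_eq K X
    have h6 : D.w K L = (∑ q, (ed K (D.s q) L : ℤ)) - ∑ p, (ed K (D.t p) L : ℤ) := rfl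
    zify at *
    linarith)
  choose G hG using hF
  refine ⟨n, D.mkm G, D.mkm_isMat G, ?_⟩
  intro v
  obtain ⟨u', hu'⟩ := hs (fun i => ⟨fun p => D.t p • v (p, i), by
    rw [mem_Vs]; intro p; rw [smul_smul, D.ht]⟩)
  refine ⟨fun q => (u' q.2).1 q.1, ?_⟩
  rintro ⟨p, i⟩
  rw [D.mkm_sum K G X _ u' (fun j q => ((mem_Vs K D.s X _).1 (u' j).2 q).symm) p i]
  simp only [hG]
  rw [hu']
  rfl

lemma exists_IF (D : Wt A) (X : Type) [AddCommGroup X] [Module A X] [Module.Finite A X]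
    (h : ∀ L : Submodule A X, D.w K L ≤ 0) :
    ∃ (n : ℕ) (f : _), (D.bl (Fin (n+1))).IsMat f ∧ (D.bl (Fin (n+1))).IF f X := by
  letI := Module.compHom X (algebraMap K A)
  haveI := kst K (A := A) X
  haveI : FiniteDimensional K X := Module.Finite.trans A X
  obtain ⟨n, F, hF, hs⟩ := NCRank.nc_inj (LinearMap.range (D.mact K X)) (by
    intro U
    obtain ⟨L, h1, h2⟩ := D.act_le K X U
    have h3 := h L
    have h6 : D.w K L = (∑ q, (ed K (D.s q) L : ℤ)) - ∑ p, (ed K (D.t p) L : ℤ) := rfl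
    zify at *
    linarith)
  choose G hG using hF
  refine ⟨n, D.mkm G, D.mkm_isMat G, ?_⟩
  intro u hu
  let u' : Fin (n+1) → Vs K D.s X := fun j => ⟨fun q => D.s q • u (q, j), by
    rw [mem_Vs]; intro p; rw [smul_smul, D.hs]⟩
  have h0 : u' = 0 := by
    apply hs
    rw [map_zero]
    funext i; apply Subtype.ext; funext p
    have := D.mkm_sum K G X u u' (fun j q => rfl) p i
    simp only [hG] at this
    exact this.symm.trans (hu (p, i))
  rintro ⟨q, j⟩
  exact congrFun (congrArg Subtype.val (congrFun h0 j)) q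

end Wt

namespace Wt
variable {A : Type} [Ring A]

/-- Diagonal blow-up of a matrix along a reindexing `κ ≃ κ1 × κ2` -/
lemma TF_diag (D : Wt A) {κ1 κ2 : Type} [Fintype κ1] [Fintype κ2] (f : (D.bl κ1).P → (D.bl κ1).Q → A)
    (hf : (D.bl κ1).IsMat f) : ∃ g : (D.bl (κ1 × κ2)).P → (D.bl (κ1 × κ2)).Q → A,
      (D.bl (κ1 × κ2)).IsMat g ∧ ∀ (X : Type) [AddCommGroup X] [Module A X],
        ((D.bl κ1).TF f X → (D.bl (κ1 × κ2)).TF g X) ∧ ((D.bl κ1).IF f X → (D.bl (κ1 × κ2)).IF g X) := by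
  classical
  let g : (D.bl (κ1 × κ2)).P → (D.bl (κ1 × κ2)).Q → A := fun p q =>
    if p.2.2 = q.2.2 then f (p.1, p.2.1) (q.1, q.2.1) else 0
  have hsum : ∀ (X : Type) [AddCommGroup X] [Module A X] (u : (D.bl (κ1 × κ2)).Q → X) p i k,
      ∑ q, g (p, i, k) q • u q = ∑ q : (D.bl κ1).Q, f (p, i) q • u (q.1, q.2, k) := by
    intro X _ _ u p i k
    change ∑ q : D.Q × κ1 × κ2, _ = ∑ q : D.Q × κ1, _
    simp only [Fintype.sum_prod_type, g]
    refine Finset.sum_congr rfl fun q _ => Finset.sum_congr rfl fun j _ => ?_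
    rw [Finset.sum_eq_single k]
    · simp
    · intro b _ hb; simp [Ne.symm hb]
    · simp
  refine ⟨g, ?_, ?_⟩
  · rintro ⟨p, i, k⟩ ⟨q, j, l⟩
    simp only [g]
    split_ifs
    · exact hf (p, i) (q, j)
    · simp
  · intro X _ _
    constructor
    · intro h v
      choose u hu using fun k => h (fun p => v (p.1, p.2, k))
      refine ⟨fun q => u q.2.2 (q.1, q.2.1), ?_⟩
      rintro ⟨p, i, k⟩
      rw [hsum]
      exact hu k (p, i)
    · rintro h u hu ⟨q, j, k⟩
      exact h (fun q => u (q.1, q.2, k)) (by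
        rintro ⟨p, i⟩
        rw [← hsum]; exact hu _) (q, j)

lemma TF_diag' (D : Wt A) {κ1 κ2 : Type} [Fintype κ1] [Fintype κ2] (f : (D.bl κ2).P → (D.bl κ2).Q → A)
    (hf : (D.bl κ2).IsMat f) : ∃ g : (D.bl (κ1 × κ2)).P → (D.bl (κ1 × κ2)).Q → A,
      (D.bl (κ1 × κ2)).IsMat g ∧ ∀ (X : Type) [AddCommGroup X] [Module A X],
        ((D.bl κ2).TF f X → (D.bl (κ1 × κ2)).TF g X) ∧ ((D.bl κ2).IF f X → (D.bl (κ1 × κ2)).IF g X) := by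
  classical
  let g : (D.bl (κ1 × κ2)).P → (D.bl (κ1 × κ2)).Q → A := fun p q =>
    if p.2.1 = q.2.1 then f (p.1, p.2.2) (q.1, q.2.2) else 0
  have hsum : ∀ (X : Type) [AddCommGroup X] [Module A X] (u : (D.bl (κ1 × κ2)).Q → X) p i k,
      ∑ q, g (p, k, i) q • u q = ∑ q : (D.bl κ2).Q, f (p, i) q • u (q.1, k, q.2) := by
    intro X _ _ u p i k
    change ∑ q : D.Q × κ1 × κ2, _ = ∑ q : D.Q × κ2, _
    simp only [Fintype.sum_prod_type, g]
    refine Finset.sum_congr rfl fun q _ => ?_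
    rw [Finset.sum_eq_single k]
    · simp
    · intro b _ hb; simp [Ne.symm hb]
    · simp
  refine ⟨g, ?_, ?_⟩
  · rintro ⟨p, k, i⟩ ⟨q, l, j⟩
    simp only [g]
    split_ifs
    · exact hf (p, i) (q, j)
    · simp
  · intro X _ _
    constructor
    · intro h v
      choose u hu using fun k => h (fun p => v (p.1, k, p.2))
      refine ⟨fun q => u q.2.1 (q.1, q.2.2), ?_⟩
      rintro ⟨p, k, i⟩
      rw [hsum]
      exact hu k (p, i)
    · rintro h u hu ⟨q, k, j⟩
      exact h (fun q => u (q.1, k, q.2)) (by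
        rintro ⟨p, i⟩
        rw [← hsum]; exact hu _) (q, j)

lemma exists_both (K : Type) [Field K] [Algebra K A] [FiniteDimensional K A] [Infinite K]
    (D : Wt A) (X Y : Type) [AddCommGroup X] [Module A X] [Module.Finite A X]
    [AddCommGroup Y] [Module A Y] [Module.Finite A Y]
    (hX : ∀ L : Submodule A X, 0 ≤ D.w K (X ⧸ L)) (hY : ∀ L : Submodule A Y, D.w K L ≤ 0) :
    ∃ (κ : Type) (_ : Fintype κ) (_ : Nonempty κ) (f : _), (D.bl κ).IsMat f ∧ (D.bl κ).TF f X ∧ (D.bl κ).IF f Y := by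
  obtain ⟨n, f, hf, hfX⟩ := D.exists_TF K X hX
  obtain ⟨m, g, hg, hgY⟩ := D.exists_IF K Y hY
  obtain ⟨f', hf', h1⟩ := D.TF_diag (κ2 := Fin (m+1)) f hf
  obtain ⟨g', hg', h2⟩ := D.TF_diag' (κ1 := Fin (n+1)) g hg
  exact ⟨Fin (n+1) × Fin (m+1), inferInstance, inferInstance, pencil K hf' hg' ((h1 X).1 hfX) ((h2 Y).2 hgY)⟩
end Wt
end TorsPaper

namespace TorsPaper
open Module
section idem
variable (K : Type) [Field K] [IsAlgClosed K] {A : Type} [Ring A] [Algebra K A] [FiniteDimensional K A]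

lemma jac_simple {j : A} (hj : j ∈ Ring.jacobson A) (X : Type) [AddCommGroup X] [Module A X]
    [IsSimpleModule A X] (x : X) : j • x = 0 := by
  have h := Module.le_comap_jacobson (LinearMap.toSpanSingleton A X x) hj
  have : Module.jacobson A X = ⊥ := IsSemisimpleModule.jacobson_eq_bot A X
  rw [this] at h
  simpa using h

lemma exists_idem : ∃ (n : ℕ) (e : Fin n → A), (∀ i, e i * e i = e i) ∧
    (∀ i a, ∃ c : K, e i * a * e i - c • e i ∈ Ring.jacobson A) ∧
    (∀ i j, i ≠ j → ∀ a, e i * a * e j ∈ Ring.jacobson A) ∧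
    (∀ (X : Type) [AddCommGroup X] [Module A X] [IsSimpleModule A X], ∃ i, ∃ x : X, e i • x ≠ 0) := by
  haveI : IsArtinianRing A := IsArtinianRing.of_finite K A
  haveI : IsSemisimpleRing (A ⧸ Ring.jacobson A) := 
    IsSemiprimaryRing.isSemisimpleRing
  haveI : FiniteDimensional K (A ⧸ Ring.jacobson A) :=
    Module.Finite.of_surjective (Ideal.Quotient.mkₐ K (Ring.jacobson A)).toLinearMap
      (Ideal.Quotient.mkₐ_surjective K _)
  obtain ⟨n, d, hd, ⟨φ⟩⟩ := IsSemisimpleRing.exists_algEquiv_pi_matrix_of_isAlgClosed K (A ⧸ Ring.jacobson A)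
  let f : A →ₐ[K] Π i, Matrix (Fin (d i)) (Fin (d i)) K :=
    φ.toAlgHom.comp (Ideal.Quotient.mkₐ K (Ring.jacobson A))
  have hfs : Function.Surjective f := φ.surjective.comp (Ideal.Quotient.mkₐ_surjective K _)
  have hfk : ∀ a, f a = 0 ↔ a ∈ Ring.jacobson A := by
    intro a
    change φ (Ideal.Quotient.mk _ a) = 0 ↔ _
    rw [map_eq_zero_iff _ φ.injective, Ideal.Quotient.eq_zero_iff_mem]
  have hnil : ∀ x ∈ RingHom.ker f.toRingHom, IsNilpotent x := by
    intro x hx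
    have hx' : x ∈ Ring.jacobson A := (hfk x).1 hx
    obtain ⟨m, hm⟩ := (IsSemiprimaryRing.isNilpotent : IsNilpotent (Ring.jacobson A))
    exact ⟨m, by
      have := Ideal.pow_mem_pow hx' m
      rw [hm] at this
      exact this⟩
  let E : ∀ i, Fin (d i) → Fin (d i) → Π i, Matrix (Fin (d i)) (Fin (d i)) K :=
    fun i k l => Pi.single i (Matrix.single k l 1)
  have hE : ∀ i, IsIdempotentElem (E i 0 0) := by
    intro i
    change Pi.single i _ * Pi.single i _ = Pi.single i _
    rw [← Pi.single_mul]; simp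
  choose e he1 he2 using fun i => exists_isIdempotentElem_eq_of_ker_isNilpotent f.toRingHom hnil
    (E i 0 0) (by obtain ⟨a, ha⟩ := hfs (E i 0 0); exact ⟨a, ha⟩) (hE i)
  have he2 : ∀ i, f (e i) = E i 0 0 := he2
  refine ⟨n, e, he1, ?_, ?_, ?_⟩
  · intro i a
    refine ⟨f a i 0 0, ?_⟩
    rw [← hfk, map_sub, map_smul, map_mul, map_mul, he2, sub_eq_zero]
    funext i'
    by_cases h : i' = i
    · subst h
      simp [E]
    · simp [E, h]
  · intro i j hij a
    rw [← hfk, map_mul, map_mul, he2, he2]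
    funext i'
    by_cases h : i' = i
    · subst h
      simp [E, hij]
    · simp [E, h]
  · intro X _ _ _
    by_contra! hcon
    choose b hb using fun i k => hfs (E i k 0)
    choose c hc using fun i k => hfs (E i 0 k)
    have h1 : f (1 - ∑ i, ∑ k, b i k * e i * c i k) = 0 := by
      rw [map_sub, map_one, sub_eq_zero]
      simp only [map_sum, map_mul, hb, he2, hc]
      funext i
      simp only [Finset.sum_apply, Pi.mul_apply, Pi.one_apply]
      rw [Finset.sum_eq_single i]
      · simp only [E, Pi.single_eq_same, Matrix.single_mul_single_same, mul_one]
        exact Matrix.sum_single_one.symm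
      · intro j _ hj
        simp [E, Ne.symm hj]
      · simp
    haveI := IsSimpleModule.nontrivial A X
    obtain ⟨x, hx⟩ := exists_ne (0 : X)
    have h2 := jac_simple ((hfk _).1 h1) X x
    rw [sub_smul, one_smul, sub_eq_zero] at h2
    apply hx
    rw [h2]
    simp only [Finset.sum_smul, mul_smul, hcon, smul_zero, Finset.sum_const_zero]

lemma ed_simple_one {e : A} (he : e * e = e)
    (h : ∀ a, ∃ c : K, e * a * e - c • e ∈ Ring.jacobson A) (X : Type) [AddCommGroup X] [Module A X]
    [IsSimpleModule A X] (x : X) (hx : e • x ≠ 0) : ed K e X = 1 := by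
  letI := Module.compHom X (algebraMap K A)
  haveI := kst K (A := A) X
  rw [ed_eq]
  apply finrank_eq_one (⟨e • x, by rw [mem_fixK, smul_smul, he]⟩ : fixK K e X)
  · intro h0; exact hx (congrArg Subtype.val h0)
  · rintro ⟨w, hw⟩
    obtain ⟨a, ha⟩ := IsSimpleModule.toSpanSingleton_surjective A hx w
    obtain ⟨c, hc⟩ := h a
    refine ⟨c, Subtype.ext ?_⟩
    change c • e • x = w
    have h1 := jac_simple hc X x
    rw [sub_smul, sub_eq_zero, smul_assoc, mul_smul, mul_smul] at h1
    rw [← h1]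
    rw [LinearMap.toSpanSingleton_apply] at ha
    rw [ha]; exact hw

lemma ed_simple_zero {e e' : A} (h : ∀ a, e' * a * e ∈ Ring.jacobson A) (X : Type) [AddCommGroup X] [Module A X]
    [IsSimpleModule A X] (x : X) (hx : e • x ≠ 0) : ed K e' X = 0 := by
  letI := Module.compHom X (algebraMap K A)
  haveI := kst K (A := A) X
  rw [ed_eq]
  have : fixK K e' X = ⊥ := by
    rw [eq_bot_iff]
    intro w hw
    obtain ⟨a, ha⟩ := IsSimpleModule.toSpanSingleton_surjective A hx w
    have h1 := jac_simple (h a) X x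
    rw [mul_smul, mul_smul] at h1
    rw [LinearMap.toSpanSingleton_apply] at ha
    rw [ha] at h1
    rw [mem_fixK] at hw
    rw [Submodule.mem_bot, ← hw, h1]
  rw [this, finrank_bot]

lemma ker_simple {e : A} (he : e * e = e) (h : ∀ a, ∃ c : K, e * a * e - c • e ∈ Ring.jacobson A)
    (X : Type) [AddCommGroup X] [Module A X] [IsSimpleModule A X] (x : X) (hx : e • x ≠ 0)
    (Y : Type) [AddCommGroup Y] [Module A Y] [IsSimpleModule A Y] (y : Y) (hy : e • y ≠ 0) :
    LinearMap.ker (LinearMap.toSpanSingleton A X (e • x)) ≤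
      LinearMap.ker (LinearMap.toSpanSingleton A Y (e • y)) := by
  letI := Module.compHom X (algebraMap K A)
  haveI := kst K (A := A) X
  letI := Module.compHom Y (algebraMap K A)
  haveI := kst K (A := A) Y
  intro a ha
  rw [LinearMap.mem_ker, LinearMap.toSpanSingleton_apply] at ha ⊢
  by_contra hne
  obtain ⟨b, hb⟩ := IsSimpleModule.toSpanSingleton_surjective A hne (e • y)
  rw [LinearMap.toSpanSingleton_apply] at hb
  obtain ⟨c, hc⟩ := h (b * a)
  have h1 := jac_simple hc X x
  have h2 := jac_simple hc Y y
  rw [sub_smul, sub_eq_zero, smul_assoc, mul_smul, mul_smul, mul_smul] at h1 h2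
  rw [ha, smul_zero, smul_zero] at h1
  have hc0 : c = 0 := by
    by_contra hc0
    exact (smul_ne_zero hc0 hx) h1.symm
  rw [hb, hc0, zero_smul] at h2
  rw [smul_smul, he] at h2
  exact hy h2

lemma iso_simple {e : A} (he : e * e = e) (h : ∀ a, ∃ c : K, e * a * e - c • e ∈ Ring.jacobson A)
    (X : Type) [AddCommGroup X] [Module A X] [IsSimpleModule A X] (x : X) (hx : e • x ≠ 0)
    (Y : Type) [AddCommGroup Y] [Module A Y] [IsSimpleModule A Y] (y : Y) (hy : e • y ≠ 0) :
    Nonempty (X ≃ₗ[A] Y) := by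
  have hk := le_antisymm (ker_simple K he h X x hx Y y hy) (ker_simple K he h Y y hy X x hx)
  exact ⟨(LinearMap.quotKerEquivOfSurjective _ (IsSimpleModule.toSpanSingleton_surjective A hx)).symm.trans
    ((Submodule.quotEquivOfEq _ _ hk).trans
    (LinearMap.quotKerEquivOfSurjective _ (IsSimpleModule.toSpanSingleton_surjective A hy)))⟩

lemma represent {θ : ModuleCat.{0} A → ℝ} (hθ : IsStability A θ)
    (hint : ∀ M : ModuleCat.{0} A, Module.Finite A M → ∃ k : ℤ, θ M = (k : ℝ)) :
    ∃ D : Wt A, ∀ (X : Type) [AddCommGroup X] [Module A X] [Module.Finite A X],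
      θ (ModuleCat.of A X) = (D.w K X : ℝ) := by
  classical
  haveI : IsArtinianRing A := IsArtinianRing.of_finite K A
  haveI : IsNoetherianRing A := IsNoetherianRing.of_finite K A
  obtain ⟨n, e, he, h1, h2, h3⟩ := exists_idem K (A := A)
  have hc : ∀ i, ∃ a : ℤ, ∀ (X : Type) [AddCommGroup X] [Module A X] [IsSimpleModule A X] (x : X),
      e i • x ≠ 0 → θ (ModuleCat.of A X) = a := by
    intro i
    by_cases hex : ∃ (X : ModuleCat.{0} A) (_ : IsSimpleModule A X) (x : X), e i • x ≠ 0
    · obtain ⟨X, hX, x, hx⟩ := hex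
      haveI : Module.Finite A X := inferInstance
      obtain ⟨k, hk⟩ := hint X inferInstance
      refine ⟨k, fun Y _ _ _ y hy => ?_⟩
      obtain ⟨φ⟩ := iso_simple K (he i) (h1 i) Y y hy X x hx
      rw [← hk]
      exact th_iso hθ φ
    · refine ⟨0, fun Y _ _ _ y hy => ?_⟩
      exact absurd ⟨ModuleCat.of A Y, ‹_›, y, hy⟩ hex
  choose a ha using hc
  let D : Wt A :=
    { Q := Σ i : Fin n, Fin (a i).toNat
      P := Σ i : Fin n, Fin (-a i).toNat
      s := fun q => e q.1
      t := fun q => e q.1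
      hs := fun q => he q.1
      ht := fun q => he q.1 }
  have hw : ∀ (X : Type) [AddCommGroup X] [Module A X], D.w K X = ∑ i, a i * ed K (e i) X := by
    intro X _ _
    change ∑ q : (Σ i : Fin n, Fin (a i).toNat), (ed K (e q.1) X : ℤ) -
      ∑ q : (Σ i : Fin n, Fin (-a i).toNat), (ed K (e q.1) X : ℤ) = _
    rw [Fintype.sum_sigma, Fintype.sum_sigma, ← Finset.sum_sub_distrib]
    refine Finset.sum_congr rfl fun i _ => ?_
    simp only [Finset.sum_const, Finset.card_univ, Fintype.card_fin, nsmul_eq_mul]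
    rw [← sub_mul, Int.toNat_sub_toNat_neg]
  refine ⟨D, ?_⟩
  have main : ∀ (m : ℕ) (X : Type) [AddCommGroup X] [Module A X] [Module.Finite A X], dm K (A := A) X = m →
      θ (ModuleCat.of A X) = (D.w K X : ℝ) := by
    intro m
    induction m using Nat.strong_induction_on with
    | _ m ih =>
    intro X _ _ _ hm
    rcases subsingleton_or_nontrivial X with hs | hn
    · rw [th_zero hθ]
      have h0 := D.w_sub K (⊥ : Submodule A X)
      have h5 : D.w K (⊥ : Submodule A X) = D.w K X := D.w_iso K
        { toFun := fun x => x.1, invFun := fun x => 0, map_add' := fun _ _ => rfl,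
          map_smul' := fun _ _ => rfl, left_inv := fun _ => Subsingleton.elim _ _,
          right_inv := fun _ => Subsingleton.elim _ _ }
      have h6 : D.w K (X ⧸ (⊥ : Submodule A X)) = D.w K X := D.w_iso K
        (Submodule.quotEquivOfEqBot _ rfl)
      have : D.w K X = 0 := by omega
      rw [this]; simp
    · obtain ⟨N, hN, -⟩ := (eq_bot_or_exists_atom_le (⊤ : Submodule A X)).resolve_left top_ne_bot
        
      haveI : IsSimpleModule A N := isSimpleModule_iff_isAtom.2 hN
      rw [th_sub hθ N, D.w_sub K N]
      have hq := ih _ (by rw [← hm]; exact dm_quot_lt K N hN.1) (X ⧸ N) rfl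
      rw [hq]
      push_cast
      congr 1
      obtain ⟨i, x, hx⟩ := h3 N
      rw [ha i N x hx, hw, Finset.sum_eq_single i]
      · rw [ed_simple_one K (he i) (h1 i) N x hx]; simp
      · intro j _ hj
        rw [ed_simple_zero K (h2 j i hj) N x hx]; simp
      · simp
  intro X _ _ _
  exact main _ X rfl
end idem
end TorsPaper

namespace TorsPaper
open Module
section fr
variable {A : Type} [Ring A]

/-- the torsion-free property relative to `T`. -/
def Fr (T : ModuleCat.{0} A → Prop) (X : Type) [AddCommGroup X] [Module A X] : Prop :=
  ∀ (Z : Type) [AddCommGroup Z] [Module A Z], T (ModuleCat.of A Z) → ∀ g : Z →ₗ[A] X, g = 0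

lemma Fr_inj {T : ModuleCat.{0} A → Prop} {X Y : Type} [AddCommGroup X] [Module A X] [AddCommGroup Y]
    [Module A Y] (h : Fr T Y) (i : X →ₗ[A] Y) (hi : Function.Injective i) : Fr T X := by
  intro Z _ _ hZ g
  apply LinearMap.ext
  intro z
  apply hi
  have := LinearMap.congr_fun (h Z hZ (i.comp g)) z
  simpa using this

lemma Fr_T {T : ModuleCat.{0} A → Prop} {X : Type} [AddCommGroup X] [Module A X] (h : Fr T X)
    (hX : T (ModuleCat.of A X)) : Subsingleton X := by
  have := h X hX LinearMap.id
  refine ⟨fun a b => ?_⟩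
  have h1 := LinearMap.congr_fun this a
  have h2 := LinearMap.congr_fun this b
  simp at h1 h2
  rw [h1, h2]

variable [IsNoetherianRing A] {T : ModuleCat.{0} A → Prop} (hT : IsTorsionClass A T)
include hT

lemma T_gen {X : Type} [AddCommGroup X] [Module A X] [Module.Finite A X]
    (h : ∀ N : Submodule A X, (∀ (Z : Type) [AddCommGroup Z] [Module A Z], T (ModuleCat.of A Z) →
      ∀ g : Z →ₗ[A] X, LinearMap.range g ≤ N) → N = ⊤) : T (ModuleCat.of A X) := by
  obtain ⟨N, h1, h2, -⟩ := exists_tors hT (X := X)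
  have := h N h2
  subst this
  exact T_surj hT h1 (Submodule.subtype ⊤) (fun x => ⟨⟨x, trivial⟩, rfl⟩)

lemma T_pi {C : Type} [AddCommGroup C] [Module A C] (hC : T (ModuleCat.of A C)) (ι : Type) [Finite ι] :
    T (ModuleCat.of A (ι → C)) := by
  classical
  haveI := Fintype.ofFinite ι
  haveI : Module.Finite A C := hT.fin _ hC
  apply T_gen hT
  intro N hN
  rw [eq_top_iff]
  intro x _
  rw [← Finset.univ_sum_single x]
  refine N.sum_mem fun i _ => hN C hC (LinearMap.single A (fun _ => C) i) ⟨x i, rfl⟩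

lemma T_of_quot {X : Type} [AddCommGroup X] [Module A X] [Module.Finite A X]
    (h : ∀ N : Submodule A X, Fr T (X ⧸ N) → N = ⊤) : T (ModuleCat.of A X) := by
  obtain ⟨N, h1, h2, h3⟩ := exists_tors hT (X := X)
  have := h N h3
  subst this
  exact T_surj hT h1 (Submodule.subtype ⊤) (fun x => ⟨⟨x, trivial⟩, rfl⟩)
end fr

namespace Wt
variable {A : Type} [Ring A] {D : Wt A} {f : D.P → D.Q → A}

lemma TF_torsion (hf : D.IsMat f) :
    IsTorsionClass A (fun X => Module.Finite A X ∧ D.TF f X) where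
  fin X h := h.1
  zero X h := by
    haveI : Subsingleton X := ⟨fun a b => (h a).trans (h b).symm⟩
    exact ⟨inferInstance, fun v => ⟨0, fun p => Subsingleton.elim _ _⟩⟩
  quot X Y hX hY h := by
    obtain ⟨g, hg⟩ := h
    refine ⟨hY, fun v => ?_⟩
    choose v' hv' using fun p => hg (v p)
    obtain ⟨u, hu⟩ := hX.2 v'
    refine ⟨fun q => g (u q), fun p => ?_⟩
    rw [← hv', ← map_smul, hu, map_sum]
    simp only [map_smul]
  ext X hX N h1 h2 := by
    refine ⟨hX, fun v => ?_⟩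
    obtain ⟨u, hu⟩ := h2.2 (fun p => N.mkQ (v p))
    choose u0 hu0 using fun q => N.mkQ_surjective (u q)
    have hmem : ∀ p, D.t p • v p - ∑ q, f p q • u0 q ∈ N := by
      intro p
      rw [← Submodule.ker_mkQ N, LinearMap.mem_ker, map_sub, map_smul, map_sum]
      simp only [map_smul, hu0]
      exact sub_eq_zero.2 (hu p)
    obtain ⟨u1, hu1⟩ := h1.2 (fun p => ⟨_, hmem p⟩)
    refine ⟨fun q => u0 q + (u1 q).1, fun p => ?_⟩
    have h3 := congrArg Subtype.val (hu1 p)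
    have h4 : D.t p • (D.t p • v p - ∑ q, f p q • u0 q) = ∑ q, f p q • (u1 q).1 := by
      refine Eq.trans h3 ?_
      change N.subtype _ = _
      rw [map_sum]; rfl
    rw [smul_sub, smul_smul, D.ht, hf.smul_sum, sub_eq_iff_eq_add] at h4
    rw [h4, add_comm, ← Finset.sum_add_distrib]
    simp only [smul_add]

lemma IF_inj {X Y : Type} [AddCommGroup X] [Module A X] [AddCommGroup Y] [Module A Y]
    (h : D.IF f Y) (i : X →ₗ[A] Y) (hi : Function.Injective i) : D.IF f X := by
  intro u hu q
  apply hi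
  rw [map_smul, map_zero]
  refine h (fun q => i (u q)) (fun p => ?_) q
  rw [← map_zero i, ← hu p, map_sum]
  simp only [map_smul]

lemma IF_ext (hf : D.IsMat f) {X Y : Type} [AddCommGroup X] [Module A X] [AddCommGroup Y] [Module A Y]
    (g : X →ₗ[A] Y) (h : D.IF f Y) (hk : D.IF f (LinearMap.ker g)) : D.IF f X := by
  intro u hu q
  have h1 : ∀ q, g (D.s q • u q) = 0 := by
    intro q
    rw [map_smul]
    refine h (fun q => g (u q)) (fun p => ?_) q
    rw [← map_zero g, ← hu p, map_sum]
    simp only [map_smul]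
  have h2 := hk (fun q => ⟨D.s q • u q, h1 q⟩) (fun p => by
    apply Subtype.ext
    change (LinearMap.ker g).subtype _ = 0
    rw [map_sum]
    change ∑ q, f p q • D.s q • u q = 0
    rw [hf.sum_s, hu]) q
  have h3 : D.s q • D.s q • u q = 0 := congrArg Subtype.val h2
  rwa [smul_smul, D.hs] at h3
end Wt

section final
variable {A : Type} [Ring A] {D : Wt A} {f : D.P → D.Q → A}

/-- Step 9: the cokernel module generates `T`. -/
lemma exists_gen (K : Type) [Field K] [Algebra K A] [FiniteDimensional K A]
    {T : ModuleCat.{0} A → Prop} (hT : IsTorsionClass A T) (hf : D.IsMat f)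
    (h1 : ∀ (X : Type) [AddCommGroup X] [Module A X], T (ModuleCat.of A X) → D.TF f X)
    (h2 : ∀ (X : Type) [AddCommGroup X] [Module A X] [Module.Finite A X], Fr T X → D.IF f X)
    (h3 : ∀ (X : Type) [AddCommGroup X] [Module A X] [Nontrivial X], T (ModuleCat.of A X) → 0 < D.w K X) :
    ∃ (C : ModuleCat.{0} A), T C ∧ ∀ (X : Type) [AddCommGroup X] [Module A X], T (ModuleCat.of A X) →
      Submodule.span A {x : X | ∃ (h : C →ₗ[A] X) (c : C), h c = x} = ⊤ := by
  classical
  haveI : IsNoetherianRing A := IsNoetherianRing.of_finite K A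
  let R : Submodule A (D.Q → A) := Submodule.span A
    (Set.range f ∪ Set.range (fun q => Pi.single q (1 - D.s q)))
  let ε : D.Q → (D.Q → A) ⧸ R := fun q => R.mkQ (Pi.single q 1)
  have hx : ∀ x : D.Q → A, R.mkQ x = ∑ q, x q • ε q := by
    intro x
    conv_lhs => rw [← Finset.univ_sum_single x]
    rw [map_sum]
    refine Finset.sum_congr rfl fun q _ => ?_
    rw [← map_smul, ← Pi.single_smul, smul_eq_mul, mul_one]
  have hfe : ∀ p, ∑ q, f p q • ε q = 0 := by
    intro p
    rw [← hx, ← LinearMap.mem_ker, Submodule.ker_mkQ]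
    exact Submodule.subset_span (Or.inl ⟨p, rfl⟩)
  have hse : ∀ q, D.s q • ε q = ε q := by
    intro q
    have : (1 - D.s q) • ε q = 0 := by
      rw [← map_smul, ← Pi.single_smul, smul_eq_mul, mul_one, ← LinearMap.mem_ker, Submodule.ker_mkQ]
      exact Submodule.subset_span (Or.inr ⟨q, rfl⟩)
    rw [sub_smul, one_smul, sub_eq_zero] at this
    exact this.symm
  have huniv : ∀ (X : Type) [AddCommGroup X] [Module A X] (u : D.Q → X),
      (∀ p, ∑ q, f p q • u q = 0) → (∀ q, D.s q • u q = u q) →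
      ∃ h : ((D.Q → A) ⧸ R) →ₗ[A] X, ∀ q, h (ε q) = u q := by
    intro X _ _ u hu1 hu2
    let h0 : (D.Q → A) →ₗ[A] X := Fintype.linearCombination A u
    have h0a : ∀ x, h0 x = ∑ q, x q • u q := fun x => rfl
    refine ⟨R.liftQ h0 ?_, fun q => ?_⟩
    · refine Submodule.span_le.2 ?_
      rintro _ (⟨p, rfl⟩ | ⟨q, rfl⟩)
      · change h0 _ = 0
        rw [h0a, hu1]
      · change h0 _ = 0
        rw [h0a, Finset.sum_eq_single q]
        · simp [sub_smul, hu2]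
        · intro b _ hb; simp [hb]
        · simp
    · change R.liftQ h0 _ (R.mkQ _) = _
      rw [Submodule.mkQ_apply, Submodule.liftQ_apply, h0a, Finset.sum_eq_single q]
      · simp
      · intro b _ hb; simp [hb]
      · simp
  have hC : T (ModuleCat.of A ((D.Q → A) ⧸ R)) := by
    apply T_of_quot hT
    intro N hN
    have hI := h2 _ hN
    have h0 := hI (fun q => N.mkQ (ε q)) (fun p => by
      have := congrArg N.mkQ (hfe p)
      rw [map_sum, map_zero] at this
      simpa only [map_smul] using this)
    rw [eq_top_iff]
    intro c _
    obtain ⟨x, rfl⟩ := R.mkQ_surjective c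
    rw [hx]
    refine N.sum_mem fun q _ => N.smul_mem _ ?_
    have := h0 q
    rw [← map_smul, hse, ← LinearMap.mem_ker, Submodule.ker_mkQ] at this
    exact this
  refine ⟨ModuleCat.of A ((D.Q → A) ⧸ R), hC, ?_⟩
  intro X _ _ hX
  haveI : Module.Finite A X := hT.fin _ hX
  set X0 : Submodule A X := Submodule.span A
    {x : X | ∃ (h : (ModuleCat.of A ((D.Q → A) ⧸ R)) →ₗ[A] X) (c : ModuleCat.of A ((D.Q → A) ⧸ R)), h c = x} with hX0
  have hr : ∀ (h : ((D.Q → A) ⧸ R) →ₗ[A] X) c, h c ∈ X0 := fun h c => Submodule.subset_span ⟨h, c, rfl⟩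
  have hTX0 : T (ModuleCat.of A X0) := by
    apply T_gen hT
    intro N hN
    have : X0 ≤ N.map X0.subtype := by
      refine Submodule.span_le.2 ?_
      rintro _ ⟨h, c, rfl⟩
      exact ⟨_, hN _ hC (LinearMap.codRestrict X0 h (hr h)) ⟨c, rfl⟩, rfl⟩
    rw [eq_top_iff]
    rintro ⟨x, hx⟩ _
    obtain ⟨y, hy, hyx⟩ := this hx
    have : y = ⟨x, hx⟩ := Subtype.ext hyx
    rwa [← this]
  have hIF : D.IF f (X ⧸ X0) := by
    intro u hu q
    choose u0 hu0 using fun q => X0.mkQ_surjective (u q)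
    have hmem : ∀ p, ∑ q, f p q • u0 q ∈ X0 := by
      intro p
      rw [← Submodule.ker_mkQ X0, LinearMap.mem_ker, map_sum]
      simp only [map_smul, hu0]
      exact hu p
    obtain ⟨u1, hu1⟩ := h1 X0 hTX0 (fun p => ⟨_, hmem p⟩)
    have hu1' : ∀ p, ∑ q, f p q • u0 q = ∑ q, f p q • (u1 q).1 := by
      intro p
      have h3 := congrArg X0.subtype (hu1 p)
      rw [map_sum] at h3
      have h4 : D.t p • ∑ q, f p q • u0 q = ∑ q, f p q • (u1 q).1 := h3
      rwa [hf.smul_sum] at h4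
    obtain ⟨h, hh⟩ := huniv X (fun q => D.s q • (u0 q - (u1 q).1)) (fun p => by
      rw [hf.sum_s]
      simp only [smul_sub, Finset.sum_sub_distrib]
      rw [hu1', sub_self]) (fun q => by rw [smul_smul, D.hs])
    have h5 : D.s q • (u0 q - (u1 q).1) ∈ X0 := by rw [← hh q]; exact hr h _
    rw [smul_sub] at h5
    have h6 : D.s q • u0 q ∈ X0 := by
      have := X0.add_mem h5 (X0.smul_mem (D.s q) (u1 q).2)
      simpa using this
    rw [← hu0, ← map_smul, ← LinearMap.mem_ker, Submodule.ker_mkQ]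
    exact h6
  by_contra hne
  haveI : Nontrivial (X ⧸ X0) := Submodule.Quotient.nontrivial_iff.2 hne
  have h7 := h3 (X ⧸ X0) (T_surj hT hX X0.mkQ X0.mkQ_surjective)
  have h8 := Wt.IF_w K hf hIF
  omega

lemma ff_of_gen (K : Type) [Field K] [Algebra K A] [FiniteDimensional K A]
    {T : ModuleCat.{0} A → Prop} (hT : IsTorsionClass A T) (C : ModuleCat.{0} A) (hC : T C)
    (hg : ∀ (X : Type) [AddCommGroup X] [Module A X], T (ModuleCat.of A X) →
      Submodule.span A {x : X | ∃ (h : C →ₗ[A] X) (c : C), h c = x} = ⊤) : FunctoriallyFinite A T := by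
  classical
  haveI : IsNoetherianRing A := IsNoetherianRing.of_finite K A
  letI := Module.compHom C (algebraMap K A)
  haveI := kst K (A := A) C
  haveI : Module.Finite A C := hT.fin _ hC
  haveI : FiniteDimensional K C := Module.Finite.trans A C
  let b := Module.finBasis K C
  have hsum : ∀ (Y : Type) [AddCommGroup Y] [Module A Y], T (ModuleCat.of A Y) → ∀ y : Y,
      ∃ H : Fin (finrank K C) → (C →ₗ[A] Y), y = ∑ j, H j (b j) := by
    intro Y _ _ hY y
    have hy : y ∈ Submodule.span A {x : Y | ∃ (h : C →ₗ[A] Y) (c : C), h c = x} := by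
      rw [hg Y hY]; trivial
    suffices h : ∀ a : A, ∃ H : Fin (finrank K C) → (C →ₗ[A] Y), a • y = ∑ j, H j (b j) by
      obtain ⟨H, hH⟩ := h 1
      exact ⟨H, by rw [← hH, one_smul]⟩
    induction hy using Submodule.span_induction with
    | mem x hx =>
      obtain ⟨h, c, rfl⟩ := hx
      intro a
      refine ⟨fun j => h.comp (b.repr (a • c) j • LinearMap.id), ?_⟩
      simp only [LinearMap.comp_apply, LinearMap.smul_apply, LinearMap.id_apply]
      rw [← map_sum, b.sum_repr, map_smul]
    | zero => intro a; exact ⟨0, by simp⟩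
    | add x y _ _ hx hy =>
      intro a
      obtain ⟨H1, h1⟩ := hx a
      obtain ⟨H2, h2⟩ := hy a
      exact ⟨H1 + H2, by simp [smul_add, h1, h2, Finset.sum_add_distrib]⟩
    | smul a' x _ hx =>
      intro a
      rw [smul_smul]; exact hx _
  constructor
  · intro G hG
    obtain ⟨n, π, hπ⟩ := Module.Finite.exists_fin' A G
    let β : (Fin n → A) →ₗ[A] (Fin n × Fin (finrank K C) → C) :=
      LinearMap.pi fun ij => (LinearMap.toSpanSingleton A C (b ij.2)).comp (LinearMap.proj ij.1)
    have hβ : ∀ x ij, β x ij = x ij.1 • b ij.2 := fun x ij => rfl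
    let B : Submodule A (Fin n × Fin (finrank K C) → C) := (LinearMap.ker π).map β
    have hle : LinearMap.ker π ≤ LinearMap.ker (B.mkQ.comp β) := by
      intro x hx
      rw [LinearMap.mem_ker, LinearMap.comp_apply, ← LinearMap.mem_ker, Submodule.ker_mkQ]
      exact ⟨x, hx, rfl⟩
    let φ : G →ₗ[A] (Fin n × Fin (finrank K C) → C) ⧸ B :=
      ((LinearMap.ker π).liftQ (B.mkQ.comp β) hle).comp (LinearMap.quotKerEquivOfSurjective π hπ).symm.toLinearMap
    have hφ : ∀ x, φ (π x) = B.mkQ (β x) := by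
      intro x
      have h0 : (LinearMap.quotKerEquivOfSurjective π hπ).symm (π x) = (LinearMap.ker π).mkQ x := by
        rw [LinearEquiv.symm_apply_eq]; rfl
      change (LinearMap.ker π).liftQ (B.mkQ.comp β) hle ((LinearMap.quotKerEquivOfSurjective π hπ).symm (π x)) = _
      rw [h0]; rfl
    refine ⟨ModuleCat.of A ((Fin n × Fin (finrank K C) → C) ⧸ B), φ, ?_, ?_⟩
    · exact T_surj hT (T_pi hT (C := C) hC _) B.mkQ B.mkQ_surjective
    · intro Y hY g
      choose H hH using fun i : Fin n => hsum Y hY (g (π (Pi.single i 1)))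
      let HH : (Fin n × Fin (finrank K C) → C) →ₗ[A] Y :=
        ∑ ij : Fin n × Fin (finrank K C), (H ij.1 ij.2).comp (LinearMap.proj ij)
      have hHH : ∀ x, HH (β x) = g (π x) := by
        intro x
        have e1 : HH (β x) = ∑ ij : Fin n × Fin (finrank K C), x ij.1 • H ij.1 ij.2 (b ij.2) := by
          simp only [HH, LinearMap.sum_apply, LinearMap.comp_apply, LinearMap.proj_apply, hβ, map_smul]
        rw [e1, Fintype.sum_prod_type]
        simp only [← Finset.smul_sum, ← hH]
        conv_rhs => rw [← Finset.univ_sum_single x]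
        rw [map_sum, map_sum]
        refine Finset.sum_congr rfl fun i _ => ?_
        rw [← map_smul, ← map_smul, ← Pi.single_smul, smul_eq_mul, mul_one]
      refine ⟨B.liftQ HH ?_, ?_⟩
      · rintro _ ⟨x, hx, rfl⟩
        rw [LinearMap.mem_ker, hHH, LinearMap.mem_ker.1 hx, map_zero]
      · apply LinearMap.ext
        intro m
        obtain ⟨x, rfl⟩ := hπ m
        rw [LinearMap.comp_apply, hφ]
        exact hHH x
  · intro G hG
    obtain ⟨N, h1, h2, -⟩ := exists_tors hT (X := G)
    refine ⟨ModuleCat.of A N, N.subtype, h1, ?_⟩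
    intro Y hY g
    refine ⟨LinearMap.codRestrict N g (fun y => h2 Y hY g ⟨y, rfl⟩), ?_⟩
    apply LinearMap.ext; intro y; rfl
end final
end TorsPaper

namespace TorsPaper
open Module
section dual
variable (K : Type) [Field K] (A : Type) [Ring A] [Algebra K A]

/-- The dual of the right module `A^P`, a left `A`-module. -/
def Du (P : Type) : Type := P → (A →ₗ[K] K)

noncomputable instance (P : Type) : AddCommGroup (Du K A P) :=
  inferInstanceAs (AddCommGroup (P → (A →ₗ[K] K)))
noncomputable instance (P : Type) : Module K (Du K A P) :=
  inferInstanceAs (Module K (P → (A →ₗ[K] K)))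

noncomputable instance (P : Type) : SMul A (Du K A P) :=
  ⟨fun b ψ p => (ψ p).comp (LinearMap.mulRight K b)⟩

lemma du_smul {P : Type} (b : A) (ψ : Du K A P) (p : P) (a : A) : (b • ψ) p a = ψ p (a * b) := rfl
lemma du_add {P : Type} (ψ ψ' : Du K A P) (p : P) (a : A) : (ψ + ψ') p a = ψ p a + ψ' p a := rfl
lemma du_zero {P : Type} (p : P) (a : A) : (0 : Du K A P) p a = 0 := rfl
lemma du_ksmul {P : Type} (c : K) (ψ : Du K A P) (p : P) (a : A) : (c • ψ) p a = c * ψ p a := rfl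
lemma du_ext {P : Type} {ψ ψ' : Du K A P} (h : ∀ p a, ψ p a = ψ' p a) : ψ = ψ' :=
  funext fun p => LinearMap.ext fun a => h p a

noncomputable instance (P : Type) : Module A (Du K A P) where
  one_smul ψ := du_ext K A fun p a => by rw [du_smul, mul_one]
  mul_smul b c ψ := du_ext K A fun p a => by rw [du_smul, du_smul, du_smul, mul_assoc]
  smul_zero b := du_ext K A fun p a => rfl
  smul_add b ψ ψ' := du_ext K A fun p a => rfl
  add_smul b c ψ := du_ext K A fun p a => by
    rw [du_smul, du_add, du_smul, du_smul, mul_add, map_add]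
  zero_smul ψ := du_ext K A fun p a => by rw [du_smul, mul_zero, map_zero, du_zero]

instance (P : Type) : IsScalarTower K A (Du K A P) :=
  ⟨fun c b ψ => du_ext K A fun p a => by
    rw [du_smul, du_ksmul, du_smul, Algebra.mul_smul_comm, map_smul, smul_eq_mul]⟩

instance (P : Type) [Finite P] [FiniteDimensional K A] : FiniteDimensional K (Du K A P) :=
  inferInstanceAs (FiniteDimensional K (P → (A →ₗ[K] K)))

instance (P : Type) [Finite P] [FiniteDimensional K A] : Module.Finite A (Du K A P) :=
  Module.Finite.of_restrictScalars_finite K A _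

variable {A}
/-- the cogenerator of the torsion-free class -/
noncomputable def NN (D : Wt A) (f : D.P → D.Q → A) : Submodule A (Du K A D.P) where
  carrier := {ψ | (∀ q a, ∑ p, ψ p (f p q * a) = 0) ∧ ∀ p a, ψ p (D.t p * a) = ψ p a}
  add_mem' := by
    rintro ψ ψ' ⟨h1, h2⟩ ⟨h3, h4⟩
    refine ⟨fun q a => ?_, fun p a => ?_⟩
    · simp only [du_add, Finset.sum_add_distrib, h1, h3, add_zero]
    · rw [du_add, du_add, h2, h4]
  zero_mem' := ⟨fun q a => by simp [du_zero], fun p a => rfl⟩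
  smul_mem' := by
    rintro b ψ ⟨h1, h2⟩
    refine ⟨fun q a => ?_, fun p a => ?_⟩
    · simp only [du_smul, mul_assoc, h1]
    · rw [du_smul, du_smul, mul_assoc, h2]

lemma NN_TF {D : Wt A} {f : D.P → D.Q → A} {Z : Type} [AddCommGroup Z] [Module A Z]
    (h : D.TF f Z) (g : Z →ₗ[A] NN K D f) : g = 0 := by
  classical
  have h1 : ∀ z p, (g z).1 p 1 = 0 := by
    intro z p
    obtain ⟨u, hu⟩ := h (Pi.single p z)
    have e1 : (g z).1 p 1 = ∑ p', (g (D.t p' • (Pi.single p z : D.P → Z) p')).1 p' 1 := by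
      rw [Finset.sum_eq_single p]
      · rw [Pi.single_eq_same, map_smul]
        change _ = (D.t p • (g z).1) p 1
        rw [du_smul, one_mul, ← mul_one (D.t p), (g z).2.2 p 1]
      · intro p' _ hp
        rw [Pi.single_eq_of_ne hp, smul_zero, map_zero]; rfl
      · simp
    have e2 : ∀ p', (g (D.t p' • (Pi.single p z : D.P → Z) p')).1 p' 1 = ∑ q, (g (u q)).1 p' (f p' q * 1) := by
      intro p'
      rw [hu, map_sum]
      let ev : NN K D f →+ K :=
        { toFun := fun ψ => ψ.1 p' 1, map_zero' := rfl, map_add' := fun _ _ => rfl }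
      change ev _ = _
      rw [map_sum]
      refine Finset.sum_congr rfl fun q _ => ?_
      rw [map_smul]
      change (f p' q • (g (u q)).1) p' 1 = _
      rw [du_smul, one_mul, mul_one]
    rw [e1]
    simp only [e2]
    rw [Finset.sum_comm]
    exact Finset.sum_eq_zero fun q _ => (g (u q)).2.1 q 1
  apply LinearMap.ext; intro z
  apply Subtype.ext
  apply du_ext; intro p a
  have := h1 (a • z) p
  rw [map_smul] at this
  change (a • (g z).1) p 1 = 0 at this
  rw [du_smul, one_mul] at this
  exact this

lemma exists_to_NN {D : Wt A} {f : D.P → D.Q → A} (hf : D.IsMat f) {L : Type} [AddCommGroup L] [Module A L]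
    (h : ¬ D.TF f L) : ∃ g : L →ₗ[A] NN K D f, g ≠ 0 := by
  classical
  letI := Module.compHom L (algebraMap K A)
  haveI := kst K (A := A) L
  let H1 : (D.Q → L) →ₗ[K] (D.P → L) :=
    { toFun := fun u p => ∑ q, f p q • u q
      map_add' := by intro u v; funext p; simp [Finset.sum_add_distrib]
      map_smul' := by
        intro c u; funext p
        simp only [Pi.smul_apply, RingHom.id_apply, Finset.smul_sum, smul_comm _ c] }
  let H2 : (D.P → L) →ₗ[K] (D.P → L) :=
    { toFun := fun v p => v p - D.t p • v p
      map_add' := by intro u v; funext p; simp only [Pi.add_apply, smul_add]; abel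
      map_smul' := by
        intro c u; funext p
        simp only [Pi.smul_apply, RingHom.id_apply, smul_sub, smul_comm _ c] }
  have hlt : LinearMap.range H1 ⊔ LinearMap.range H2 < ⊤ := by
    rw [lt_top_iff_ne_top]
    intro htop
    apply h
    intro v
    have hv : v ∈ LinearMap.range H1 ⊔ LinearMap.range H2 := by rw [htop]; trivial
    obtain ⟨_, ⟨u, rfl⟩, _, ⟨v', rfl⟩, rfl⟩ := Submodule.mem_sup.1 hv
    refine ⟨u, fun p => ?_⟩
    change D.t p • (∑ q, f p q • u q + (v' p - D.t p • v' p)) = _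
    rw [smul_add, hf.smul_sum, smul_sub, smul_smul, D.ht, sub_self, add_zero]
  obtain ⟨φ, hφ0, hφ⟩ := Submodule.exists_le_ker_of_lt_top _ hlt
  have k1 : ∀ u, φ (H1 u) = 0 := fun u => hφ (Submodule.mem_sup_left ⟨u, rfl⟩)
  have k2 : ∀ u, φ (H2 u) = 0 := fun u => hφ (Submodule.mem_sup_right ⟨u, rfl⟩)
  let ψ : L → Du K A D.P := fun x p =>
    { toFun := fun a => φ (Pi.single p (a • x))
      map_add' := by intro a b; rw [add_smul, Pi.single_add, map_add]
      map_smul' := by intro c a; rw [smul_assoc, Pi.single_smul, map_smul]; rfl }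
  have hψ : ∀ x p a, ψ x p a = φ (Pi.single p (a • x)) := fun _ _ _ => rfl
  have hmem : ∀ x, ψ x ∈ NN K D f := by
    intro x
    refine ⟨fun q a => ?_, fun p a => ?_⟩
    · simp only [hψ]
      rw [← map_sum, ← k1 (Pi.single q (a • x))]
      congr 1
      funext p
      rw [Finset.sum_apply, Finset.sum_eq_single p]
      · change _ = ∑ q', f p q' • (Pi.single q (a • x) : D.Q → L) q'
        rw [Finset.sum_eq_single q]
        · simp [mul_smul]
        · intro b _ hb; simp [hb]
        · simp
      · intro b _ hb; simp [Ne.symm hb]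
      · simp
    · rw [hψ, hψ, eq_comm, ← sub_eq_zero, ← map_sub, ← k2 (Pi.single p (a • x))]
      congr 1
      funext p'
      change _ = (Pi.single p (a • x) : D.P → L) p' - D.t p' • (Pi.single p (a • x) : D.P → L) p'
      by_cases hp : p' = p
      · subst hp; simp [mul_smul]
      · simp [hp]
  let g : L →ₗ[A] NN K D f :=
    { toFun := fun x => ⟨ψ x, hmem x⟩
      map_add' := by
        intro x y; apply Subtype.ext; apply du_ext; intro p a
        change ψ (x + y) p a = (ψ x + ψ y) p a
        rw [du_add, hψ, hψ, hψ, smul_add, Pi.single_add, map_add]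
      map_smul' := by
        intro b x; apply Subtype.ext; apply du_ext; intro p a
        change ψ (b • x) p a = (b • ψ x) p a
        rw [du_smul, hψ, hψ, mul_smul] }
  refine ⟨g, fun hg => hφ0 ?_⟩
  apply LinearMap.ext; intro v
  rw [← Finset.univ_sum_single v, map_sum]
  refine Finset.sum_eq_zero fun p _ => ?_
  have h1 : ψ (v p) = 0 := congrArg Subtype.val (LinearMap.congr_fun hg (v p))
  have h2 := hψ (v p) p 1
  rw [h1, du_zero, one_smul] at h2
  exact h2.symm
end dual

section main
variable (K : Type) [Field K] {A : Type} [Ring A] [Algebra K A] [FiniteDimensional K A]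
  {T : ModuleCat.{0} A → Prop}

/-- shifted weight data -/
def Wt.shift (D : Wt A) (d : ℕ) : Wt A where
  Q := (D.Q × Fin (d+1)) ⊕ Unit
  P := D.P × Fin (d+1)
  s := Sum.elim (fun q => D.s q.1) (fun _ => 1)
  t p := D.t p.1
  hs := by
    rintro (q | q)
    · exact D.hs q.1
    · exact one_mul 1
  ht p := D.ht p.1

lemma Wt.w_shift (D : Wt A) (d : ℕ) (X : Type) [AddCommGroup X] [Module A X] :
    (D.shift d).w K X = (d + 1) * D.w K X + dm K (A := A) X := by
  have h := D.w_bl K (Fin (d+1)) X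
  rw [Fintype.card_fin] at h
  push_cast at h
  rw [← h, ← ed_one]
  change ∑ q : (D.Q × Fin (d+1)) ⊕ Unit, (ed K ((D.shift d).s q) X : ℤ) - ∑ p : D.P × Fin (d+1), (ed K (D.t p.1) X : ℤ) =
    ∑ q : D.Q × Fin (d+1), (ed K (D.s q.1) X : ℤ) - ∑ p : D.P × Fin (d+1), (ed K (D.t p.1) X : ℤ) + _
  rw [Fintype.sum_sum_type]
  simp only [Finset.univ_unique, Finset.sum_singleton]
  simp only [Wt.shift, Sum.elim_inl, Sum.elim_inr]
  ring

lemma w_sub0 (D : Wt A) {X : Type} [AddCommGroup X] [Module A X] [Subsingleton X] : D.w K X = 0 := by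
  have h0 := D.w_sub K (⊥ : Submodule A X)
  have h5 : D.w K (⊥ : Submodule A X) = D.w K X := D.w_iso K
    { toFun := fun x => x.1, invFun := fun x => 0, map_add' := fun _ _ => rfl,
      map_smul' := fun _ _ => rfl, left_inv := fun _ => Subsingleton.elim _ _,
      right_inv := fun _ => Subsingleton.elim _ _ }
  have h6 : D.w K (X ⧸ (⊥ : Submodule A X)) = D.w K X := D.w_iso K
    (Submodule.quotEquivOfEqBot _ rfl)
  omega

lemma dm_sub0 {X : Type} [AddCommGroup X] [Module A X] [Subsingleton X] : dm K (A := A) X = 0 := by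
  letI := Module.compHom X (algebraMap K A)
  haveI := kst K (A := A) X
  rw [dm_eq]
  exact finrank_zero_of_subsingleton

lemma ff_main [Infinite K] (hT : IsTorsionClass A T) (D : Wt A)
    (hpos : ∀ (X : Type) [AddCommGroup X] [Module A X], T (ModuleCat.of A X) → 0 ≤ D.w K X)
    (hneg : ∀ (X : Type) [AddCommGroup X] [Module A X] [Module.Finite A X] [Nontrivial X], Fr T X → D.w K X < 0)
    (M : ModuleCat.{0} A) (hM : T M)
    (hgen : ∀ T' : ModuleCat.{0} A → Prop, IsTorsionClass A T' → T' M → ∀ X, T X → T' X) :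
    FunctoriallyFinite A T := by
  haveI : IsNoetherianRing A := IsNoetherianRing.of_finite K A
  haveI : Module.Finite A M := hT.fin _ hM
  -- first presentation
  obtain ⟨n, f, hf, hfM⟩ := D.exists_TF K M (fun L => hpos _ (T_surj hT (X := M) hM L.mkQ L.mkQ_surjective))
  have hD1 : ∀ (X : Type) [AddCommGroup X] [Module A X] [Module.Finite A X] [Nontrivial X], Fr T X → 
      ¬ (D.bl (Fin (n+1))).TF f X := by
    intro X _ _ _ _ hX hTF
    have h1 := Wt.TF_w K hf hTF
    rw [Wt.w_bl, Fintype.card_fin] at h1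
    have h2 := hneg X hX
    have : 0 ≤ D.w K X := nonneg_of_mul_nonneg_right h1 (by positivity)
    omega
  have hTF : ∀ (X : Type) [AddCommGroup X] [Module A X], T (ModuleCat.of A X) → (D.bl (Fin (n+1))).TF f X :=
    fun X _ _ hX => (hgen _ (Wt.TF_torsion hf) ⟨inferInstance, hfM⟩ _ hX).2
  set N := NN K (D.bl (Fin (n+1))) f with hN
  have hNF : Fr T N := fun Z _ _ hZ g => NN_TF K (hTF Z hZ) g
  haveI : Module.Finite A N := inferInstance
  set d := dm K (A := A) N with hd
  -- the filtration principle
  have filt : ∀ (L : Type) [AddCommGroup L] [Module A L] [Module.Finite A L] [Nontrivial L], Fr T L →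
      ∃ g : L →ₗ[A] N, LinearMap.ker g ≠ ⊤ := by
    intro L _ _ _ _ hL
    obtain ⟨g, hg⟩ := exists_to_NN K hf (hD1 L hL)
    exact ⟨g, fun h => hg (LinearMap.ker_eq_top.1 h)⟩
  have bound : ∀ (m : ℕ) (L : Type) [AddCommGroup L] [Module A L] [Module.Finite A L], dm K (A := A) L = m →
      Fr T L → (d : ℤ) * D.w K L ≤ - (dm K (A := A) L : ℤ) := by
    intro m
    induction m using Nat.strong_induction_on with
    | _ m ih =>
    intro L _ _ _ hm hL
    rcases subsingleton_or_nontrivial L with hs | hn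
    · rw [w_sub0, dm_sub0]; simp
    · obtain ⟨g, hg⟩ := filt L hL
      have h1 := ih _ (by rw [← hm]; exact dm_lt K _ hg) (LinearMap.ker g) rfl
        (Fr_inj hL (LinearMap.ker g).subtype Subtype.val_injective)
      have h2 := D.w_sub K (LinearMap.ker g)
      have h3 := dm_sub K (A := A) (LinearMap.ker g)
      rw [D.w_iso K g.quotKerEquivRange] at h2
      rw [dm_iso K g.quotKerEquivRange] at h3
      haveI : Nontrivial (LinearMap.range g) := by
        rw [Submodule.nontrivial_iff_ne_bot]
        intro hb
        exact hg (LinearMap.ker_eq_top.2 (LinearMap.range_eq_bot.1 hb))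
      have h4 := hneg (LinearMap.range g) (Fr_inj hNF (LinearMap.range g).subtype Subtype.val_injective)
      have h5 := dm_sub K (A := A) (LinearMap.range g)
      rw [← hd] at h5
      rw [h2, h3]
      push_cast
      have h6 : (d : ℤ) * D.w K (LinearMap.range g) ≤ d * (-1) :=
        mul_le_mul_of_nonneg_left (by omega) (by positivity)
      have h7 : (dm K (A := A) (LinearMap.range g) : ℤ) ≤ d := by omega
      rw [mul_add]
      linarith
  -- shifted weight
  let D' := D.shift d
  have hpos' : ∀ (X : Type) [AddCommGroup X] [Module A X] [Nontrivial X], T (ModuleCat.of A X) → 0 < D'.w K X := by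
    intro X _ _ _ hX
    haveI : Module.Finite A X := hT.fin _ hX
    have h1 := hpos X hX
    have h2 := dm_pos K (A := A) (X := X)
    rw [Wt.w_shift]
    have : 0 ≤ ((d : ℤ) + 1) * D.w K X := by positivity
    omega
  have hneg' : ∀ (X : Type) [AddCommGroup X] [Module A X] [Module.Finite A X], Fr T X → D'.w K X ≤ 0 := by
    intro X _ _ _ hX
    rcases subsingleton_or_nontrivial X with hs | hn
    · rw [w_sub0]
    · have h1 := hneg X hX
      have h2 := bound _ X rfl hX
      rw [Wt.w_shift, add_mul]
      linarith
  obtain ⟨κ, _, _, f', hf', hfM', hfN'⟩ := D'.exists_both K M N (fun L => by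
    rcases subsingleton_or_nontrivial (M ⧸ L) with hs | hn
    · rw [w_sub0]
    · exact (hpos' _ (T_surj hT (X := M) hM L.mkQ L.mkQ_surjective)).le)
    (fun L => hneg' L (Fr_inj hNF L.subtype Subtype.val_injective))
  have hIF : ∀ (m : ℕ) (L : Type) [AddCommGroup L] [Module A L] [Module.Finite A L], dm K (A := A) L = m →
      Fr T L → (D'.bl κ).IF f' L := by
    intro m
    induction m using Nat.strong_induction_on with
    | _ m ih =>
    intro L _ _ _ hm hL
    rcases subsingleton_or_nontrivial L with hs | hn
    · intro u hu q; exact Subsingleton.elim _ _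
    · obtain ⟨g, hg⟩ := filt L hL
      have h1 := ih _ (by rw [← hm]; exact dm_lt K _ hg) (LinearMap.ker g) rfl
        (Fr_inj hL (LinearMap.ker g).subtype Subtype.val_injective)
      exact Wt.IF_ext hf' g hfN' h1
  obtain ⟨C, hC, hCg⟩ := exists_gen K hT hf'
    (fun X _ _ hX => (hgen _ (Wt.TF_torsion hf') ⟨inferInstance, hfM'⟩ _ hX).2)
    (fun X _ _ _ hX => hIF _ X rfl hX)
    (fun X _ _ _ hX => by
      rw [Wt.w_bl]
      have := hpos' X hX
      have : 0 < Fintype.card κ := Fintype.card_pos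
      positivity)
  exact ff_of_gen K hT C hC hCg

lemma exists_cover (hT : IsTorsionClass A T) {S : Set (ModuleCat.{0} A)} (hS : S.Finite) (h : ∀ B ∈ S, T B) :
    ∃ M : ModuleCat.{0} A, T M ∧ ∀ B ∈ S, IsQuotientOf A B M := by
  induction S, hS using Set.Finite.induction_on with
  | empty => exact ⟨ModuleCat.of A PUnit, T_sub hT, by simp⟩
  | @insert B S _ _ ih =>
    obtain ⟨M, hM, hq⟩ := ih (fun B hB => h B (Set.mem_insert_of_mem _ hB))
    refine ⟨ModuleCat.of A (B × M), T_prod hT (h B (Set.mem_insert _ _)) hM, ?_⟩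
    rintro B' (rfl | hB')
    · exact ⟨LinearMap.fst A B' M, LinearMap.fst_surjective⟩
    · obtain ⟨g, hg⟩ := hq B' hB'
      exact ⟨g.comp (LinearMap.snd A B M), hg.comp LinearMap.snd_surjective⟩

end main

lemma stmt13_aux {A : Type} [Ring A] (K : Type) [Field K] [IsAlgClosed K] [Algebra K A] [FiniteDimensional K A]
    (θ : ModuleCat.{0} A → ℝ) (hθ : IsStability A θ)
    (hint : ∀ M : ModuleCat.{0} A, Module.Finite A M → ∃ k : ℤ, θ M = (k : ℝ))
    (hnf : ¬ FunctoriallyFinite A (tThetaBar A θ)) :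
    ∃ S : Set (ModuleCat.{0} A), IsSemibrick A S ∧ S.Infinite ∧
      tThetaBar A θ = torsClosure A (fun X => X ∈ S) := by
  haveI : IsNoetherianRing A := IsNoetherianRing.of_finite K A
  haveI : IsArtinianRing A := IsArtinianRing.of_finite K A
  have hT := tb_torsion hθ
  have hgen := semibrick_gen K hθ hint
  refine ⟨SS (tThetaBar A θ), SS_semibrick hT, ?_, hgen⟩
  intro hfin
  apply hnf
  have hSS : ∀ B ∈ SS (tThetaBar A θ), tThetaBar A θ B := by
    intro B hB
    rw [hgen]
    intro T' _ hT'
    exact hT' B hB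
  obtain ⟨M, hM, hq⟩ := exists_cover hT hfin hSS
  obtain ⟨D, hD⟩ := represent K hθ hint
  refine ff_main K hT D ?_ ?_ M hM ?_
  · intro X _ _ hX
    haveI : Module.Finite A X := hT.fin _ hX
    have := tb_nonneg hθ hX
    rw [hD X] at this
    exact_mod_cast this
  · intro X _ _ _ _ hX
    have := tf_neg hθ (X := X) hX
    rw [hD X] at this
    exact_mod_cast this
  · intro T' hT' hM' X hX
    rw [hgen] at hX
    refine hX T' hT' fun B hB => ?_
    exact hT'.quot M B hM' (hT.fin _ (hSS B hB)) (hq B hB)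
end TorsPaper

namespace TorsPaper

variable (A : Type) [Ring A]

/-- Over an algebraically closed field, for an integer-valued stability
function `θ` (a lattice point), if `\bar T_θ` is not functorially finite, then there is an
infinite semibrick `𝒮` with `\bar T_θ = T(𝒮)`. -/
theorem stmt13 (K : Type) [Field K] [IsAlgClosed K] [Algebra K A] [FiniteDimensional K A]
    (θ : ModuleCat.{0} A → ℝ) (hθ : IsStability A θ)
    (hint : ∀ M : ModuleCat.{0} A, Module.Finite A M → ∃ k : ℤ, θ M = (k : ℝ))
    (hnf : ¬ FunctoriallyFinite A (tThetaBar A θ)) :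
    ∃ S : Set (ModuleCat.{0} A), IsSemibrick A S ∧ S.Infinite ∧
      tThetaBar A θ = torsClosure A (fun X => X ∈ S) := by
  exact stmt13_aux K θ hθ hint hnf

end TorsPaper
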